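/- Let N be an atomic nest and J a two-sided ideal of T(N). Then J is a maximal two-sided ideal of T(N) if and only if J ∩ D(N) is a maximal two-sided ideal of the diagonal von Neumann algebra D(N). -/

import Mathlib

noncomputable section

universe u

variable {H : Type u} [NormedAddCommGroup H] [InnerProductSpace ℂ H] [CompleteSpace H]
  [TopologicalSpace.SeparableSpace H]

/-- A nest: a linearly ordered set of orthogonal projections containing `0` and `1`. -/
structure Nest (H : Type u) [NormedAddCommGroup H] [InnerProductSpace ℂ H]
    [CompleteSpace H] where
  carrier : Set (H →L[ℂ] H)
  isProj : ∀ P ∈ carrier, IsSelfAdjoint P ∧ P * P = P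
  zero_mem : (0 : H →L[ℂ] H) ∈ carrier
  one_mem : (1 : H →L[ℂ] H) ∈ carrier
  chain : ∀ P ∈ carrier, ∀ Q ∈ carrier, Q * P = P ∨ P * Q = Q

/-- Order on projections: `P ≤ Q` iff `ran P ⊆ ran Q`. -/
def projLE (P Q : H →L[ℂ] H) : Prop := Q * P = P

/-- Strict order on projections. -/
def projLT (P Q : H →L[ℂ] H) : Prop := projLE P Q ∧ P ≠ Q

/-- The nest algebra: all bounded operators leaving invariant the range of every
projection in the nest, i.e. `(1 - P) X P = 0` for every `P` in the nest. -/
def nestAlgebra (𝒩 : Nest H) : Subalgebra ℂ (H →L[ℂ] H) where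
  carrier := {X | ∀ P ∈ 𝒩.carrier, (1 - P) * X * P = 0}
  mul_mem' := by
    intro X Y hX hY P hP
    have hX' := hX P hP
    have hY' := hY P hP
    have hYP : Y * P = P * (Y * P) := by
      have h : (1 - P) * Y * P + P * Y * P = Y * P := by noncomm_ring
      rw [hY', zero_add] at h
      rw [← mul_assoc]; exact h.symm
    calc (1 - P) * (X * Y) * P = (1 - P) * X * (Y * P) := by noncomm_ring
      _ = (1 - P) * X * (P * (Y * P)) := by rw [← hYP]
      _ = ((1 - P) * X * P) * (Y * P) := by noncomm_ring
      _ = 0 := by rw [hX', zero_mul]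
  one_mem' := by
    intro P hP
    have h := (𝒩.isProj P hP).2
    calc (1 - P) * 1 * P = P - P * P := by noncomm_ring
      _ = 0 := by rw [h, sub_self]
  add_mem' := by
    intro X Y hX hY P hP
    have hX' := hX P hP
    have hY' := hY P hP
    calc (1 - P) * (X + Y) * P = (1 - P) * X * P + (1 - P) * Y * P := by noncomm_ring
      _ = 0 := by rw [hX', hY', add_zero]
  zero_mem' := by intro P hP; simp
  algebraMap_mem' := by
    intro c P hP
    have h := (𝒩.isProj P hP).2
    have h1 : (1 - P) * 1 * P = 0 := by
      calc (1 - P) * 1 * P = P - P * P := by noncomm_ring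
        _ = 0 := by rw [h, sub_self]
    calc (1 - P) * (algebraMap ℂ (H →L[ℂ] H) c) * P
        = (1 - P) * (c • (1 : H →L[ℂ] H)) * P := by rw [Algebra.algebraMap_eq_smul_one]
      _ = c • ((1 - P) * 1 * P) := by rw [mul_smul_comm, smul_mul_assoc]
      _ = 0 := by rw [h1, smul_zero]

/-- `J` is a two-sided ideal of the algebra (given as a subset) `Alg`. -/
def IsIdealOfSet (Alg J : Set (H →L[ℂ] H)) : Prop :=
  J ⊆ Alg ∧ (0 : H →L[ℂ] H) ∈ J ∧ (∀ X ∈ J, ∀ Y ∈ J, X + Y ∈ J) ∧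
    (∀ c : ℂ, ∀ X ∈ J, c • X ∈ J) ∧ ∀ T ∈ Alg, ∀ X ∈ J, T * X ∈ J ∧ X * T ∈ J

/-- `J` is a maximal (proper) two-sided ideal of `Alg`. -/
def IsMaximalIdealOfSet (Alg J : Set (H →L[ℂ] H)) : Prop :=
  IsIdealOfSet Alg J ∧ J ≠ Alg ∧
    ∀ J', IsIdealOfSet Alg J' → J ⊆ J' → J' = J ∨ J' = Alg

/-- The diagonal algebra `D(𝒩)`: the commutant of the nest. -/
def diagAlgebra (𝒩 : Nest H) : Set (H →L[ℂ] H) :=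
  {X | ∀ P ∈ 𝒩.carrier, X * P = P * X}

/-- An atom of the nest: a minimal interval `N - M`. -/
def IsAtomOf (𝒩 : Nest H) (E : H →L[ℂ] H) : Prop :=
  ∃ M ∈ 𝒩.carrier, ∃ N ∈ 𝒩.carrier, projLT M N ∧ E = N - M ∧
    ∀ P ∈ 𝒩.carrier, projLE M P → projLE P N → P = M ∨ P = N

/-- The nest is atomic: its atoms sum (strongly) to the identity. -/
def IsAtomicNest (𝒩 : Nest H) : Prop :=
  ∃ E : ℕ → H →L[ℂ] H, (∀ n, IsAtomOf 𝒩 (E n) ∨ E n = 0) ∧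
    (∀ m n, m ≠ n → E m * E n = 0) ∧ ∀ h : H, HasSum (fun n => E n h) h

set_option linter.unusedSectionVars false

section MixedDet

open Polynomial

variable {ι : Type*} [Fintype ι] [DecidableEq ι] {R R' : Type*} [CommRing R] [CommRing R'] {r : ℕ}

/-- The determinant of the principal submatrix of `diag z - A` on `S`. -/
def principalDet (A : Matrix ι ι R) (z : ι → R) (S : Finset ι) : R :=
  Matrix.det (Matrix.of fun i j =>
    if i ∈ S then (if i = j then z i else 0) - A i j else if i = j then 1 else 0)

/-- The sum over all ways of distributing the elements of `L` among the sets `S k` of the product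
of the corresponding principal minors. -/
def mixedDet (A : Matrix ι ι R) (z : Fin r → ι → R) : List ι → (Fin r → Finset ι) → R
  | [], S => ∏ k, principalDet A (z k) (S k)
  | i :: L, S => ∑ k, mixedDet A z L (Function.update S k (insert i (S k)))

theorem principalDet_map (f : R →+* R') (A : Matrix ι ι R) (z : ι → R) (S : Finset ι) :
    f (principalDet A z S) = principalDet (A.map f) (fun i => f (z i)) S := by
  unfold principalDet
  rw [RingHom.map_det]
  congr 1
  ext i j
  simp only [RingHom.mapMatrix_apply, Matrix.map_apply, Matrix.of_apply]
  split_ifs <;> simp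

theorem mixedDet_map (f : R →+* R') (A : Matrix ι ι R) (z : Fin r → ι → R) (L : List ι)
    (S : Fin r → Finset ι) :
    f (mixedDet A z L S) = mixedDet (A.map f) (fun k i => f (z k i)) L S := by
  induction L generalizing S with
  | nil => simp [mixedDet, principalDet_map]
  | cons i L ih => simp [mixedDet, ih]

theorem principalDet_congr (A : Matrix ι ι R) {z w : ι → R} {S : Finset ι}
    (h : ∀ i ∈ S, z i = w i) : principalDet A z S = principalDet A w S := by
  unfold principalDet
  congr 1
  ext i j
  simp only [Matrix.of_apply]
  by_cases h1 : i ∈ S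
  · simp [h1, h _ h1]
  · simp [h1]

theorem principalDet_eq_det (A : Matrix ι ι R) (z : ι → R) (S : Finset ι) :
    principalDet A z S =
      ((Matrix.diagonal z - A).toSquareBlockProp fun i => i ∈ S).det := by
  unfold principalDet
  rw [Matrix.twoBlockTriangular_det _ (fun i => i ∈ S)]
  · have h2 : (Matrix.toSquareBlockProp (Matrix.of fun i j =>
        if i ∈ S then (if i = j then z i else 0) - A i j else if i = j then 1 else 0)
        fun i => ¬ i ∈ S) = 1 := by
      ext i j
      simp [Matrix.toSquareBlockProp, Matrix.one_apply, i.2, Subtype.ext_iff]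
    have h3 : (Matrix.toSquareBlockProp (Matrix.of fun i j =>
        if i ∈ S then (if i = j then z i else 0) - A i j else if i = j then 1 else 0)
        fun i => i ∈ S) = (Matrix.diagonal z - A).toSquareBlockProp fun i => i ∈ S := by
      ext i j
      simp [Matrix.toSquareBlockProp, i.2, Matrix.diagonal_apply]
    rw [h2, h3, Matrix.det_one, mul_one]
    congr!
  · intro i hi j hj
    simp only [Matrix.of_apply, hi, if_false]
    rw [if_neg]
    rintro rfl
    exact hi hj

theorem principalDet_transpose (A : Matrix ι ι R) (z : ι → R) (S : Finset ι) :
    principalDet A.transpose z S = principalDet A z S := by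
  rw [principalDet_eq_det, principalDet_eq_det, ← Matrix.det_transpose]
  congr 1
  ext i j
  by_cases h : i = j
  · subst h; simp [Matrix.toSquareBlockProp]
  · have : j.1 ≠ i.1 := fun h' => h (Subtype.ext h'.symm)
    simp [Matrix.toSquareBlockProp, this, this.symm]

theorem mixedDet_transpose (A : Matrix ι ι R) (z : Fin r → ι → R) (L : List ι)
    (S : Fin r → Finset ι) : mixedDet A.transpose z L S = mixedDet A z L S := by
  induction L generalizing S with
  | nil => simp [mixedDet, principalDet_transpose]
  | cons i L ih => simp [mixedDet, ih]

theorem principalDet_insert (A : Matrix ι ι R) {z w w' : ι → R} {S : Finset ι} {i : ι} {a b : R}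
    (hi : i ∉ S) (h1 : ∀ j ∈ S, w j = z j) (h2 : w i = a + b) (h3 : ∀ j ∈ S, w' j = z j)
    (h4 : w' i = b) :
    principalDet A w (insert i S) = a * principalDet A z S + principalDet A w' (insert i S) := by
  unfold principalDet
  set M : Matrix ι ι R := Matrix.of fun k j =>
    if k ∈ insert i S then (if k = j then w' k else 0) - A k j else if k = j then 1 else 0 with hM
  have e1 : (Matrix.of fun k j =>
      if k ∈ insert i S then (if k = j then w k else 0) - A k j else if k = j then 1 else 0) =
      M.updateRow i (a • Pi.single i 1 + M i) := by
    ext k j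
    by_cases hk : k = i
    · subst hk
      by_cases hj : k = j
      · subst hj; simp [hM, h2, h4]; ring
      · simp [hM, hj, Ne.symm hj]
    · have : i ≠ k := fun h => hk h.symm
      by_cases hkS : k ∈ S
      · simp [hM, hk, hkS, h1 k hkS, h3 k hkS]
      · simp [hM, hk, hkS]
  have e2 : (Matrix.of fun k j =>
      if k ∈ S then (if k = j then z k else 0) - A k j else if k = j then 1 else 0) =
      M.updateRow i (Pi.single i 1) := by
    ext k j
    by_cases hk : k = i
    · subst hk
      by_cases hj : k = j
      · subst hj; simp [hi]
      · simp [hi, hj, Ne.symm hj]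
    · by_cases hkS : k ∈ S
      · simp [hM, hk, hkS, h3 k hkS]
      · simp [hM, hk, hkS]
  rw [e1, e2, Matrix.det_updateRow_add, Matrix.det_updateRow_smul, Matrix.updateRow_eq_self]

theorem natDegree_prod_linear (s : Finset (Fin r)) (α β : Fin r → R) :
    (∏ k ∈ s, (C (α k) * X + C (β k))).natDegree ≤ s.card ∧
      (∏ k ∈ s, (C (α k) * X + C (β k))).coeff s.card = ∏ k ∈ s, α k := by
  have h1 : ∀ k ∈ s, (C (α k) * X + C (β k)).natDegree ≤ 1 := fun k _ => natDegree_linear_le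
  refine ⟨(natDegree_prod_le s _).trans ((Finset.sum_le_sum h1).trans (by simp)), ?_⟩
  have := coeff_prod_of_natDegree_le s _ 1 h1
  simpa using this

theorem coeff_prod_linear (s : Finset (Fin r)) (α β : Fin r → R) (n : ℕ) (hn : n + 1 = s.card) :
    (∏ k ∈ s, (C (α k) * X + C (β k))).coeff n = ∑ k ∈ s, β k * ∏ l ∈ s.erase k, α l := by
  induction s using Finset.induction_on generalizing n with
  | empty => simp at hn
  | insert a s ha ih =>
    rw [Finset.card_insert_of_notMem ha] at hn
    have hn' : n = s.card := by omega
    rw [Finset.prod_insert ha, add_mul, coeff_add, mul_assoc, coeff_C_mul, coeff_C_mul, hn',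
      (natDegree_prod_linear s α β).2, Finset.sum_insert ha, Finset.erase_insert ha, add_comm]
    congr 1
    rcases Nat.eq_zero_or_pos s.card with h0 | h0
    · have : s = ∅ := Finset.card_eq_zero.mp h0
      subst this
      simp
    · obtain ⟨m, hm⟩ : ∃ m, m + 1 = s.card := ⟨s.card - 1, by omega⟩
      rw [← hm, coeff_X_mul, ih m hm, Finset.mul_sum]
      refine Finset.sum_congr rfl fun k hk => ?_
      have hka : k ≠ a := fun h => ha (h ▸ hk)
      rw [Finset.erase_insert_of_ne hka.symm, Finset.prod_insert (by simp [ha])]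
      ring

theorem mixedDet_line (A : Matrix ι ι R) (z : Fin (r + 1) → ι → R) (ν : Fin (r + 1) → R) (i : ι)
    (L : List ι) (hL : i ∉ L) (S : Fin (r + 1) → Finset ι) (hS : ∀ k, i ∉ S k)
    (G : R[X]) (hG : G = mixedDet (A.map C)
      (fun k j => if j = i then C (ν k) * X + C (z k i) else C (z k j)) L
      (fun k => insert i (S k))) :
    G.natDegree ≤ r + 1 ∧ G.coeff (r + 1) = (∏ k, ν k) * mixedDet A z L S ∧
      G.coeff r = ∑ k, (∏ l ∈ Finset.univ.erase k, ν l) *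
        mixedDet A z L (Function.update S k (insert i (S k))) := by
  subst hG
  induction L generalizing S with
  | nil =>
    have hk : ∀ k, principalDet (A.map C)
        (fun j => if j = i then C (ν k) * X + C (z k i) else C (z k j)) (insert i (S k)) =
        C (ν k * principalDet A (z k) (S k)) * X + C (principalDet A (z k) (insert i (S k))) := by
      intro k
      rw [principalDet_insert (A.map C) (z := fun j => C (z k j))
        (w' := fun j => C (z k j)) (hS k) _ (if_pos rfl) (fun _ _ => rfl) rfl,
        ← principalDet_map C, ← principalDet_map C, C_mul]
      · ring
      · intro j hj
        rw [if_neg]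
        rintro rfl
        exact hS k hj
    simp only [mixedDet, hk]
    refine ⟨?_, ?_, ?_⟩
    · simpa using (natDegree_prod_linear Finset.univ (fun k => ν k * principalDet A (z k) (S k))
        (fun k => principalDet A (z k) (insert i (S k)))).1
    · have := (natDegree_prod_linear Finset.univ (fun k => ν k * principalDet A (z k) (S k))
        (fun k => principalDet A (z k) (insert i (S k)))).2
      rw [Finset.card_univ, Fintype.card_fin] at this
      rw [this, Finset.prod_mul_distrib]
    · have := coeff_prod_linear Finset.univ (fun k => ν k * principalDet A (z k) (S k))
        (fun k => principalDet A (z k) (insert i (S k))) r (by simp)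
      rw [this]
      refine Finset.sum_congr rfl fun k _ => ?_
      rw [Finset.prod_mul_distrib,
        ← Finset.mul_prod_erase Finset.univ (fun x => principalDet A (z x) _) (Finset.mem_univ k),
        Function.update_self, mul_left_comm]
      congr 2
      refine Finset.prod_congr rfl fun l hl => ?_
      rw [Function.update_of_ne (Finset.ne_of_mem_erase hl)]
  | cons m L ih =>
    simp only [List.mem_cons, not_or] at hL
    have key : ∀ l, (Function.update (fun k => insert i (S k)) l (insert m (insert i (S l)))) =
        fun k => insert i (Function.update S l (insert m (S l)) k) := by
      intro l
      ext1 k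
      by_cases h : k = l
      · subst h; simp [Finset.insert_comm]
      · simp [h]
    have hS' : ∀ l k, i ∉ Function.update S l (insert m (S l)) k := by
      intro l k
      by_cases h : k = l
      · subst h; simp [hL.1, hS]
      · simp [h, hS]
    have ih' := fun l => ih hL.2 (Function.update S l (insert m (S l))) (hS' l)
    simp only [mixedDet, key]
    refine ⟨natDegree_sum_le_of_forall_le _ _ fun l _ => (ih' l).1, ?_, ?_⟩
    · rw [finsetSum_coeff, Finset.mul_sum]
      exact Finset.sum_congr rfl fun l _ => (ih' l).2.1
    · rw [finsetSum_coeff]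
      simp_rw [fun l => (ih' l).2.2, Finset.mul_sum]
      rw [Finset.sum_comm]
      refine Finset.sum_congr rfl fun k _ => Finset.sum_congr rfl fun l _ => ?_
      congr 2
      ext1 q
      by_cases h1 : q = k <;> by_cases h2 : q = l
      · subst h1; subst h2; simp [Finset.insert_comm]
      · subst h1; simp [h2]
      · subst h2; simp [h1]
      · simp [h1, h2]

theorem mixedDet_derivative (A : Matrix ι ι R) (z : Fin r → ι → R) (j : ι)
    (L : List ι) (hL : j ∉ L) (S : Fin r → Finset ι) (hS : ∀ k, j ∈ S k) :
    derivative (mixedDet (A.map C) (fun k i => if i = j then X + C (z k i) else C (z k i)) L S) =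
      ∑ k, mixedDet (A.map C) (fun k i => if i = j then X + C (z k i) else C (z k i)) L
        (Function.update S k ((S k).erase j)) := by
  induction L generalizing S with
  | nil =>
    have hk : ∀ k, derivative (principalDet (A.map C)
        (fun i => if i = j then X + C (z k i) else C (z k i)) (S k)) =
        principalDet (A.map C) (fun i => if i = j then X + C (z k i) else C (z k i)) ((S k).erase j) := by
      intro k
      have h0 : j ∉ (S k).erase j := by simp
      have h1 : ∀ i ∈ (S k).erase j, (if i = j then X + C (z k i) else C (z k i)) = C (z k i) := by
        intro i hi
        rw [if_neg (Finset.ne_of_mem_erase hi)]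
      conv_lhs => rw [← Finset.insert_erase (hS k)]
      rw [principalDet_congr (A.map C) (z := fun i => if i = j then X + C (z k i) else C (z k i))
        (w := fun i => C (z k i)) h1,
        principalDet_insert (A.map C) (z := fun i => C (z k i)) (a := X)
        (w' := fun i => C (z k i)) h0 h1 (if_pos rfl) (fun _ _ => rfl) rfl,
        ← principalDet_map C, ← principalDet_map C]
      simp
    simp only [mixedDet]
    rw [Finset.prod_eq_multiset_prod, derivative_prod]
    show (Multiset.map _ (Finset.univ : Finset (Fin r)).val).sum = _
    rw [← Finset.sum_eq_multiset_sum]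
    refine Finset.sum_congr rfl fun k _ => ?_
    rw [hk, ← Finset.erase_val, ← Finset.prod_eq_multiset_prod, mul_comm,
      ← Finset.mul_prod_erase Finset.univ (fun x => principalDet _ _ _) (Finset.mem_univ k),
      Function.update_self]
    congr 1
    refine Finset.prod_congr rfl fun l hl => ?_
    rw [Function.update_of_ne (Finset.ne_of_mem_erase hl)]
  | cons m L ih =>
    simp only [List.mem_cons, not_or] at hL
    have hS' : ∀ l k, j ∈ Function.update S l (insert m (S l)) k := by
      intro l k
      by_cases h : k = l
      · subst h; simp [hS]
      · simp [h, hS]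
    have ih' := fun l => ih hL.2 (Function.update S l (insert m (S l))) (hS' l)
    simp only [mixedDet, derivative_sum, ih']
    rw [Finset.sum_comm]
    refine Finset.sum_congr rfl fun k _ => Finset.sum_congr rfl fun l _ => ?_
    congr 1
    ext1 q
    by_cases h1 : q = k <;> by_cases h2 : q = l
    · subst h1; subst h2
      simp [Finset.erase_insert_of_ne (Ne.symm hL.1)]
    · subst h1; simp [h2]
    · subst h2; simp [h1]
    · simp [h1, h2]

theorem mixedDet_congr (A : Matrix ι ι R) {z w : Fin r → ι → R} {L : List ι}
    {S : Fin r → Finset ι} (h : ∀ k i, i ∈ L ∨ i ∈ S k → z k i = w k i) :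
    mixedDet A z L S = mixedDet A w L S := by
  induction L generalizing S with
  | nil =>
    exact Finset.prod_congr rfl fun k _ => principalDet_congr A fun i hi => h k i (Or.inr hi)
  | cons m L ih =>
    refine Finset.sum_congr rfl fun l _ => ih fun k i hi => h k i ?_
    rcases hi with hi | hi
    · exact Or.inl (List.mem_cons_of_mem _ hi)
    · by_cases hkl : k = l
      · subst hkl
        rw [Function.update_self, Finset.mem_insert] at hi
        rcases hi with rfl | hi
        · exact Or.inl List.mem_cons_self
        · exact Or.inr hi
      · rw [Function.update_of_ne hkl] at hi
        exact Or.inr hi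

theorem mixedDet_map_of_transpose (f : R →+* R) {A : Matrix ι ι R} (hA : A.map f = A.transpose)
    (z : Fin r → ι → R) (L : List ι) (S : Fin r → Finset ι) :
    f (mixedDet A z L S) = mixedDet A (fun k i => f (z k i)) L S := by
  rw [mixedDet_map, hA, mixedDet_transpose]

end MixedDet

section RealRooted

open Polynomial

theorem exists_map_ofReal_eq {f : ℂ[X]} (h : f.map (starRingEnd ℂ) = f) :
    ∃ g : ℝ[X], g.map (algebraMap ℝ ℂ) = f := by
  rw [← mem_lifts, lifts_iff_coeff_lifts]
  intro n
  have : (starRingEnd ℂ) (f.coeff n) = f.coeff n := by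
    conv_rhs => rw [← h]
    rw [coeff_map]
  exact ⟨(f.coeff n).re, Complex.conj_eq_iff_re.mp this⟩

theorem splits_of_aeval_ne_zero {g : ℝ[X]} (h : ∀ t : ℂ, 0 < t.im → aeval t g ≠ 0) :
    g.Splits := by
  refine Splits.of_splits_map (algebraMap ℝ ℂ) (IsAlgClosed.splits _) fun a ha => ?_
  have ha' : aeval a g = 0 := by
    have := isRoot_of_mem_roots ha
    rwa [IsRoot, eval_map_algebraMap] at this
  have h1 : ¬ 0 < a.im := fun h0 => h a h0 ha'
  have h2 : ¬ 0 < (starRingEnd ℂ a).im := by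
    intro h0
    refine h _ h0 ?_
    rw [aeval_conj, ha', map_zero]
  simp only [Complex.conj_im, Left.neg_pos_iff, not_lt] at h1 h2
  exact ⟨a.re, Complex.ext rfl (by simpa using le_antisymm h2 h1)⟩

theorem Multiset.sum_im_neg {s : Multiset ℂ} (h0 : s ≠ 0) (h : ∀ x ∈ s, x.im < 0) :
    s.sum.im < 0 := by
  induction s using Multiset.induction_on with
  | empty => exact absurd rfl h0
  | cons a s ih =>
    rw [Multiset.sum_cons, Complex.add_im]
    have ha := h a (Multiset.mem_cons_self a s)
    by_cases hs : s = 0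
    · subst hs; simpa using ha
    · linarith [ih hs fun x hx => h x (Multiset.mem_cons_of_mem hx)]

theorem Multiset.sum_im_nonpos {s : Multiset ℂ} (h : ∀ x ∈ s, x.im ≤ 0) : s.sum.im ≤ 0 := by
  induction s using Multiset.induction_on with
  | empty => simp
  | cons a s ih =>
    rw [Multiset.sum_cons, Complex.add_im]
    linarith [h a (Multiset.mem_cons_self a s), ih fun x hx => h x (Multiset.mem_cons_of_mem hx)]

theorem Multiset.card_sq_le_sum_mul_sum_inv (s : Multiset ℝ) (h : ∀ x ∈ s, 0 < x) :
    0 ≤ s.sum ∧ 0 ≤ (s.map fun x => x⁻¹).sum ∧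
      (Multiset.card s : ℝ) ^ 2 ≤ s.sum * (s.map fun x => x⁻¹).sum := by
  induction s using Multiset.induction_on with
  | empty => simp
  | cons a s ih =>
    obtain ⟨h1, h2, h3⟩ := ih fun x hx => h x (Multiset.mem_cons_of_mem hx)
    have ha := h a (Multiset.mem_cons_self a s)
    rw [Multiset.map_cons, Multiset.sum_cons, Multiset.sum_cons, Multiset.card_cons]
    set S := s.sum
    set T := (s.map fun x => x⁻¹).sum
    have ha' : 0 < a⁻¹ := inv_pos.mpr ha
    refine ⟨by positivity, by positivity, ?_⟩
    have hn : (0 : ℝ) ≤ Multiset.card s := by positivity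
    have h5 : a * a⁻¹ = 1 := mul_inv_cancel₀ ha.ne'
    have h4 : 2 * (Multiset.card s : ℝ) ≤ a * T + S * a⁻¹ := by
      refine abs_le_of_sq_le_sq' ?_ (by positivity) |>.2
      have : (a * T) * (S * a⁻¹) = S * T := by
        calc (a * T) * (S * a⁻¹) = (a * a⁻¹) * (S * T) := by ring
          _ = S * T := by rw [h5, one_mul]
      nlinarith [sq_nonneg (a * T - S * a⁻¹)]
    push_cast
    nlinarith

open Filter Topology in
theorem eq_one_of_im_div_nonpos {g h : ℝ[X]} {x : ℝ} {m : ℕ} (hm : m ≠ 0)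
    (hg : g.eval x ≠ 0) (hh : h.eval x ≠ 0)
    (him : ∀ t : ℂ, 0 < t.im → (aeval t h / aeval t ((X - C x) ^ m * g)).im ≤ 0) :
    m = 1 ∧ 0 < h.eval x / g.eval x := by
  set b := h.eval x / g.eval x with hb
  have hb0 : b ≠ 0 := div_ne_zero hh hg
  have key : ∀ ω : ℂ, 0 < ω.im → ((b : ℂ) / ω ^ m).im ≤ 0 := by
    intro ω hω
    have hω0 : ω ≠ 0 := by rintro rfl; simp at hω
    have h1 : Tendsto (fun ε : ℝ => aeval ((x : ℂ) + ε * ω) h / aeval ((x : ℂ) + ε * ω) g / ω ^ m)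
        (𝓝[>] 0) (𝓝 ((b : ℂ) / ω ^ m)) := by
      have hc : ∀ f : ℝ[X], Tendsto (fun ε : ℝ => aeval ((x : ℂ) + ε * ω) f) (𝓝[>] 0)
          (𝓝 ((f.eval x : ℝ) : ℂ)) := by
        intro f
        have : Continuous fun ε : ℝ => aeval ((x : ℂ) + ε * ω) f := by fun_prop
        have h := this.tendsto 0
        simp only [Complex.ofReal_zero, zero_mul, add_zero] at h
        rw [show aeval (x : ℂ) f = ((f.eval x : ℝ) : ℂ) from aeval_algebraMap_apply_eq_algebraMap_eval x f] at h
        exact h.mono_left nhdsWithin_le_nhds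
      rw [hb]
      push_cast
      exact ((hc h).div (hc g) (by exact_mod_cast hg)).div_const _
    have h2 := (Complex.continuous_im.tendsto _).comp h1
    refine le_of_tendsto h2 ?_
    filter_upwards [self_mem_nhdsWithin] with ε hε
    have hε : 0 < ε := hε
    have hε0 : (ε : ℂ) ≠ 0 := by exact_mod_cast hε.ne'
    have h3 := him ((x : ℂ) + ε * ω) (by simpa using mul_pos hε hω)
    have h4 : aeval ((x : ℂ) + ε * ω) h / aeval ((x : ℂ) + ε * ω) ((X - C x) ^ m * g) =
        (((ε ^ m)⁻¹ : ℝ) : ℂ) *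
          (aeval ((x : ℂ) + ε * ω) h / aeval ((x : ℂ) + ε * ω) g / ω ^ m) := by
      simp only [map_mul, map_pow, map_sub, aeval_X, aeval_C, Complex.coe_algebraMap,
        add_sub_cancel_left, mul_pow]
      push_cast
      rw [div_div, mul_comm ((ε : ℂ) ^ m * ω ^ m), mul_comm ((ε : ℂ) ^ m), ← mul_assoc,
        ← div_div, mul_comm ((ε : ℂ) ^ m)⁻¹, ← div_eq_mul_inv]
    rw [h4, Complex.im_ofReal_mul] at h3
    exact nonpos_of_mul_nonpos_right h3 (by positivity)
  have hexp : ∀ a : ℝ, 0 < a → a < Real.pi * m →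
      ((b : ℂ) / Complex.exp (a * Complex.I)).im ≤ 0 := by
    intro a ha ha'
    have hm' : (0 : ℝ) < m := by positivity
    have := key (Complex.exp ((a / m : ℝ) * Complex.I)) (by
      rw [Complex.exp_ofReal_mul_I_im]
      refine Real.sin_pos_of_pos_of_lt_pi (by positivity) ?_
      rwa [div_lt_iff₀ hm'])
    rw [← Complex.exp_nat_mul] at this
    convert this using 4
    push_cast
    field_simp
  have hpi := Real.pi_pos
  have hm1 : (1 : ℝ) ≤ m := by exact_mod_cast Nat.one_le_iff_ne_zero.mpr hm
  have hpos : 0 ≤ b := by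
    have := hexp (Real.pi / 2) (by positivity) (by nlinarith)
    rw [show ((Real.pi / 2 : ℝ) : ℂ) * Complex.I = Real.pi / 2 * Complex.I by push_cast; rfl,
      Complex.exp_pi_div_two_mul_I] at this
    simpa using this
  refine ⟨?_, lt_of_le_of_ne hpos hb0.symm⟩
  by_contra hne
  have hm2 : (2 : ℝ) ≤ m := by exact_mod_cast (by omega : 2 ≤ m)
  have := hexp (Real.pi + Real.pi / 2) (by positivity) (by nlinarith)
  rw [show ((Real.pi + Real.pi / 2 : ℝ) : ℂ) * Complex.I =
    Real.pi * Complex.I + Real.pi / 2 * Complex.I by push_cast; ring, Complex.exp_add,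
    Complex.exp_pi_mul_I, Complex.exp_pi_div_two_mul_I, neg_one_mul, div_neg, Complex.div_I] at this
  have h6 : b ≤ 0 := by simpa using this
  exact hb0 (le_antisymm h6 hpos)

theorem exists_partialFractions (g h : ℝ[X]) (hs : g.Splits) (h0 : g ≠ 0)
    (hd : h.natDegree ≤ g.natDegree)
    (him : ∀ t : ℂ, 0 < t.im → (aeval t h / aeval t g).im ≤ 0) :
    ∃ (κ : ℝ) (c : ℝ → ℝ), (∀ x, 0 ≤ c x) ∧
      h = C κ * g + ∑ x ∈ g.roots.toFinset, C (c x) * (g /ₘ (X - C x)) := by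
  induction hn : g.natDegree generalizing g h with
  | zero =>
    rw [hn] at hd
    have hg := eq_C_of_natDegree_eq_zero hn
    have hh := eq_C_of_natDegree_le_zero hd
    have hg0 : g.coeff 0 ≠ 0 := by
      intro h
      rw [h, C_0] at hg
      exact h0 hg
    refine ⟨h.coeff 0 / g.coeff 0, 0, fun _ => le_rfl, ?_⟩
    rw [hg, hh]
    simp only [coeff_C_zero, ← C_mul, div_mul_cancel₀ _ hg0]
    simp
  | succ n ih =>
    by_cases hc : ∃ x, g.IsRoot x ∧ h.IsRoot x
    · obtain ⟨x, hgx, hhx⟩ := hc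
      obtain ⟨g1, rfl⟩ := dvd_iff_isRoot.mpr hgx
      obtain ⟨h1, rfl⟩ := dvd_iff_isRoot.mpr hhx
      have hx0 : (X - C x : ℝ[X]) ≠ 0 := X_sub_C_ne_zero x
      have hg1 : g1 ≠ 0 := right_ne_zero_of_mul h0
      rw [natDegree_mul hx0 hg1, natDegree_X_sub_C] at hn
      have hn1 : g1.natDegree = n := by omega
      have hd1 : h1.natDegree ≤ g1.natDegree := by
        by_cases hh1 : h1 = 0
        · simp [hh1]
        · rw [natDegree_mul hx0 hg1, natDegree_mul hx0 hh1] at hd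
          omega
      obtain ⟨κ, c, hc, he⟩ := ih g1 h1 (splits_X_sub_C_mul_iff.mp hs) hg1 hd1 (by
        intro t ht
        have := him t ht
        rw [map_mul, map_mul, mul_div_mul_left] at this
        · exact this
        · rw [map_sub, aeval_X, aeval_C, sub_ne_zero]
          rintro rfl
          simp at ht) hn1
      classical
      refine ⟨κ, fun y => if y ∈ g1.roots.toFinset then c y else 0, ?_, ?_⟩
      · intro y
        dsimp only
        split_ifs
        exacts [hc y, le_rfl]
      · have hr : g1.roots.toFinset ⊆ ((X - C x) * g1).roots.toFinset := by
          rw [roots_mul h0]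
          intro y hy
          simp only [Multiset.mem_toFinset, Multiset.mem_add] at hy ⊢
          exact Or.inr hy
        rw [← Finset.sum_subset hr]
        · rw [he, mul_add, Finset.mul_sum]
          congr 1
          · ring
          · refine Finset.sum_congr rfl fun y hy => ?_
            dsimp only
            rw [if_pos hy]
            have hy' : g1.IsRoot y := isRoot_of_mem_roots (Multiset.mem_toFinset.mp hy)
            obtain ⟨g2, rfl⟩ := dvd_iff_isRoot.mpr hy'
            rw [mul_left_comm (X - C x) (X - C y), mul_divByMonic_cancel_left _ (monic_X_sub_C y),
              mul_divByMonic_cancel_left _ (monic_X_sub_C y)]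
            ring
        · intro y _ hy
          dsimp only
          rw [if_neg hy, C_0, zero_mul]
    · push Not at hc
      have hroot : ∀ x, g.IsRoot x → g.roots.count x = 1 ∧ ∃ g1, g = (X - C x) * g1 ∧
          g1.eval x ≠ 0 ∧ 0 < h.eval x / g1.eval x := by
        intro x hx
        obtain ⟨g1, hg1, hnd⟩ := exists_eq_pow_rootMultiplicity_mul_and_not_dvd g h0 x
        have hg1x : g1.eval x ≠ 0 := fun h => hnd (dvd_iff_isRoot.mpr h)
        have hm : rootMultiplicity x g ≠ 0 := ((rootMultiplicity_pos h0).mpr hx).ne'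
        have := eq_one_of_im_div_nonpos hm hg1x (hc x hx) (by rwa [← hg1])
        rw [count_roots]
        refine ⟨this.1, g1, ?_, hg1x, this.2⟩
        rw [this.1, pow_one] at hg1
        exact hg1
      choose! hcount g1 hg1 hg1x hpos using hroot
      have hnodup : g.roots.Nodup := by
        rw [Multiset.nodup_iff_count_le_one]
        intro x
        by_cases hx : g.IsRoot x
        · exact (hcount x hx).le
        · rw [Multiset.count_eq_zero_of_notMem]
          · exact zero_le_one
          · rwa [mem_roots h0]
      have hdiv : ∀ x, g.IsRoot x → g /ₘ (X - C x) = g1 x := by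
        intro x hx
        conv_lhs => rw [hg1 x hx]
        rw [mul_divByMonic_cancel_left _ (monic_X_sub_C x)]
      classical
      refine ⟨h.coeff (n + 1) / g.coeff (n + 1),
        fun x => if g.IsRoot x then h.eval x / (g1 x).eval x else 0, ?_, ?_⟩
      · intro x
        dsimp only
        split_ifs with hx
        exacts [(hpos x hx).le, le_rfl]
      · have hgn : g.coeff (n + 1) ≠ 0 := by
          rw [← hn]
          exact leadingCoeff_ne_zero.mpr h0
        rw [← sub_eq_zero]
        set D := h - (C (h.coeff (n + 1) / g.coeff (n + 1)) * g + ∑ x ∈ g.roots.toFinset,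
          C (if g.IsRoot x then h.eval x / (g1 x).eval x else 0) * (g /ₘ (X - C x))) with hD
        have hdeg1 : ∀ x, g.IsRoot x → (g1 x).natDegree = n := by
          intro x hx
          have hne : g1 x ≠ 0 := fun h => hg1x x hx (by rw [h, eval_zero])
          have := hn
          rw [hg1 x hx, natDegree_mul (X_sub_C_ne_zero x) hne, natDegree_X_sub_C] at this
          omega
        have hDd : D.natDegree ≤ n := by
          have hle : D.natDegree ≤ n + 1 := by
            rw [hD]
            refine (natDegree_sub_le _ _).trans (max_le (hd.trans hn.le)
              ((natDegree_add_le _ _).trans (max_le ?_ ?_)))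
            · exact (natDegree_C_mul_le _ _).trans hn.le
            · refine natDegree_sum_le_of_forall_le _ _ fun x hx => ?_
              have hx' : g.IsRoot x := isRoot_of_mem_roots (Multiset.mem_toFinset.mp hx)
              rw [hdiv x hx']
              exact (natDegree_C_mul_le _ _).trans ((hdeg1 x hx').le.trans (Nat.le_succ n))
          have hcoeff : D.coeff (n + 1) = 0 := by
            rw [hD, coeff_sub, coeff_add, coeff_C_mul, div_mul_cancel₀ _ hgn, finsetSum_coeff,
              Finset.sum_eq_zero, add_zero, sub_self]
            intro x hx
            have hx' : g.IsRoot x := isRoot_of_mem_roots (Multiset.mem_toFinset.mp hx)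
            rw [hdiv x hx', coeff_C_mul, coeff_eq_zero_of_natDegree_lt, mul_zero]
            rw [hdeg1 x hx']
            exact Nat.lt_succ_self n
          by_contra hlt
          have heq : D.natDegree = n + 1 := by omega
          rw [← heq] at hcoeff
          have : D = 0 := leadingCoeff_eq_zero.mp hcoeff
          rw [this] at heq
          simp at heq
        refine eq_zero_of_natDegree_lt_card_of_eval_eq_zero' D g.roots.toFinset ?_ ?_
        · intro y hy
          have hy' : g.IsRoot y := isRoot_of_mem_roots (Multiset.mem_toFinset.mp hy)
          rw [hD, eval_sub, eval_add, eval_mul, hy'.eq_zero, mul_zero, zero_add, eval_finsetSum,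
            Finset.sum_eq_single y]
          · rw [if_pos hy', hdiv y hy', eval_mul, eval_C, div_mul_cancel₀ _ (hg1x y hy'), sub_self]
          · intro x hx hxy
            have hx' : g.IsRoot x := isRoot_of_mem_roots (Multiset.mem_toFinset.mp hx)
            have : (g1 x).eval y = 0 := by
              have h7 := hy'.eq_zero
              rw [hg1 x hx', eval_mul, eval_sub, eval_X, eval_C] at h7
              exact (mul_eq_zero.mp h7).resolve_left (sub_ne_zero.mpr (Ne.symm hxy))
            rw [hdiv x hx', eval_mul, this, mul_zero]
          · intro h; exact absurd hy h
        · rw [Multiset.toFinset_card_of_nodup hnodup, ← hs.natDegree_eq_card_roots, hn]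
          exact Nat.lt_succ_of_le hDd

theorem coeff_le_of_barrier {g h : ℝ[X]} {r : ℕ} {b Δ : ℝ} (hs : g.Splits)
    (hgd : g.natDegree = r + 1) (hlead : 0 < g.coeff (r + 1)) (hhd : h.natDegree ≤ r + 1)
    (him : ∀ t : ℂ, 0 < t.im → (aeval t h / aeval t g).im ≤ 0)
    (hpos : ∀ x, Δ ≤ x → 0 < g.eval x) (hb : 0 < b) (hΔ : (r + 1) * b * Δ = r ^ 2)
    (hg' : g.derivative.eval Δ ≤ b * g.eval Δ) (hh : h.eval Δ ≤ b * g.eval Δ) :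
    0 < g.coeff r ∧ h.coeff r ≤ b * g.coeff r := by
  have h0 : g ≠ 0 := by rintro rfl; simp at hgd
  have hroot : ∀ x, g.IsRoot x → x < Δ := by
    intro x hx
    by_contra hlt
    exact (hpos x (not_lt.mp hlt)).ne' hx
  set c := g.coeff (r + 1) with hc
  have hlc : g.leadingCoeff = c := by rw [leadingCoeff, hgd]
  have hcard : Multiset.card g.roots = r + 1 := by rw [← hs.natDegree_eq_card_roots, hgd]
  set M := -g.roots.sum with hM
  have hcr : g.coeff r = c * M := by
    have := hs.nextCoeff_eq_neg_sum_roots_mul_leadingCoeff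
    rw [nextCoeff_of_natDegree_pos (by omega), hgd, hlc] at this
    simp only [Nat.add_sub_cancel] at this
    rw [this]; ring
  have hinv : (g.roots.map fun x => (Δ - x)⁻¹).sum ≤ b := by
    have h1 := hs.eval_derivative_div_eval_of_ne_zero (hpos Δ le_rfl).ne'
    simp only [one_div] at h1
    rw [← h1, div_le_iff₀ (hpos Δ le_rfl)]
    exact hg'
  have hu : ∀ x ∈ g.roots, Δ - x ≤ M := by
    intro x hx
    obtain ⟨s, hsx⟩ := Multiset.exists_cons_of_mem hx
    have hpos' : ∀ y ∈ s.map fun y => Δ - y, 0 < y := by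
      intro y hy
      obtain ⟨w, hw, rfl⟩ := Multiset.mem_map.mp hy
      have : w ∈ g.roots := by rw [hsx]; exact Multiset.mem_cons_of_mem hw
      linarith [hroot w (isRoot_of_mem_roots this)]
    obtain ⟨h1, h2, h3⟩ := Multiset.card_sq_le_sum_mul_sum_inv _ hpos'
    rw [Multiset.map_map] at h2 h3
    have hcs : Multiset.card s = r := by rw [hsx] at hcard; simpa using hcard
    rw [Multiset.card_map, hcs] at h3
    have hsum : (s.map fun y => Δ - y).sum = r * Δ - s.sum := by
      rw [Multiset.sum_map_sub, Multiset.map_const', Multiset.sum_replicate, hcs, nsmul_eq_mul,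
        Multiset.map_id']
    rw [hsx, Multiset.map_cons, Multiset.sum_cons] at hinv
    have hx' : 0 < (Δ - x)⁻¹ := inv_pos.mpr (by linarith [hroot x (isRoot_of_mem_roots hx)])
    have h5 : (s.map ((fun x => x⁻¹) ∘ fun y => Δ - y)).sum ≤ b := by
      have : (s.map ((fun x => x⁻¹) ∘ fun y => Δ - y)) = s.map fun x => (Δ - x)⁻¹ := rfl
      rw [this]
      linarith
    have h6 : (r : ℝ) ^ 2 ≤ (r * Δ - s.sum) * b := by
      rw [← hsum]
      exact h3.trans (mul_le_mul_of_nonneg_left h5 h1)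
    have h7 : ((r : ℝ) + 1) * Δ ≤ r * Δ - s.sum := by
      by_contra hlt
      nlinarith
    rw [hM, hsx, Multiset.sum_cons]
    linarith
  have hMpos : 0 < M := by
    obtain ⟨x, hx⟩ := Multiset.card_pos_iff_exists_mem.mp (by omega : 0 < Multiset.card g.roots)
    linarith [hu x hx, hroot x (isRoot_of_mem_roots hx)]
  have hgpos : 0 < g.coeff r := by rw [hcr]; positivity
  refine ⟨hgpos, ?_⟩
  obtain ⟨κ, d, hd, he⟩ := exists_partialFractions g h hs h0 (by omega) him
  have hg1 : ∀ x ∈ g.roots.toFinset, (g /ₘ (X - C x)).coeff r = c ∧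
      (g /ₘ (X - C x)).eval Δ = g.eval Δ * (Δ - x)⁻¹ := by
    intro x hx
    have hx' : g.IsRoot x := isRoot_of_mem_roots (Multiset.mem_toFinset.mp hx)
    obtain ⟨g1, hg1⟩ := dvd_iff_isRoot.mpr hx'
    have hd : g /ₘ (X - C x) = g1 := by
      conv_lhs => rw [hg1]
      rw [mul_divByMonic_cancel_left _ (monic_X_sub_C x)]
    have hg10 : g1 ≠ 0 := by rintro rfl; simp at hg1; exact h0 hg1
    rw [hd]
    constructor
    · have h1 : g1.natDegree = r := by
        have := hgd
        rw [hg1, natDegree_mul (X_sub_C_ne_zero x) hg10, natDegree_X_sub_C] at this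
        omega
      rw [← hlc, hg1, leadingCoeff_mul, leadingCoeff_X_sub_C, one_mul, leadingCoeff, h1]
    · have : Δ - x ≠ 0 := (sub_pos.mpr (hroot x hx')).ne'
      conv_rhs => rw [hg1]
      rw [eval_mul, eval_sub, eval_X, eval_C, mul_comm (Δ - x), mul_assoc, mul_inv_cancel₀ this,
        mul_one]
  have hΔ' := hpos Δ le_rfl
  have e1 : h.coeff r = κ * (c * M) + ∑ x ∈ g.roots.toFinset, d x * c := by
    conv_lhs => rw [he]
    rw [coeff_add, coeff_C_mul, hcr, finsetSum_coeff]
    congr 1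
    refine Finset.sum_congr rfl fun x hx => ?_
    rw [coeff_C_mul, (hg1 x hx).1]
  have e2 : h.eval Δ = g.eval Δ * (κ + ∑ x ∈ g.roots.toFinset, d x * (Δ - x)⁻¹) := by
    conv_lhs => rw [he]
    rw [eval_add, eval_mul, eval_C, eval_finsetSum, mul_add, Finset.mul_sum]
    congr 1
    · ring
    refine Finset.sum_congr rfl fun x hx => ?_
    rw [eval_mul, eval_C, (hg1 x hx).2]
    ring
  have e3 : κ + ∑ x ∈ g.roots.toFinset, d x * (Δ - x)⁻¹ ≤ b := by
    rw [e2, mul_comm b] at hh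
    exact le_of_mul_le_mul_left hh hΔ'
  have e4 : ∑ x ∈ g.roots.toFinset, d x * c ≤
      c * M * ∑ x ∈ g.roots.toFinset, d x * (Δ - x)⁻¹ := by
    rw [Finset.mul_sum]
    refine Finset.sum_le_sum fun x hx => ?_
    have hx1 := Multiset.mem_toFinset.mp hx
    have hx2 : 0 < Δ - x := sub_pos.mpr (hroot x (isRoot_of_mem_roots hx1))
    have : 1 ≤ M * (Δ - x)⁻¹ := by
      rw [← div_eq_mul_inv, one_le_div hx2]
      exact hu x hx1
    calc d x * c = c * d x * 1 := by ring
      _ ≤ c * d x * (M * (Δ - x)⁻¹) :=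
        mul_le_mul_of_nonneg_left this (mul_nonneg hlead.le (hd x))
      _ = _ := by ring
  rw [e1, hcr]
  have h8 := mul_le_mul_of_nonneg_left e3 (mul_pos hlead hMpos).le
  calc κ * (c * M) + ∑ x ∈ g.roots.toFinset, d x * c
      ≤ c * M * (κ + ∑ x ∈ g.roots.toFinset, d x * (Δ - x)⁻¹) := by rw [mul_add]; linarith
    _ ≤ c * M * b := h8
    _ = b * (c * M) := by ring

end RealRooted

section Stability

open Polynomial

variable {ι : Type*} [Fintype ι] [DecidableEq ι] {r : ℕ} {A : Matrix ι ι ℂ}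

open Matrix in
theorem principalDet_ne_zero (hA : A.IsHermitian) {z : ι → ℂ} {S : Finset ι}
    (hz : ∀ i ∈ S, 0 < (z i).im) : principalDet A z S ≠ 0 := by
  rw [principalDet_eq_det]
  intro h0
  obtain ⟨v, hv, hv0⟩ := Matrix.exists_mulVec_eq_zero_iff.mpr h0
  set B : Matrix {i // i ∈ S} {i // i ∈ S} ℂ := A.submatrix Subtype.val Subtype.val with hB
  have hBh : B.IsHermitian := hA.submatrix _
  have h1 : (Matrix.diagonal z - A).toSquareBlockProp (fun i => i ∈ S) =
      Matrix.diagonal (fun i : {i // i ∈ S} => z i) - B := by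
    ext i j
    by_cases h : i = j
    · subst h; simp [Matrix.toSquareBlockProp, hB]
    · have h' : i.1 ≠ j.1 := fun h' => h (Subtype.ext h')
      simp [Matrix.toSquareBlockProp, hB, h, h']
  rw [h1, Matrix.sub_mulVec, sub_eq_zero] at hv0
  have h2 := hBh.im_star_dotProduct_mulVec_self v
  rw [← hv0] at h2
  have h3 : star v ⬝ᵥ Matrix.diagonal (fun i : {i // i ∈ S} => z i) *ᵥ v =
      ∑ i : {i // i ∈ S}, z i * (Complex.normSq (v i) : ℂ) := by
    simp only [dotProduct, Matrix.mulVec_diagonal, Pi.star_apply]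
    refine Finset.sum_congr rfl fun i _ => ?_
    rw [Complex.normSq_eq_conj_mul_self]
    simp only [Complex.star_def]
    ring
  rw [h3] at h2
  simp only [RCLike.im_to_complex, Complex.im_sum, Complex.im_mul_ofReal] at h2
  rw [Finset.sum_eq_zero_iff_of_nonneg
    fun i _ => mul_nonneg (hz _ (Subtype.prop _)).le (Complex.normSq_nonneg _)] at h2
  refine hv (funext fun i => ?_)
  have := h2 i (Finset.mem_univ i)
  exact Complex.normSq_eq_zero.mp ((mul_eq_zero.mp this).resolve_left (hz i i.2).ne')

theorem mixedDet_eval {R : Type*} [CommRing R] (A : Matrix ι ι R) (t : R)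
    (z : Fin r → ι → R[X]) (L : List ι)
    (S : Fin r → Finset ι) :
    (mixedDet (A.map C) z L S).eval t = mixedDet A (fun k i => (z k i).eval t) L S := by
  rw [← coe_evalRingHom, mixedDet_map]
  congr 1
  ext i j
  simp

theorem mixedDet_sum_ne_zero {i : ι} {L : List ι} {S : Fin (r + 1) → Finset ι} (hL : i ∉ L)
    (hS : ∀ k, i ∉ S k)
    (h1 : ∀ z : Fin (r + 1) → ι → ℂ, (∀ k j, 0 < (z k j).im) → mixedDet A z L S ≠ 0)
    (h2 : ∀ z : Fin (r + 1) → ι → ℂ, (∀ k j, 0 < (z k j).im) →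
      mixedDet A z L (fun k => insert i (S k)) ≠ 0)
    {μ : Fin (r + 1) → ℝ} (hμ : ∀ k, 0 < μ k) {z : Fin (r + 1) → ι → ℂ}
    (hz : ∀ k j, 0 < (z k j).im) :
    ∑ k, (μ k : ℂ) * mixedDet A z L (Function.update S k (insert i (S k))) ≠ 0 := by
  set ν : Fin (r + 1) → ℂ := fun k => (((μ k)⁻¹ : ℝ) : ℂ) with hν
  obtain ⟨hd, hc, hc'⟩ := mixedDet_line A z ν i L hL S hS _ rfl
  set G := mixedDet (A.map C)
      (fun k j => if j = i then C (ν k) * X + C (z k i) else C (z k j)) L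
      (fun k => insert i (S k)) with hG
  have hν0 : ∏ k, ν k ≠ 0 := Finset.prod_ne_zero_iff.mpr fun k _ => by
    simpa [hν] using (hμ k).ne'
  have hlead : G.coeff (r + 1) ≠ 0 := by
    rw [hc]
    exact mul_ne_zero hν0 (h1 z hz)
  have hdeg : G.natDegree = r + 1 := le_antisymm hd (le_natDegree_of_ne_zero hlead)
  have hroots : ∀ t ∈ G.roots, t.im < 0 := by
    intro t ht
    have ht' : G.eval t = 0 := isRoot_of_mem_roots ht
    by_contra hlt
    refine h2 (fun k j => if j = i then ν k * t + z k i else z k j) ?_ ?_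
    · intro k j
      split_ifs
      · have : 0 ≤ (μ k)⁻¹ * t.im := mul_nonneg (inv_nonneg.mpr (hμ k).le) (not_lt.mp hlt)
        rw [Complex.add_im, hν, Complex.im_ofReal_mul]
        linarith [hz k i]
      · exact hz k j
    · rw [← ht', hG, mixedDet_eval]
      congr 1
      ext k j
      split_ifs <;> simp
  have hcard : G.roots ≠ 0 := by
    intro h
    have := (IsAlgClosed.splits G).natDegree_eq_card_roots
    rw [h, hdeg] at this
    simp at this
  have hsum := Multiset.sum_im_neg hcard hroots
  have hnext := (IsAlgClosed.splits G).nextCoeff_eq_neg_sum_roots_mul_leadingCoeff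
  rw [nextCoeff_of_natDegree_pos (by omega), hdeg, leadingCoeff, hdeg, Nat.add_sub_cancel,
    hc'] at hnext
  intro h0
  have : ∑ k, (∏ l ∈ Finset.univ.erase k, ν l) *
      mixedDet A z L (Function.update S k (insert i (S k))) = 0 := by
    have e : ∀ k, ∏ l ∈ Finset.univ.erase k, ν l = (∏ l, ν l) * μ k := by
      intro k
      have hμk : (μ k : ℂ) ≠ 0 := by exact_mod_cast (hμ k).ne'
      rw [← Finset.mul_prod_erase Finset.univ ν (Finset.mem_univ k), hν]
      push_cast
      field_simp
    simp_rw [e, mul_assoc, ← Finset.mul_sum, h0, mul_zero]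
  rw [this] at hnext
  have h3 : G.roots.sum = 0 := by
    have := hnext.symm
    rw [neg_mul, neg_eq_zero] at this
    exact (mul_eq_zero.mp this).resolve_left hlead
  rw [h3] at hsum
  simp at hsum

theorem mixedDet_ne_zero (hA : A.IsHermitian) {L : List ι} (hL : L.Nodup)
    {S : Fin (r + 1) → Finset ι} (hS : ∀ k, ∀ i ∈ L, i ∉ S k) {z : Fin (r + 1) → ι → ℂ}
    (hz : ∀ k j, 0 < (z k j).im) : mixedDet A z L S ≠ 0 := by
  induction L generalizing S z with
  | nil => exact Finset.prod_ne_zero_iff.mpr fun k _ => principalDet_ne_zero hA fun i _ => hz k i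
  | cons i L ih =>
    rw [List.nodup_cons] at hL
    have hS1 : ∀ k, ∀ i ∈ L, i ∉ S k := fun k j hj => hS k j (List.mem_cons_of_mem _ hj)
    have hS2 : ∀ k, ∀ j ∈ L, j ∉ insert i (S k) := by
      intro k j hj
      rw [Finset.mem_insert, not_or]
      refine ⟨?_, hS1 k j hj⟩
      rintro rfl
      exact hL.1 hj
    have := mixedDet_sum_ne_zero (μ := fun _ => 1) hL.1 (fun k => hS k i List.mem_cons_self)
      (fun z hz => ih hL.2 hS1 hz) (fun z hz => ih hL.2 hS2 hz) (fun _ => one_pos) hz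
    simpa [mixedDet] using this

theorem Polynomial.Splits.norm_aeval_mul_I_mono {g : ℝ[X]} (hg : g.Splits) {a b : ℝ} (ha : 0 ≤ a)
    (hab : a ≤ b) : ‖aeval (a * Complex.I) g‖ ≤ ‖aeval (b * Complex.I) g‖ := by
  obtain ⟨m, hm⟩ := splits_iff_exists_multiset.mp hg
  rw [hm, map_mul, map_mul, norm_mul, norm_mul, aeval_C, aeval_C]
  refine mul_le_mul_of_nonneg_left ?_ (norm_nonneg _)
  clear hm
  induction m using Multiset.induction_on with
  | empty => simp
  | cons x m ih =>
    rw [Multiset.map_cons, Multiset.prod_cons, map_mul, map_mul, norm_mul, norm_mul]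
    refine mul_le_mul ?_ ih (norm_nonneg _) (norm_nonneg _)
    rw [map_sub, map_sub, aeval_X, aeval_X, aeval_C]
    rw [← sq_le_sq₀ (norm_nonneg _) (norm_nonneg _), Complex.sq_norm, Complex.sq_norm,
      Complex.normSq_apply, Complex.normSq_apply]
    simp
    nlinarith

theorem continuous_mixedDet (A : Matrix ι ι ℂ) (L : List ι) (S : Fin r → Finset ι) :
    Continuous fun z : Fin r → ι → ℂ => mixedDet A z L S := by
  induction L generalizing S with
  | nil =>
    refine continuous_finsetProd _ fun k _ => ?_
    unfold principalDet
    refine Continuous.matrix_det (continuous_matrix fun i j => ?_)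
    simp only [Matrix.of_apply]
    split_ifs <;> fun_prop
  | cons i L ih => exact continuous_finsetSum _ fun k _ => ih _

theorem map_conj_mixedDet (hA : A.IsHermitian) {z : Fin r → ι → ℂ[X]}
    (hz : ∀ k i, (z k i).map (starRingEnd ℂ) = z k i) (L : List ι) (S : Fin r → Finset ι) :
    (mixedDet (A.map C) z L S).map (starRingEnd ℂ) = mixedDet (A.map C) z L S := by
  rw [← coe_mapRingHom, mixedDet_map_of_transpose]
  · congr 1
    ext1 k
    ext1 i
    exact hz k i
  · refine Matrix.ext fun i j => ?_
    have := hA.apply j i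
    simpa using this

open Filter Topology in
theorem mixedDet_ne_zero_of_im_nonneg (hA : A.IsHermitian) {L : List ι}
    {S : Fin r → Finset ι} {ζ : ι → ℝ}
    (h1 : ∀ z : ι → ℂ, (∀ j, 0 < (z j).im) → mixedDet A (fun _ => z) L S ≠ 0)
    (h2 : ∀ y : ι → ℝ, (∀ i, ζ i ≤ y i) → mixedDet A (fun _ i => (y i : ℂ)) L S ≠ 0)
    {w : ι → ℂ} (hw : ∀ i, 0 < (w i).im ∨ (w i).im = 0 ∧ ζ i ≤ (w i).re) :
    mixedDet A (fun _ => w) L S ≠ 0 := by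
  intro hw0
  set P : ℝ → ℂ[X] := fun ε => mixedDet (A.map C)
    (fun _ i => C ((((w i).im + ε : ℝ)) : ℂ) * X + C (((w i).re : ℝ) : ℂ)) L S with hP
  have hPeval : ∀ ε t, (P ε).eval t =
      mixedDet A (fun _ i => (((w i).im + ε : ℝ) : ℂ) * t + ((w i).re : ℂ)) L S := by
    intro ε t
    rw [hP, mixedDet_eval]
    simp
  have hPreal : ∀ ε, ∃ g : ℝ[X], g.map (algebraMap ℝ ℂ) = P ε := by
    intro ε
    refine exists_map_ofReal_eq (map_conj_mixedDet hA ?_ L S)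
    intro k i
    simp only [Polynomial.map_add, Polynomial.map_mul, map_C, map_X, Complex.conj_ofReal]
  choose g hg using hPreal
  have hge : ∀ ε t, aeval t (g ε) = (P ε).eval t := by
    intro ε t
    rw [← hg, eval_map_algebraMap]
  have him : ∀ i, 0 ≤ (w i).im := fun i => (hw i).elim le_of_lt fun h => h.1.ge
  have hmono : ∀ ε : ℝ, 0 < ε → ∀ a b : ℝ, 0 ≤ a → a ≤ b →
      ‖(P ε).eval (a * Complex.I)‖ ≤ ‖(P ε).eval (b * Complex.I)‖ := by
    intro ε hε a b ha hab
    rw [← hge, ← hge]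
    refine (splits_of_aeval_ne_zero fun t ht => ?_).norm_aeval_mul_I_mono ha hab
    rw [hge, hPeval]
    refine h1 _ fun i => ?_
    rw [Complex.add_im, Complex.im_ofReal_mul, Complex.ofReal_im, add_zero]
    exact mul_pos (by linarith [him i]) ht
  have hcont : ∀ t : ℂ, Tendsto (fun ε : ℝ => ‖(P ε).eval t‖) (𝓝[>] 0) (𝓝 ‖(P 0).eval t‖) := by
    intro t
    have : Continuous fun ε : ℝ => ‖(P ε).eval t‖ := by
      simp only [hPeval]
      refine ((continuous_mixedDet A L S).comp ?_).norm
      fun_prop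
    exact (this.tendsto 0).mono_left nhdsWithin_le_nhds
  have hI : (P 0).eval ((1 : ℝ) * Complex.I) = 0 := by
    rw [hPeval, ← hw0]
    congr 1
    ext k i
    rw [add_zero, Complex.ofReal_one, one_mul, add_comm]
    exact Complex.re_add_im (w i)
  have hzero : ∀ a : ℝ, 0 ≤ a → a ≤ 1 → (P 0).eval (a * Complex.I) = 0 := by
    intro a ha ha1
    have := le_of_tendsto_of_tendsto (hcont (a * Complex.I)) (hcont ((1 : ℝ) * Complex.I)) (by
      filter_upwards [self_mem_nhdsWithin] with ε hε
      exact hmono ε hε a 1 ha ha1)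
    rw [hI, norm_zero] at this
    exact norm_le_zero_iff.mp this
  have hP0 : P 0 = 0 := by
    refine eq_zero_of_infinite_isRoot _ (Set.Infinite.mono ?_
      ((Set.Icc_infinite (zero_lt_one' ℝ)).image (f := fun a : ℝ => (a : ℂ) * Complex.I) ?_))
    · rintro _ ⟨a, ha, rfl⟩
      exact hzero a ha.1 ha.2
    · intro a _ b _ hab
      simpa using hab
  have hlarge : ∀ᶠ s : ℝ in atTop, ∀ i, ζ i ≤ (w i).im * s + (w i).re := by
    rw [eventually_all]
    intro i
    rcases hw i with h | h
    · exact (tendsto_atTop_add_const_right _ _ (tendsto_id.const_mul_atTop h)).eventually_ge_atTop _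
    · refine Eventually.of_forall fun s => ?_
      rw [h.1, zero_mul, zero_add]
      exact h.2
  obtain ⟨s, hs⟩ := hlarge.exists
  refine h2 _ hs ?_
  have := hPeval 0 s
  rw [hP0, eval_zero] at this
  rw [this]
  simp

end Stability

section Positivity

open Polynomial

variable {ι : Type*} [Fintype ι] [DecidableEq ι] {A : Matrix ι ι ℂ}

open Matrix

theorem re_dotProduct_mulVec_le {j : ι} (hj : A j j = 0) {K : ℝ} (hK1 : 1 ≤ K)
    (hK : ∀ v : ι → ℂ, |(star v ⬝ᵥ A *ᵥ v).re| ≤ K * ∑ i, ‖v i‖ ^ 2) (v : ι → ℂ) :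
    (star v ⬝ᵥ A *ᵥ v).re ≤
      32 * K ^ 2 * ∑ i ∈ Finset.univ.erase j, ‖v i‖ ^ 2 + ‖v j‖ ^ 2 / 16 := by
  set t : ℝ := 1 / (16 * K) with ht
  have ht0 : 0 < t := by positivity
  have ht1 : t ≤ 1 := by rw [ht, div_le_one (by positivity)]; linarith
  set c : ι → ℂ := Pi.single j (v j) with hc
  set u : ι → ℂ := v - c with hu
  have hcc : star c ⬝ᵥ A *ᵥ c = 0 := by
    rw [hc, Matrix.mulVec_single, ← Pi.single_star, single_dotProduct]
    simp [hj]
  set w : ι → ℂ := u + (t : ℂ) • c with hw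
  have hid : star v ⬝ᵥ A *ᵥ v =
      ((t⁻¹ : ℝ) : ℂ) * (star w ⬝ᵥ A *ᵥ w) - ((t⁻¹ * (1 - t) : ℝ) : ℂ) * (star u ⬝ᵥ A *ᵥ u) := by
    have hv : v = u + c := by simp [hu]
    have htc : (t : ℂ) ≠ 0 := by exact_mod_cast ht0.ne'
    rw [hw, hv]
    simp only [star_add, star_smul, mulVec_add, mulVec_smul, add_dotProduct, dotProduct_add,
      smul_dotProduct, dotProduct_smul, hcc, smul_eq_mul, Complex.star_def, Complex.conj_ofReal]
    push_cast
    field_simp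
    ring
  have hu0 : u j = 0 := by simp [hu, hc]
  have hui : ∀ i, i ≠ j → u i = v i := by
    intro i hi
    simp [hu, hc, Pi.single_eq_of_ne hi]
  have hsu : ∑ i, ‖u i‖ ^ 2 = ∑ i ∈ Finset.univ.erase j, ‖v i‖ ^ 2 := by
    rw [← Finset.add_sum_erase _ _ (Finset.mem_univ j), hu0]
    simp only [norm_zero, ne_eq, OfNat.ofNat_ne_zero, not_false_eq_true, zero_pow, zero_add]
    exact Finset.sum_congr rfl fun i hi => by rw [hui i (Finset.ne_of_mem_erase hi)]
  have hsw : ∑ i, ‖w i‖ ^ 2 = ∑ i ∈ Finset.univ.erase j, ‖v i‖ ^ 2 + t ^ 2 * ‖v j‖ ^ 2 := by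
    rw [← Finset.add_sum_erase _ _ (Finset.mem_univ j), add_comm]
    congr 1
    · refine Finset.sum_congr rfl fun i hi => ?_
      have hi' := Finset.ne_of_mem_erase hi
      simp [hw, hui i hi', hc, Pi.single_eq_of_ne hi']
    · simp [hw, hu0, hc, mul_pow]
  have h1 := (abs_le.mp (hK w)).2
  have h2 := (abs_le.mp (hK u)).1
  rw [hsw] at h1
  rw [hsu] at h2
  rw [hid, Complex.sub_re, Complex.re_ofReal_mul, Complex.re_ofReal_mul]
  set U := ∑ i ∈ Finset.univ.erase j, ‖v i‖ ^ 2
  have hU : 0 ≤ U := Finset.sum_nonneg fun i _ => by positivity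
  have h3 : t⁻¹ * (star w ⬝ᵥ A *ᵥ w).re ≤ t⁻¹ * (K * (U + t ^ 2 * ‖v j‖ ^ 2)) :=
    mul_le_mul_of_nonneg_left h1 (by positivity)
  have h4 : t⁻¹ * (1 - t) * -(star u ⬝ᵥ A *ᵥ u).re ≤ t⁻¹ * (1 - t) * (K * U) :=
    mul_le_mul_of_nonneg_left (by linarith) (mul_nonneg (by positivity) (by linarith))
  have h5 : t⁻¹ * (1 - t) * (K * U) ≤ t⁻¹ * (K * U) := by
    refine mul_le_mul_of_nonneg_right ?_ (by positivity)
    exact mul_le_of_le_one_right (by positivity) (by linarith)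
  have h6 : t⁻¹ * (K * (U + t ^ 2 * ‖v j‖ ^ 2)) + t⁻¹ * (K * U) =
      32 * K ^ 2 * U + ‖v j‖ ^ 2 / 16 := by
    rw [ht]
    field_simp
    ring
  linarith

open ComplexOrder in
theorem posDef_diagonal_sub (hA : A.IsHermitian) {j : ι} (hj : A j j = 0) {K : ℝ} (hK1 : 1 ≤ K)
    (hK : ∀ v : ι → ℂ, |(star v ⬝ᵥ A *ᵥ v).re| ≤ K * ∑ i, ‖v i‖ ^ 2) {y : ι → ℝ}
    (hy : ∀ i, i ≠ j → 32 * K ^ 2 + 1 ≤ y i) (hyj : 1 / 8 ≤ y j) :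
    (Matrix.diagonal (fun i => (y i : ℂ)) - A).PosDef := by
  rw [Matrix.posDef_iff_dotProduct_mulVec]
  have hH : (Matrix.diagonal (fun i => (y i : ℂ)) - A).IsHermitian := by
    refine IsHermitian.sub ?_ hA
    refine Matrix.isHermitian_diagonal_of_self_adjoint _ ?_
    ext i
    simp
  refine ⟨hH, fun v hv => ?_⟩
  rw [Complex.lt_def]
  refine ⟨?_, (hH.im_star_dotProduct_mulVec_self v).symm⟩
  rw [Matrix.sub_mulVec, dotProduct_sub, Complex.sub_re, Complex.zero_re]
  have h1 : (star v ⬝ᵥ Matrix.diagonal (fun i => (y i : ℂ)) *ᵥ v).re = ∑ i, y i * ‖v i‖ ^ 2 := by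
    simp only [dotProduct, Matrix.mulVec_diagonal, Pi.star_apply, Complex.re_sum]
    refine Finset.sum_congr rfl fun i _ => ?_
    rw [mul_left_comm, Complex.star_def, Complex.conj_mul', Complex.re_ofReal_mul]
    norm_cast
  have h2 := re_dotProduct_mulVec_le hj hK1 hK v
  have h3 : (32 * K ^ 2 + 1) * ∑ i ∈ Finset.univ.erase j, ‖v i‖ ^ 2 ≤
      ∑ i ∈ Finset.univ.erase j, y i * ‖v i‖ ^ 2 := by
    rw [Finset.mul_sum]
    exact Finset.sum_le_sum fun i hi =>
      mul_le_mul_of_nonneg_right (hy i (Finset.ne_of_mem_erase hi)) (by positivity)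
  have h4 : 1 / 8 * ‖v j‖ ^ 2 ≤ y j * ‖v j‖ ^ 2 := mul_le_mul_of_nonneg_right hyj (by positivity)
  have h5 : 0 < ∑ i, ‖v i‖ ^ 2 := by
    obtain ⟨i, hi⟩ := Function.ne_iff.mp hv
    exact Finset.sum_pos' (fun i _ => by positivity)
      ⟨i, Finset.mem_univ i, by have := norm_pos_iff.mpr hi; positivity⟩
  rw [h1, ← Finset.add_sum_erase _ _ (Finset.mem_univ j)]
  rw [← Finset.add_sum_erase _ _ (Finset.mem_univ j)] at h5
  have h6 : 0 ≤ ∑ i ∈ Finset.univ.erase j, ‖v i‖ ^ 2 := Finset.sum_nonneg fun i _ => by positivity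
  have h7 : 0 ≤ ‖v j‖ ^ 2 := by positivity
  nlinarith

open ComplexOrder in
theorem principalDet_pos (hA : A.IsHermitian) (h0 : ∀ i, A i i = 0) {K : ℝ} (hK1 : 1 ≤ K)
    (hK : ∀ v : ι → ℂ, |(star v ⬝ᵥ A *ᵥ v).re| ≤ K * ∑ i, ‖v i‖ ^ 2) {y : ι → ℝ} (j : ι)
    (hy : ∀ i, i ≠ j → 32 * K ^ 2 + 1 ≤ y i) (hyj : 1 / 8 ≤ y j) (S : Finset ι) :
    0 < principalDet A (fun i => (y i : ℂ)) S := by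
  rw [principalDet_eq_det]
  refine Matrix.PosDef.det_pos ?_
  exact (posDef_diagonal_sub hA (h0 j) hK1 hK hy hyj).submatrix Subtype.val_injective

end Positivity

section Barrier

open Polynomial

variable {ι : Type*} [Fintype ι] [DecidableEq ι] {A : Matrix ι ι ℂ} {r : ℕ}

/-- The barrier estimate for `mixedDet A · L V` above the threshold `ζ`. -/
def BarrierBound (r : ℕ) (A : Matrix ι ι ℂ) (b : ℝ) (ζ : ι → ℝ) (L : List ι) (V : Finset ι) : Prop :=
  ∀ y : ι → ℝ, (∀ i, ζ i ≤ y i) → ∃ p : ℝ, 0 < p ∧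
    mixedDet A (fun (_ : Fin (r + 1)) i => (y i : ℂ)) L (fun _ => V) = p ∧
    ∀ j ∈ V, (∑ k, mixedDet A (fun (_ : Fin (r + 1)) i => (y i : ℂ)) L
      (Function.update (fun _ => V) k (V.erase j))).re ≤ b * p

open ComplexOrder in
theorem barrierBound_nil (hA : A.IsHermitian) (h0 : ∀ i, A i i = 0) {K : ℝ} (hK1 : 1 ≤ K)
    (hK : ∀ v : ι → ℂ, |(dotProduct (star v) (A.mulVec v)).re| ≤ K * ∑ i, ‖v i‖ ^ 2)
    (V : Finset ι) :
    BarrierBound r A ((r + 1) / (32 * K ^ 2 + 7 / 8)) (fun _ => 32 * K ^ 2 + 1) [] V := by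
  intro y hy
  set s : ℝ := 32 * K ^ 2 + 7 / 8 with hs
  have hs0 : 0 < s := by positivity
  have hpos : ∀ (W : Finset ι), ∃ q : ℝ, 0 < q ∧ principalDet A (fun i => (y i : ℂ)) W = q := by
    intro W
    rcases isEmpty_or_nonempty ι with hι | ⟨⟨j⟩⟩
    · refine ⟨1, one_pos, ?_⟩
      simp [principalDet]
    · have := principalDet_pos hA h0 hK1 hK j (fun i _ => hy i)
        (by nlinarith [hy j]) W
      rw [Complex.lt_def] at this
      exact ⟨_, this.1, Complex.ext rfl this.2.symm⟩
  obtain ⟨q, hq, hqe⟩ := hpos V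
  refine ⟨q ^ (r + 1), by positivity, ?_, ?_⟩
  · simp [mixedDet, hqe]
  intro j hj
  obtain ⟨p, hp, hpe⟩ := hpos (V.erase j)
  have hterm : ∀ k, mixedDet A (fun (_ : Fin (r + 1)) i => (y i : ℂ)) []
      (Function.update (fun _ => V) k (V.erase j)) = ((p * q ^ r : ℝ) : ℂ) := by
    intro k
    rw [mixedDet, ← Finset.mul_prod_erase _ _ (Finset.mem_univ k), Function.update_self, hpe,
      Finset.prod_congr rfl (g := fun _ => (q : ℂ))]
    · simp
    · intro l hl
      rw [Function.update_of_ne (Finset.ne_of_mem_erase hl), hqe]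
  simp_rw [hterm]
  rw [Finset.sum_const, Finset.card_univ, Fintype.card_fin, nsmul_eq_mul]
  have hins := principalDet_insert A (w := fun i => (y i : ℂ)) (z := fun i => (y i : ℂ))
    (w' := fun i => ((Function.update y j (y j - s) i : ℝ) : ℂ)) (S := V.erase j) (i := j)
    (a := (s : ℂ)) (b := ((y j - s : ℝ) : ℂ)) (by simp) (fun _ _ => rfl) (by push_cast; ring)
    (fun i hi => by rw [Function.update_of_ne (Finset.ne_of_mem_erase hi)])
    (by rw [Function.update_self])
  have hpos' := principalDet_pos hA h0 hK1 hK (y := Function.update y j (y j - s)) j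
    (fun i hi => by rw [Function.update_of_ne hi]; exact hy i)
    (by rw [Function.update_self]; nlinarith [hy j]) V
  rw [Finset.insert_erase hj, hqe, hpe] at hins
  rw [Complex.lt_def] at hpos'
  have h1 : q = s * p + (principalDet A
      (fun i => ((Function.update y j (y j - s) i : ℝ) : ℂ)) V).re := by
    have := congrArg Complex.re hins
    simpa using this
  have h2 : p ≤ q / s := by
    rw [le_div_iff₀ hs0]
    have := hpos'.1
    rw [Complex.zero_re] at this
    linarith
  have h3 : p * q ^ r ≤ q / s * q ^ r := mul_le_mul_of_nonneg_right h2 (by positivity)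
  have h4 : (((r + 1 : ℕ) : ℂ) * ((p * q ^ r : ℝ) : ℂ)).re = (r + 1 : ℝ) * (p * q ^ r) := by
    rw [← Complex.ofReal_natCast, Complex.re_ofReal_mul, Complex.ofReal_re]
    push_cast
    ring
  rw [h4]
  calc (r + 1 : ℝ) * (p * q ^ r) ≤ (r + 1 : ℝ) * (q / s * q ^ r) :=
        mul_le_mul_of_nonneg_left h3 (by positivity)
    _ = _ := by rw [pow_succ]; ring

theorem BarrierBound.cons (hA : A.IsHermitian) {b Δ : ℝ} (hb : 0 < b)
    (hΔ : (r + 1) * b * Δ = r ^ 2) {ζ : ι → ℝ} {i : ι} {L : List ι} (hL : (i :: L).Nodup)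
    {V : Finset ι} (hV : ∀ j ∈ i :: L, j ∉ V)
    (ih : BarrierBound r A b ζ L V) (ih' : BarrierBound r A b ζ L (insert i V)) :
    BarrierBound r A b (Function.update ζ i (ζ i - Δ)) (i :: L) V := by
  intro y hy
  rw [List.nodup_cons] at hL
  have hiV : i ∉ V := hV i List.mem_cons_self
  have hLV : ∀ k : Fin (r + 1), ∀ j ∈ L, j ∉ (fun _ : Fin (r + 1) => insert i V) k := by
    intro k j hj
    simp only [Finset.mem_insert, not_or]
    refine ⟨?_, hV j (List.mem_cons_of_mem _ hj)⟩
    rintro rfl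
    exact hL.1 hj
  have hyi : ∀ j, j ≠ i → ζ j ≤ y j := fun j hj => by
    have := hy j
    rwa [Function.update_of_ne hj] at this
  have hyi' : ζ i ≤ y i + Δ := by
    have := hy i
    rw [Function.update_self] at this
    linarith
  set Z : Fin (r + 1) → ι → ℂ[X] := fun _ l => if l = i then X + C (y i : ℂ) else C (y l : ℂ) with hZ
  have hZ1 : Z = fun (k : Fin (r + 1)) l => if l = i then
      C ((fun _ : Fin (r + 1) => (1 : ℂ)) k) * X + C ((fun (_ : Fin (r + 1)) l => (y l : ℂ)) k i)
      else C ((fun (_ : Fin (r + 1)) l => (y l : ℂ)) k l) := by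
    rw [hZ]; simp
  have hZ2 : Z = fun (k : Fin (r + 1)) l => if l = i then
      X + C ((fun (_ : Fin (r + 1)) l => (y l : ℂ)) k l)
      else C ((fun (_ : Fin (r + 1)) l => (y l : ℂ)) k l) := by
    rw [hZ]
    ext1 k
    ext1 l
    split_ifs with h
    · rw [h]
    · rfl
  have hZc : ∀ k l, (Z k l).map (starRingEnd ℂ) = Z k l := by
    intro k l
    simp only [hZ]
    split_ifs
    · simp only [Polynomial.map_add, map_C, map_X, Complex.conj_ofReal]
    · simp only [map_C, Complex.conj_ofReal]
  set G : ℂ[X] := mixedDet (A.map C) Z L (fun _ => insert i V) with hG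
  have hZe : ∀ t : ℂ, (fun (k : Fin (r + 1)) l => (Z k l).eval t) =
      fun _ l => if l = i then t + y i else (y l : ℂ) := by
    intro t
    ext k l
    simp only [hZ]
    split_ifs <;> simp
  have hZr : ∀ x : ℝ, (fun (_ : Fin (r + 1)) l => if l = i then (x : ℂ) + y i else (y l : ℂ)) =
      fun _ l => ((if l = i then x + y i else y l : ℝ) : ℂ) := by
    intro x
    ext k l
    split_ifs <;> simp
  have hζx : ∀ x : ℝ, Δ ≤ x → ∀ l, ζ l ≤ if l = i then x + y i else y l := by
    intro x hx l
    split_ifs with h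
    · rw [h]; linarith
    · exact hyi l h
  -- stability above the threshold
  have hstab : ∀ w : ι → ℂ, (∀ l, 0 < (w l).im ∨ (w l).im = 0 ∧ ζ l ≤ (w l).re) →
      mixedDet A (fun (_ : Fin (r + 1)) => w) L (fun _ => insert i V) ≠ 0 := by
    intro w hw
    refine mixedDet_ne_zero_of_im_nonneg hA
      (fun z hz => mixedDet_ne_zero hA hL.2 hLV fun _ => hz) (fun y hy => ?_) hw
    obtain ⟨p, hp, hpe, -⟩ := ih' y hy
    rw [hpe]
    exact_mod_cast hp.ne'
  obtain ⟨g, hg⟩ := exists_map_ofReal_eq (map_conj_mixedDet hA hZc L (fun _ => insert i V))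
  rw [← hG] at hg
  have hge : ∀ t : ℂ, aeval t g = mixedDet A
      (fun (_ : Fin (r + 1)) l => if l = i then t + y i else (y l : ℂ)) L (fun _ => insert i V) := by
    intro t
    rw [← eval_map_algebraMap, hg, hG, mixedDet_eval, hZe]
  have hgr : ∀ (g : ℝ[X]) (x : ℝ), ((g.eval x : ℝ) : ℂ) = aeval (x : ℂ) g := by
    intro g x
    rw [← Complex.coe_algebraMap, aeval_algebraMap_apply, Complex.coe_algebraMap]
    rfl
  have hcoeff : ∀ n, ((g.coeff n : ℝ) : ℂ) = G.coeff n := by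
    intro n
    rw [← hg, coeff_map]
    rfl
  have hline := mixedDet_line A (fun (_ : Fin (r + 1)) l => (y l : ℂ)) (fun _ => 1) i L hL.1
    (fun _ => V) (fun _ => hiV) G (by rw [hG, hZ1])
  obtain ⟨hd, hc1, hc0⟩ := hline
  have hgd : g.natDegree ≤ r + 1 := by
    rw [← natDegree_map_eq_of_injective (algebraMap ℝ ℂ).injective, hg]
    exact hd
  have hlead : 0 < g.coeff (r + 1) := by
    obtain ⟨p, hp, hpe, -⟩ := ih (fun l => if l = i then Δ + y i else y l) (hζx Δ le_rfl)
    have : ((g.coeff (r + 1) : ℝ) : ℂ) = p := by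
      rw [hcoeff, hc1, ← hpe]
      simp only [Finset.prod_const_one, one_mul]
      refine mixedDet_congr A fun k l hl => ?_
      rw [if_neg]
      rintro rfl
      exact hl.elim hL.1 hiV
    rw [Complex.ofReal_inj.mp this]
    exact hp
  have hgd' : g.natDegree = r + 1 := le_antisymm hgd (le_natDegree_of_ne_zero hlead.ne')
  have hgpos : ∀ x, Δ ≤ x → 0 < g.eval x := by
    intro x hx
    obtain ⟨p, hp, hpe, -⟩ := ih' _ (hζx x hx)
    have : ((g.eval x : ℝ) : ℂ) = p := by rw [hgr, hge, hZr, hpe]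
    rw [Complex.ofReal_inj.mp this]
    exact hp
  have him : ∀ t : ℂ, 0 < t.im → ∀ l, 0 < (if l = i then t + y i else (y l : ℂ)).im ∨
      (if l = i then t + y i else (y l : ℂ)).im = 0 ∧
        ζ l ≤ (if l = i then t + y i else (y l : ℂ)).re := by
    intro t ht l
    split_ifs with h
    · left; simpa using ht
    · right; exact ⟨by simp, by simpa using hyi l h⟩
  have hgs : g.Splits := splits_of_aeval_ne_zero fun t ht => by
    rw [hge]
    exact hstab _ (him t ht)
  obtain ⟨p₀, hp₀, hpe₀, hbar⟩ := ih' _ (hζx Δ le_rfl)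
  have hgΔ : g.eval Δ = p₀ := by
    have : ((g.eval Δ : ℝ) : ℂ) = p₀ := by rw [hgr, hge, hZr, hpe₀]
    exact Complex.ofReal_inj.mp this
  have hg' : g.derivative.eval Δ ≤ b * g.eval Δ := by
    rw [hgΔ]
    refine le_trans (le_of_eq ?_) (hbar i (Finset.mem_insert_self _ _))
    have h1 : ((g.derivative.eval Δ : ℝ) : ℂ) = G.derivative.eval (Δ : ℂ) := by
      rw [← hg, derivative_map, eval_map_algebraMap, hgr]
    rw [← Complex.ofReal_re (eval Δ (derivative g)), h1, hG, hZ2, mixedDet_derivative A _ i L hL.1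
      _ (fun _ => Finset.mem_insert_self _ _), ← hZ2, eval_finsetSum]
    simp only [mixedDet_eval, hZe, hZr]
  -- the polynomial of a removed index
  have hmain : ∀ j ∈ V, (∑ k, mixedDet A (fun (_ : Fin (r + 1)) l => (y l : ℂ))
      (i :: L) (Function.update (fun _ => V) k (V.erase j))).re ≤ b * g.coeff r := by
    intro j hj
    have hji : j ≠ i := by rintro rfl; exact hiV hj
    have hjL : j ∉ L := fun h => hV j (List.mem_cons_of_mem _ h) hj
    have hupd : ∀ k : Fin (r + 1), Function.update (fun _ => insert i V) k ((insert i V).erase j) =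
        fun l => insert i (Function.update (fun _ => V) k (V.erase j) l) := by
      intro k
      ext1 l
      by_cases hl : l = k
      · subst hl
        rw [Function.update_self, Function.update_self, Finset.erase_insert_of_ne hji.symm]
      · rw [Function.update_of_ne hl, Function.update_of_ne hl]
    set F : ℂ[X] := ∑ k, mixedDet (A.map C) Z L
      (Function.update (fun _ => insert i V) k ((insert i V).erase j)) with hF
    have hlines : ∀ k, _ := fun k => mixedDet_line A (fun (_ : Fin (r + 1)) l => (y l : ℂ))
      (fun _ => 1) i L hL.1 (Function.update (fun _ => V) k (V.erase j)) (by
        intro l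
        by_cases hl : l = k
        · subst hl
          rw [Function.update_self]
          exact fun h => hiV (Finset.mem_of_mem_erase h)
        · rwa [Function.update_of_ne hl]) (mixedDet (A.map C) Z L
          (Function.update (fun _ => insert i V) k ((insert i V).erase j))) (by rw [hupd, hZ1])
    obtain ⟨f, hf⟩ := exists_map_ofReal_eq (f := F) (by
      rw [hF, Polynomial.map_sum]
      exact Finset.sum_congr rfl fun k _ => map_conj_mixedDet hA hZc L _)
    have hfe : ∀ t : ℂ, aeval t f = ∑ k, mixedDet A
        (fun (_ : Fin (r + 1)) l => if l = i then t + y i else (y l : ℂ)) L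
          (Function.update (fun _ => insert i V) k ((insert i V).erase j)) := by
      intro t
      rw [← eval_map_algebraMap, hf, hF, eval_finsetSum]
      simp only [mixedDet_eval, hZe]
    have hfd : f.natDegree ≤ r + 1 := by
      rw [← natDegree_map_eq_of_injective (algebraMap ℝ ℂ).injective, hf]
      exact natDegree_sum_le_of_forall_le _ _ fun k _ => (hlines k).1
    have hfΔ : f.eval Δ ≤ b * g.eval Δ := by
      rw [hgΔ]
      refine le_trans (le_of_eq ?_) (hbar j (Finset.mem_insert_of_mem hj))
      rw [← Complex.ofReal_re (eval Δ f), hgr, hfe, hZr]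
    have hfim : ∀ t : ℂ, 0 < t.im → (aeval t f / aeval t g).im ≤ 0 := by
      intro t ht
      set w : ι → ℂ := fun l => if l = i then t + y i else (y l : ℂ) with hw
      set Ψ : ℂ[X] := mixedDet (A.map C) (fun (_ : Fin (r + 1)) l =>
        if l = j then X + C (w l) else C (w l)) L (fun _ => insert i V) with hΨ
      have hΨe : ∀ σ, Ψ.eval σ = mixedDet A (fun (_ : Fin (r + 1)) l =>
          if l = j then σ + w l else w l) L (fun _ => insert i V) := by
        intro σ
        rw [hΨ, mixedDet_eval]
        congr 1
        ext k l
        split_ifs <;> simp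
      have hΨ0 : Ψ.eval 0 = aeval t g := by
        rw [hΨe, hge]
        congr 1
        ext k l
        simp [hw]
      have hΨ' : Ψ.derivative.eval 0 = aeval t f := by
        rw [hΨ, mixedDet_derivative A (fun (_ : Fin (r + 1)) l => w l) j L hjL _
          (fun _ => Finset.mem_insert_of_mem hj), eval_finsetSum, hfe]
        refine Finset.sum_congr rfl fun k _ => ?_
        rw [mixedDet_eval]
        congr 1
        ext k l
        by_cases hlj : l = j <;> by_cases hli : l = i <;> simp [hw, hlj, hli, hji.symm]
      have hg0 : Ψ.eval 0 ≠ 0 := by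
        rw [hΨ0, hge]
        exact hstab _ (him t ht)
      rw [← hΨ0, ← hΨ', (IsAlgClosed.splits Ψ).eval_derivative_div_eval_of_ne_zero hg0]
      refine Multiset.sum_im_nonpos fun x hx => ?_
      obtain ⟨σ, hσ, rfl⟩ := Multiset.mem_map.mp hx
      have hσ0 : σ.im ≤ 0 := by
        by_contra hlt
        refine hstab (fun l => if l = j then σ + w l else w l) (fun l => ?_) ?_
        · split_ifs with h
          · subst h
            left
            simpa [hw, hji] using hlt
          · exact him t ht l
        · rw [← hΨe]
          exact isRoot_of_mem_roots hσ
      rw [zero_sub, one_div, Complex.inv_im, Complex.neg_im, neg_neg]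
      exact div_nonpos_of_nonpos_of_nonneg hσ0 (Complex.normSq_nonneg _)
    have hfinal := (coeff_le_of_barrier hgs hgd' hlead hfd hfim hgpos hb hΔ hg' hfΔ).2
    refine le_trans (le_of_eq ?_) hfinal
    have hfc : ((f.coeff r : ℝ) : ℂ) = F.coeff r := by
      rw [← hf, coeff_map]
      rfl
    rw [← Complex.ofReal_re (f.coeff r), hfc, hF, finsetSum_coeff]
    congr 1
    refine Finset.sum_congr rfl fun k _ => ?_
    rw [(hlines k).2.2, mixedDet]
    simp only [Finset.prod_const_one, one_mul]
  have hpos := (coeff_le_of_barrier (h := 0) hgs hgd' hlead (by simp) (by simp) hgpos hb hΔ hg'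
    (by rw [eval_zero]; exact (mul_pos hb (hgpos Δ le_rfl)).le)).1
  refine ⟨g.coeff r, hpos, ?_, hmain⟩
  rw [hcoeff, hc0, mixedDet]
  simp only [Finset.prod_const_one, one_mul]

theorem barrierBound_of_nodup (hA : A.IsHermitian) (h0 : ∀ i, A i i = 0) {K : ℝ} (hK1 : 1 ≤ K)
    (hK : ∀ v : ι → ℂ, |(dotProduct (star v) (A.mulVec v)).re| ≤ K * ∑ i, ‖v i‖ ^ 2)
    {L : List ι} (hL : L.Nodup) (V : Finset ι) (hV : ∀ j ∈ L, j ∉ V) :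
    BarrierBound r A ((r + 1) / (32 * K ^ 2 + 7 / 8)) (fun i => if i ∈ L then
      32 * K ^ 2 + 1 - r ^ 2 * (32 * K ^ 2 + 7 / 8) / (r + 1) ^ 2 else 32 * K ^ 2 + 1) L V := by
  induction L generalizing V with
  | nil => simpa using barrierBound_nil hA h0 hK1 hK V
  | cons i L ih =>
    have hL' := List.nodup_cons.mp hL
    have h1 := ih hL'.2 V fun j hj => hV j (List.mem_cons_of_mem _ hj)
    have h2 := ih hL'.2 (insert i V) fun j hj => by
      rw [Finset.mem_insert, not_or]
      refine ⟨?_, hV j (List.mem_cons_of_mem _ hj)⟩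
      rintro rfl
      exact hL'.1 hj
    have h3 := BarrierBound.cons (Δ := r ^ 2 * (32 * K ^ 2 + 7 / 8) / (r + 1) ^ 2) hA
      (by positivity) (by field_simp) hL hV h1 h2
    convert h3 using 1
    ext1 l
    by_cases hl : l = i
    · subst hl
      simp [hL'.1]
    · simp [hl]

end Barrier

section Selection

open Polynomial

theorem Polynomial.Splits.le_eval {g : ℝ[X]} (hg : g.Splits) {x₀ x : ℝ} (hx : x₀ ≤ x)
    (hc : 0 < g.leadingCoeff) (h : ∀ x, x₀ ≤ x → 0 < g.eval x) :
    g.leadingCoeff * (x - x₀) ^ g.natDegree ≤ g.eval x := by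
  have hroots : ∀ ρ ∈ g.roots, ρ < x₀ := by
    intro ρ hρ
    by_contra hlt
    exact (h ρ (not_lt.mp hlt)).ne' (isRoot_of_mem_roots hρ)
  rw [hg.eval_eq_prod_roots, hg.natDegree_eq_card_roots]
  refine mul_le_mul_of_nonneg_left ?_ hc.le
  generalize g.roots = m at hroots
  induction m using Multiset.induction_on with
  | empty => simp
  | cons a m ih =>
    rw [Multiset.card_cons, Multiset.map_cons, Multiset.prod_cons, pow_succ, mul_comm]
    have h1 := hroots a (Multiset.mem_cons_self a m)
    exact mul_le_mul (by linarith) (ih fun ρ hρ => hroots ρ (Multiset.mem_cons_of_mem hρ))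
      (pow_nonneg (by linarith) _) (by linarith)

theorem exists_eval_pos_of_sum {κ : Type*} [Fintype κ] [DecidableEq κ] (f : κ → ℝ[X]) {d : ℕ}
    (hd : ∀ k, (f k).natDegree ≤ d) (hc : ∀ k, 0 < (f k).coeff d)
    (hs : ∀ μ : κ → ℝ, (∀ k, 0 < μ k) → (∑ k, C (μ k) * f k).Splits) {x₀ : ℝ}
    (hpos : ∀ x, x₀ ≤ x → 0 < (∑ k, f k).eval x) : ∃ k, ∀ x, x₀ ≤ x → 0 < (f k).eval x := by
  obtain ⟨k, hk⟩ : ∃ k, 0 < (f k).eval x₀ := by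
    by_contra! h
    refine (hpos x₀ le_rfl).not_ge ?_
    rw [eval_finsetSum]
    exact Finset.sum_nonpos fun k _ => h k
  refine ⟨k, ?_⟩
  by_contra! hcon
  obtain ⟨x₁, hx₁, hfx₁⟩ := hcon
  set F := ∑ k, f k with hF
  have hFd : F.natDegree ≤ d := natDegree_sum_le_of_forall_le _ _ fun k _ => hd k
  have hFc : 0 < F.coeff d := by
    rw [hF, finsetSum_coeff]
    exact Finset.sum_pos (fun k _ => hc k) ⟨k, Finset.mem_univ k⟩
  have hlarge : ∀ g : ℝ[X], g.natDegree ≤ d → 0 < g.coeff d →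
      ∃ M : ℝ, ∀ x, M ≤ x → 0 < g.eval x := by
    intro g hg hgc
    have hgd : g.natDegree = d := le_antisymm hg (le_natDegree_of_ne_zero hgc.ne')
    have hlc : 0 < g.leadingCoeff := by rw [leadingCoeff, hgd]; exact hgc
    rcases Nat.eq_zero_or_pos d with h | h
    · rw [h] at hgd hgc
      refine ⟨0, fun x _ => ?_⟩
      rw [eq_C_of_natDegree_eq_zero hgd, eval_C]
      exact hgc
    · exact Filter.eventually_atTop.mp ((g.tendsto_atTop_of_leadingCoeff_nonneg
        (natDegree_pos_iff_degree_pos.mp (hgd ▸ h)) hlc.le).eventually_gt_atTop 0)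
  obtain ⟨M₁, hM₁⟩ := hlarge (f k) (hd k) (hc k)
  obtain ⟨M₂, hM₂⟩ := hlarge F hFd hFc
  set M := max M₁ M₂
  set B : Set (ℝ × ℝ) := {p | p ∈ Set.Icc (0 : ℝ) 1 ×ˢ Set.Icc x₀ M ∧
    (1 - p.1) * (f k).eval p.2 + p.1 * F.eval p.2 ≤ 0} with hB
  have hBc : IsCompact B := by
    refine (isCompact_Icc.prod isCompact_Icc).inter_right (t := {p : ℝ × ℝ |
      (1 - p.1) * (f k).eval p.2 + p.1 * F.eval p.2 ≤ 0}) (isClosed_le ?_ continuous_const)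
    have h1 := (f k).continuous
    have h2 := F.continuous
    fun_prop
  have hmem : ∀ s ∈ Set.Icc (0 : ℝ) 1, ∀ x, x₀ ≤ x →
      (1 - s) * (f k).eval x + s * F.eval x ≤ 0 → (s, x) ∈ B := by
    intro s hs x hx hle
    refine ⟨⟨hs, hx, ?_⟩, hle⟩
    by_contra! hlt
    have h1 := hM₁ x ((le_max_left _ _).trans hlt.le)
    have h2 := hM₂ x ((le_max_right _ _).trans hlt.le)
    rcases hs.1.eq_or_lt with h | h
    · simp [← h] at hle; linarith
    · have : 0 ≤ (1 - s) * eval x (f k) := mul_nonneg (by linarith [hs.2]) h1.le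
      have := mul_pos h h2
      linarith
  obtain ⟨⟨s, x⟩, hsx, hmax⟩ := hBc.exists_isMaxOn
    ⟨(0, x₁), hmem 0 ⟨le_rfl, zero_le_one⟩ x₁ hx₁ (by simpa using hfx₁)⟩ continuous_fst.continuousOn
  obtain ⟨⟨⟨hs0 : 0 ≤ s, hs1 : s ≤ 1⟩, hx0 : x₀ ≤ x, -⟩, hle⟩ := hsx
  simp only at hle
  have hs1' : s < 1 := by
    refine lt_of_le_of_ne hs1 ?_
    rintro rfl
    have := hpos x hx0
    linarith
  have hx0' : x₀ < x := by
    refine lt_of_le_of_ne hx0 ?_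
    rintro rfl
    have h1 := hpos x₀ le_rfl
    have h2 : 0 < (1 - s) * eval x₀ (f k) := mul_pos (by linarith) hk
    have h3 : 0 ≤ s * eval x₀ F := mul_nonneg hs0 h1.le
    linarith
  have hlow : ∀ s' ∈ Set.Ioo s 1, ((1 - s') * (f k).coeff d + s' * F.coeff d) * (x - x₀) ^ d ≤
      (1 - s') * (f k).eval x + s' * F.eval x := by
    intro s' hs'
    have hs'0 : 0 < s' := hs0.trans_lt hs'.1
    have hs'1 := hs'.2
    set g : ℝ[X] := C (1 - s') * f k + C s' * F with hg
    have hge : ∀ x, g.eval x = (1 - s') * (f k).eval x + s' * F.eval x := by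
      intro x; simp [hg]
    have hgc : g.coeff d = (1 - s') * (f k).coeff d + s' * F.coeff d := by
      rw [hg, coeff_add, coeff_C_mul, coeff_C_mul]
    have hgc0 : 0 < g.coeff d := by
      rw [hgc]
      exact add_pos (mul_pos (by linarith) (hc k)) (mul_pos hs'0 hFc)
    have hgd : g.natDegree = d := by
      refine le_antisymm ?_ (le_natDegree_of_ne_zero hgc0.ne')
      exact natDegree_add_le_of_degree_le ((natDegree_C_mul_le _ _).trans (hd k))
        ((natDegree_C_mul_le _ _).trans hFd)
    have hgs : g.Splits := by
      have := hs (fun l => if l = k then 1 else s') (fun l => by split_ifs <;> linarith)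
      convert this using 1
      rw [hg, hF, ← Finset.add_sum_erase _ _ (Finset.mem_univ k),
        ← Finset.add_sum_erase _ _ (Finset.mem_univ k), if_pos rfl, mul_add, Finset.mul_sum,
        ← add_assoc, ← add_mul, ← C_add, sub_add_cancel]
      congr 1
      exact Finset.sum_congr rfl fun l hl => by rw [if_neg (Finset.ne_of_mem_erase hl)]
    have hlc : g.leadingCoeff = g.coeff d := by rw [leadingCoeff, hgd]
    have := hgs.le_eval hx0 (by rw [hlc]; exact hgc0) (fun z hz => by
      by_contra! hcon
      rw [hge] at hcon
      have := hmax (hmem s' ⟨hs'0.le, hs'1.le⟩ z hz hcon)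
      exact hs'.1.not_ge this)
    rwa [hlc, hgc, hgd, hge] at this
  have hlim : ((1 - s) * (f k).coeff d + s * F.coeff d) * (x - x₀) ^ d ≤
      (1 - s) * (f k).eval x + s * F.eval x := by
    refine ContinuousWithinAt.closure_le (s := Set.Ioo s 1) (x := s)
      (f := fun s => ((1 - s) * (f k).coeff d + s * F.coeff d) * (x - x₀) ^ d)
      (g := fun s => (1 - s) * (f k).eval x + s * F.eval x) ?_ ?_ ?_ hlow
    · rw [closure_Ioo hs1'.ne]
      exact ⟨le_rfl, hs1'.le⟩
    · exact Continuous.continuousWithinAt (by fun_prop)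
    · exact Continuous.continuousWithinAt (by fun_prop)
  have h1 : 0 < (1 - s) * (f k).coeff d + s * F.coeff d :=
    add_pos_of_pos_of_nonneg (mul_pos (by linarith) (hc k)) (mul_nonneg hs0 hFc.le)
  have h2 : 0 < (x - x₀) ^ d := pow_pos (by linarith) _
  nlinarith [mul_pos h1 h2]

end Selection

section Paving

open Polynomial

variable {ι : Type*} [Fintype ι] [DecidableEq ι] {A : Matrix ι ι ℂ} {r : ℕ}

theorem monic_principalDet_X (A : Matrix ι ι ℂ) (S : Finset ι) :
    (principalDet (A.map C) (fun _ => X) S).Monic ∧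
      (principalDet (A.map C) (fun _ => X) S).natDegree = S.card := by
  have h : principalDet (A.map C) (fun _ => X) S =
      (A.toSquareBlockProp fun i => i ∈ S).charpoly := by
    rw [principalDet_eq_det, Matrix.charpoly]
    congr 1
    ext1 i j
    by_cases hij : i = j
    · subst hij
      simp [Matrix.toSquareBlockProp, Matrix.charmatrix]
    · have hij' : i.1 ≠ j.1 := fun h' => hij (Subtype.ext h')
      simp [Matrix.toSquareBlockProp, Matrix.charmatrix, hij, hij']
  rw [h]
  exact ⟨Matrix.charpoly_monic _, by rw [Matrix.charpoly_natDegree_eq_dim]; simp⟩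

theorem coeff_mixedDet_X (A : Matrix ι ι ℂ) {L : List ι} (hL : L.Nodup)
    (S : Fin (r + 1) → Finset ι) (hS : ∀ k, ∀ i ∈ L, i ∉ S k) :
    (mixedDet (A.map C) (fun _ _ => X) L S).natDegree ≤ ∑ k, (S k).card + L.length ∧
      (mixedDet (A.map C) (fun _ _ => X) L S).coeff (∑ k, (S k).card + L.length) =
        ((r + 1 : ℝ) ^ L.length : ℝ) := by
  induction L generalizing S with
  | nil =>
    have h1 : (∏ k, principalDet (A.map C) (fun _ => (X : ℂ[X])) (S k)).Monic :=
      monic_prod_of_monic _ _ fun k _ => (monic_principalDet_X A (S k)).1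
    have h2 : (∏ k, principalDet (A.map C) (fun _ => (X : ℂ[X])) (S k)).natDegree =
        ∑ k, (S k).card := by
      rw [natDegree_prod_of_monic _ _ fun k _ => (monic_principalDet_X A (S k)).1]
      exact Finset.sum_congr rfl fun k _ => (monic_principalDet_X A (S k)).2
    simp only [mixedDet, List.length_nil, add_zero, pow_zero]
    rw [← h2]
    exact ⟨le_rfl, by rw [h1.coeff_natDegree]; simp⟩
  | cons i L ih =>
    rw [List.nodup_cons] at hL
    have hcard : ∀ k, ∑ l, (Function.update S k (insert i (S k)) l).card = ∑ l, (S l).card + 1 := by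
      intro k
      rw [← Finset.add_sum_erase _ _ (Finset.mem_univ k), Function.update_self,
        Finset.card_insert_of_notMem (hS k i List.mem_cons_self),
        ← Finset.add_sum_erase _ (fun l => (S l).card) (Finset.mem_univ k)]
      rw [Finset.sum_congr rfl fun l hl => by
        rw [Function.update_of_ne (Finset.ne_of_mem_erase hl)]]
      ring
    have hk : ∀ k, _ := fun k => ih hL.2 (Function.update S k (insert i (S k))) (by
      intro l j hj
      have hj' := hS l j (List.mem_cons_of_mem _ hj)
      by_cases hl : l = k
      · subst hl
        rw [Function.update_self, Finset.mem_insert, not_or]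
        refine ⟨?_, hj'⟩
        rintro rfl
        exact hL.1 hj
      · rwa [Function.update_of_ne hl])
    have he : ∀ k, ∑ l, (Function.update S k (insert i (S k)) l).card + L.length =
        ∑ l, (S l).card + (i :: L).length := by
      intro k
      rw [hcard, List.length_cons]
      ring
    simp only [he] at hk
    rw [mixedDet]
    refine ⟨natDegree_sum_le_of_forall_le _ _ fun k _ => (hk k).1, ?_⟩
    rw [finsetSum_coeff, Finset.sum_congr rfl fun k _ => (hk k).2]
    simp only [Finset.sum_const, Finset.card_univ, Fintype.card_fin, nsmul_eq_mul, List.length_cons]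
    push_cast
    ring

/-- Positivity of the polynomial `mixedDet A X L S` on `[x₀, ∞)`. -/
def MixedPos (A : Matrix ι ι ℂ) (x₀ : ℝ) (L : List ι) (S : Fin (r + 1) → Finset ι) : Prop :=
  ∀ x : ℝ, x₀ ≤ x → 0 < (mixedDet A (fun _ _ => (x : ℂ)) L S).re

theorem MixedPos.exists_update (hA : A.IsHermitian) {x₀ : ℝ} {i : ι} {L : List ι}
    {S : Fin (r + 1) → Finset ι} (hL : (i :: L).Nodup) (hS : ∀ k, ∀ j ∈ i :: L, j ∉ S k)
    (h : MixedPos A x₀ (i :: L) S) :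
    ∃ k, MixedPos A x₀ L (Function.update S k (insert i (S k))) := by
  rw [List.nodup_cons] at hL
  have hreal : ∀ k, ∃ f : ℝ[X], f.map (algebraMap ℝ ℂ) =
      mixedDet (A.map C) (fun _ _ => X) L (Function.update S k (insert i (S k))) := fun k =>
    exists_map_ofReal_eq (map_conj_mixedDet hA (fun _ _ => map_X _) _ _)
  choose f hf using hreal
  have hS' : ∀ k, ∀ l, ∀ j ∈ L, j ∉ Function.update S k (insert i (S k)) l := by
    intro k l j hj
    have hj' := hS l j (List.mem_cons_of_mem _ hj)
    by_cases hl : l = k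
    · subst hl
      rw [Function.update_self, Finset.mem_insert, not_or]
      refine ⟨?_, hj'⟩
      rintro rfl
      exact hL.1 hj
    · rwa [Function.update_of_ne hl]
  have hfe : ∀ k (t : ℂ), aeval t (f k) =
      mixedDet A (fun _ _ => t) L (Function.update S k (insert i (S k))) := by
    intro k t
    rw [← eval_map_algebraMap, hf, mixedDet_eval]
    simp
  have hgr : ∀ (g : ℝ[X]) (x : ℝ), ((g.eval x : ℝ) : ℂ) = aeval (x : ℂ) g := by
    intro g x
    rw [← Complex.coe_algebraMap, aeval_algebraMap_apply, Complex.coe_algebraMap]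
    rfl
  have hcard : ∀ k, ∑ l, (Function.update S k (insert i (S k)) l).card = ∑ l, (S l).card + 1 := by
    intro k
    rw [← Finset.add_sum_erase _ _ (Finset.mem_univ k), Function.update_self,
      Finset.card_insert_of_notMem (hS k i List.mem_cons_self),
      ← Finset.add_sum_erase _ (fun l => (S l).card) (Finset.mem_univ k)]
    rw [Finset.sum_congr rfl fun l hl => by
      rw [Function.update_of_ne (Finset.ne_of_mem_erase hl)]]
    ring
  have hdeg : ∀ k, (f k).natDegree ≤ ∑ l, (S l).card + 1 + L.length ∧
      0 < (f k).coeff (∑ l, (S l).card + 1 + L.length) := by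
    intro k
    have h1 := coeff_mixedDet_X A hL.2 _ (hS' k)
    rw [hcard, ← hf] at h1
    refine ⟨?_, ?_⟩
    · rw [← natDegree_map_eq_of_injective (algebraMap ℝ ℂ).injective]
      exact h1.1
    · have h2 := h1.2
      rw [coeff_map] at h2
      have h3 : (f k).coeff (∑ l, (S l).card + 1 + L.length) = (r + 1 : ℝ) ^ L.length :=
        Complex.ofReal_inj.mp h2
      rw [h3]
      positivity
  obtain ⟨k, hk⟩ := exists_eval_pos_of_sum f (x₀ := x₀) (fun k => (hdeg k).1) (fun k => (hdeg k).2)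
    (fun μ hμ => splits_of_aeval_ne_zero fun t ht => by
      rw [map_sum]
      simp only [map_mul, aeval_C, hfe]
      refine mixedDet_sum_ne_zero hL.1 (fun k => hS k i List.mem_cons_self) ?_ ?_ hμ fun _ _ => ht
      · exact fun z hz => mixedDet_ne_zero hA hL.2
          (fun k j hj => hS k j (List.mem_cons_of_mem _ hj)) hz
      · refine fun z hz => mixedDet_ne_zero hA hL.2 (fun k j hj => ?_) hz
        have := hS' k k j hj
        rwa [Function.update_self] at this)
    (fun x hx => by
      have := h x hx
      rw [mixedDet, ← Finset.sum_congr rfl fun k _ => hfe k x, ← map_sum, ← hgr,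
        Complex.ofReal_re] at this
      exact this)
  refine ⟨k, fun x hx => ?_⟩
  rw [← hfe, ← hgr, Complex.ofReal_re]
  exact hk x hx

theorem MixedPos.exists_cover (hA : A.IsHermitian) {x₀ : ℝ} {L : List ι}
    {S : Fin (r + 1) → Finset ι} (hL : L.Nodup) (hS : ∀ k, ∀ j ∈ L, j ∉ S k)
    (h : MixedPos A x₀ L S) :
    ∃ S' : Fin (r + 1) → Finset ι, (∀ k, S k ⊆ S' k) ∧ (∀ i ∈ L, ∃ k, i ∈ S' k) ∧
      MixedPos A x₀ [] S' := by
  induction L generalizing S with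
  | nil => exact ⟨S, fun _ => subset_rfl, by simp, h⟩
  | cons i L ih =>
    obtain ⟨k, hk⟩ := h.exists_update hA hL hS
    rw [List.nodup_cons] at hL
    obtain ⟨S', h1, h2, h3⟩ := ih hL.2 (fun l j hj => by
      have hj' := hS l j (List.mem_cons_of_mem _ hj)
      by_cases hl : l = k
      · subst hl
        rw [Function.update_self, Finset.mem_insert, not_or]
        refine ⟨?_, hj'⟩
        rintro rfl
        exact hL.1 hj
      · rwa [Function.update_of_ne hl]) hk
    refine ⟨S', fun l => ?_, fun j hj => ?_, h3⟩
    · by_cases hl : l = k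
      · subst hl
        have := h1 l
        rw [Function.update_self] at this
        exact (Finset.subset_insert _ _).trans this
      · have := h1 l
        rwa [Function.update_of_ne hl] at this
    · rcases List.mem_cons.mp hj with rfl | hj
      · have := h1 k
        rw [Function.update_self] at this
        exact ⟨k, this (Finset.mem_insert_self _ _)⟩
      · exact h2 j hj

open Matrix ComplexOrder

theorem re_dotProduct_le_of_principalDet_ne_zero (hA : A.IsHermitian) {x₀ : ℝ} (hx₀ : 0 < x₀)
    {S : Finset ι} (h : ∀ x : ℝ, x₀ ≤ x → principalDet A (fun _ => (x : ℂ)) S ≠ 0) {v : ι → ℂ}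
    (hv : ∀ i, i ∉ S → v i = 0) : (star v ⬝ᵥ A *ᵥ v).re ≤ x₀ * ∑ i, ‖v i‖ ^ 2 := by
  set P : Matrix ι ι ℂ := Matrix.of fun i j => if i ∈ S ∧ j ∈ S then A i j else 0 with hP
  have hPh : P.IsHermitian := by
    ext i j
    have := hA.apply i j
    by_cases hi : i ∈ S <;> by_cases hj : j ∈ S <;> simp [hP, hi, hj, this]
  have hdet : ∀ x : ℝ, x₀ ≤ x → ∀ w : ι → ℂ, P *ᵥ w = (x : ℂ) • w → w = 0 := by
    intro x hx w hw
    by_contra hw0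
    refine h x hx ?_
    unfold principalDet
    refine Matrix.exists_mulVec_eq_zero_iff.mp ⟨w, hw0, ?_⟩
    have hx0 : (x : ℂ) ≠ 0 := by exact_mod_cast (hx₀.trans_le hx).ne'
    have hwS : ∀ i, i ∉ S → w i = 0 := by
      intro i hi
      have := congrFun hw i
      simp only [mulVec, dotProduct, hP, of_apply, hi, false_and, if_false, zero_mul,
        Finset.sum_const_zero, Pi.smul_apply, smul_eq_mul] at this
      exact (mul_eq_zero.mp this.symm).resolve_left hx0
    ext i
    by_cases hi : i ∈ S
    · have := congrFun hw i
      simp only [mulVec, dotProduct, hP, of_apply, hi, true_and, Pi.smul_apply, smul_eq_mul] at this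
      simp only [mulVec, dotProduct, of_apply, hi, if_true, sub_mul, ite_mul, zero_mul,
        Finset.sum_sub_distrib, Finset.sum_ite_eq, Finset.mem_univ, Pi.zero_apply, sub_eq_zero]
      rw [← this]
      refine Finset.sum_congr rfl fun j _ => ?_
      by_cases hj : j ∈ S
      · simp [hj]
      · simp [hj, hwS j hj]
    · simp [mulVec, dotProduct, hi, hwS i hi]
  set Q : Matrix ι ι ℂ := (x₀ : ℂ) • 1 - P with hQ
  have hQh : Q.IsHermitian := by
    refine IsHermitian.sub ?_ hPh
    rw [Matrix.IsHermitian, conjTranspose_smul, conjTranspose_one]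
    simp
  have hQp : Q.PosSemidef := by
    rw [hQh.posSemidef_iff_eigenvalues_nonneg]
    intro i
    by_contra! hneg
    have h1 := hQh.mulVec_eigenvectorBasis i
    have h2 := hdet (x₀ - hQh.eigenvalues i) (by simp at hneg; linarith)
      (hQh.eigenvectorBasis i).ofLp (by
        have : P = (x₀ : ℂ) • 1 - Q := by rw [hQ, sub_sub_cancel]
        rw [this, Matrix.sub_mulVec, h1, Matrix.smul_mulVec, one_mulVec]
        ext j
        simp [sub_mul])
    have h3 := hQh.eigenvectorBasis.orthonormal.ne_zero i
    exact h3 (by ext j; simp [h2])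
  have h1 := hQp.dotProduct_mulVec_nonneg v
  have h2 : star v ⬝ᵥ P *ᵥ v = star v ⬝ᵥ A *ᵥ v := by
    simp only [dotProduct, mulVec]
    refine Finset.sum_congr rfl fun i _ => ?_
    by_cases hi : i ∈ S
    · congr 1
      refine Finset.sum_congr rfl fun j _ => ?_
      by_cases hj : j ∈ S
      · simp [hP, hi, hj]
      · simp [hv j hj]
    · simp [hv i hi]
  have h3 := (Complex.le_def.mp h1).1
  have h4 : star v ⬝ᵥ v = ((∑ i, ‖v i‖ ^ 2 : ℝ) : ℂ) := by
    simp only [dotProduct, Pi.star_apply, Complex.star_def, Complex.conj_mul']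
    push_cast
    rfl
  rw [hQ, Matrix.sub_mulVec, dotProduct_sub, Complex.sub_re, h2, Matrix.smul_mulVec, one_mulVec,
    dotProduct_smul, h4, smul_eq_mul, Complex.re_ofReal_mul, Complex.ofReal_re, Complex.zero_re] at h3
  linarith

/-- Zero-diagonal Hermitian matrices of bounded norm admit a one-sided paving with a number of
colours independent of the size. -/
theorem exists_paving {K : ℝ} (hK1 : 1 ≤ K) : ∃ r : ℕ, ∀ {ι : Type*} [Fintype ι] [DecidableEq ι]
    (A : Matrix ι ι ℂ), A.IsHermitian → (∀ i, A i i = 0) →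
    (∀ v : ι → ℂ, |(star v ⬝ᵥ A *ᵥ v).re| ≤ K * ∑ i, ‖v i‖ ^ 2) →
    ∃ c : ι → Fin (r + 1), ∀ k, ∀ v : ι → ℂ, (∀ i, c i ≠ k → v i = 0) →
      (star v ⬝ᵥ A *ᵥ v).re ≤ 1 / 2 * ∑ i, ‖v i‖ ^ 2 := by
  set s : ℝ := 32 * K ^ 2 + 7 / 8 with hs
  obtain ⟨r, hr⟩ := exists_nat_ge (16 / 3 * s)
  refine ⟨r, fun {ι} _ _ A hA h0 hK => ?_⟩
  have hs0 : 0 < s := by positivity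
  have hbar := barrierBound_of_nodup (r := r) hA h0 hK1 hK (L := Finset.univ.toList)
    (Finset.nodup_toList _) ∅ (by simp)
  have hhalf : 32 * K ^ 2 + 1 - r ^ 2 * (32 * K ^ 2 + 7 / 8) / (r + 1) ^ 2 ≤ (1 / 2 : ℝ) := by
    have h1 : (s * (r + 1) ^ 2 - r ^ 2 * s) / (r + 1 : ℝ) ^ 2 ≤ 3 / 8 := by
      rw [div_le_iff₀ (by positivity)]
      nlinarith
    have h2 : (s * (r + 1) ^ 2 - r ^ 2 * s) / (r + 1 : ℝ) ^ 2 = s - r ^ 2 * s / (r + 1) ^ 2 := by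
      field_simp
    rw [← hs]
    linarith
  have hpos : MixedPos (r := r) A (1 / 2) (Finset.univ.toList) (fun _ => ∅) := by
    intro x hx
    obtain ⟨p, hp, hpe, -⟩ := hbar (fun _ => x) (fun i => by simpa using hhalf.trans hx)
    rw [hpe, Complex.ofReal_re]
    exact hp
  obtain ⟨S, -, hcov, hSpos⟩ := hpos.exists_cover hA (Finset.nodup_toList _) (by simp)
  choose c hc using fun i => hcov i (by simp)
  refine ⟨c, fun k v hv => ?_⟩
  refine re_dotProduct_le_of_principalDet_ne_zero hA (by norm_num) (S := S k) (fun x hx hdet => ?_)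
    fun i hi => hv i fun h => hi (h ▸ hc i)
  have := hSpos x hx
  rw [mixedDet, Finset.prod_eq_zero (Finset.mem_univ k) hdet] at this
  simp at this

end Paving

section Matrices

variable {ι : Type*} (b : HilbertBasis ι ℂ H)

theorem HilbertBasis.ext_inner {x y : H} (h : ∀ i, inner ℂ (b i) x = inner ℂ (b i) y) : x = y := by
  refine b.repr.injective (lp.ext (funext fun i => ?_))
  rw [b.repr_apply_apply, b.repr_apply_apply, h]

theorem HilbertBasis.ext_apply {A B : H →L[ℂ] H} (h : ∀ i, A (b i) = B (b i)) : A = B := by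
  refine ContinuousLinearMap.ext_on (s := Set.range b) ?_ ?_
  · exact Submodule.dense_iff_topologicalClosure_eq_top.2 b.dense_span
  · rintro _ ⟨i, rfl⟩
    exact h i

theorem HilbertBasis.ext_entries {A B : H →L[ℂ] H}
    (h : ∀ i j, inner ℂ (b i) (A (b j)) = inner ℂ (b i) (B (b j))) : A = B :=
  b.ext_apply fun j => b.ext_inner fun i => h i j

theorem HilbertBasis.sum_sq_le (v : H) (F : Finset ι) :
    ∑ i ∈ F, ‖inner ℂ (b i) v‖ ^ 2 ≤ ‖v‖ ^ 2 :=
  b.orthonormal.sum_inner_products_le v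

theorem HilbertBasis.exists_of_rows (w : ι → H) {C : ℝ} (hC : 0 ≤ C)
    (h : ∀ (v : H) (F : Finset ι), ∑ i ∈ F, ‖inner ℂ (w i) v‖ ^ 2 ≤ C ^ 2 * ‖v‖ ^ 2) :
    ∃ A : H →L[ℂ] H, (∀ i v, inner ℂ (b i) (A v) = inner ℂ (w i) v) ∧ ‖A‖ ≤ C := by
  have hmem : ∀ v, Memℓp (fun i => inner ℂ (w i) v) 2 := by
    intro v
    refine memℓp_gen' (C := C ^ 2 * ‖v‖ ^ 2) fun F => ?_
    simpa using h v F
  set f : H →ₗ[ℂ] H :=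
    { toFun := fun v => b.repr.symm ⟨_, hmem v⟩
      map_add' := fun x y => by
        rw [← map_add]
        congr 1
        ext i
        exact inner_add_right _ _ _
      map_smul' := fun c x => by
        rw [RingHom.id_apply, ← map_smul]
        congr 1
        ext i
        exact inner_smul_right _ _ _ } with hf
  have hfe : ∀ v, f v = b.repr.symm ⟨_, hmem v⟩ := fun v => rfl
  have hbound : ∀ v, ‖f v‖ ≤ C * ‖v‖ := by
    intro v
    rw [hfe, LinearIsometryEquiv.norm_map]
    refine lp.norm_le_of_forall_sum_le (by norm_num) (by positivity) fun F => ?_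
    have := h v F
    rw [← mul_pow] at this
    simpa using this
  refine ⟨f.mkContinuous C hbound, fun i v => ?_, LinearMap.mkContinuous_norm_le _ hC _⟩
  rw [LinearMap.mkContinuous_apply, hfe, ← b.repr_apply_apply, LinearIsometryEquiv.apply_symm_apply]


/-- The matrix entry `⟪b i, A (b j)⟫`. -/
def HilbertBasis.entry (A : H →L[ℂ] H) (i j : ι) : ℂ := inner ℂ (b i) (A (b j))

theorem HilbertBasis.entry_ext {A B : H →L[ℂ] H} (h : ∀ i j, b.entry A i j = b.entry B i j) :
    A = B :=
  b.ext_entries h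

@[simp] theorem HilbertBasis.entry_zero (i j : ι) : b.entry (0 : H →L[ℂ] H) i j = 0 := by
  simp [HilbertBasis.entry]

@[simp] theorem HilbertBasis.entry_add (A B : H →L[ℂ] H) (i j : ι) :
    b.entry (A + B) i j = b.entry A i j + b.entry B i j := by
  simp [HilbertBasis.entry]

@[simp] theorem HilbertBasis.entry_sub (A B : H →L[ℂ] H) (i j : ι) :
    b.entry (A - B) i j = b.entry A i j - b.entry B i j := by
  simp [HilbertBasis.entry]

@[simp] theorem HilbertBasis.entry_smul (c : ℂ) (A : H →L[ℂ] H) (i j : ι) :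
    b.entry (c • A) i j = c * b.entry A i j := by
  simp [HilbertBasis.entry]

theorem HilbertBasis.entry_one [DecidableEq ι] (i j : ι) :
    b.entry (1 : H →L[ℂ] H) i j = if i = j then 1 else 0 := by
  simpa [HilbertBasis.entry] using orthonormal_iff_ite.1 b.orthonormal i j

theorem HilbertBasis.entry_one_of_ne {i j : ι} (h : i ≠ j) :
    b.entry (1 : H →L[ℂ] H) i j = 0 := by
  classical
  rw [b.entry_one, if_neg h]

theorem HilbertBasis.entry_adjoint (A : H →L[ℂ] H) (i j : ι) :
    b.entry (ContinuousLinearMap.adjoint A) i j = (starRingEnd ℂ) (b.entry A j i) := by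
  rw [HilbertBasis.entry, HilbertBasis.entry, ContinuousLinearMap.adjoint_inner_right,
    inner_conj_symm]

theorem HilbertBasis.hasSum_entry_mul (A B : H →L[ℂ] H) (i j : ι) :
    HasSum (fun k => b.entry A i k * b.entry B k j) (b.entry (A * B) i j) := by
  have h := b.hasSum_inner_mul_inner (ContinuousLinearMap.adjoint A (b i)) (B (b j))
  rw [ContinuousLinearMap.adjoint_inner_left] at h
  simp only [ContinuousLinearMap.adjoint_inner_left] at h
  exact h

theorem HilbertBasis.continuous_entry (i j : ι) : Continuous fun A : H →L[ℂ] H => b.entry A i j := by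
  unfold HilbertBasis.entry
  fun_prop

/-- The operators whose matrix is supported on the relation `r`. -/
def HilbertBasis.supp (r : ι → ι → Prop) : Set (H →L[ℂ] H) :=
  {A | ∀ i j, ¬ r i j → b.entry A i j = 0}

variable {b} {r s t : ι → ι → Prop} {A B : H →L[ℂ] H}

theorem HilbertBasis.supp_mono (h : ∀ i j, r i j → s i j) : b.supp r ⊆ b.supp s :=
  fun _ hA i j hs => hA i j fun hr => hs (h i j hr)

theorem HilbertBasis.zero_mem_supp : (0 : H →L[ℂ] H) ∈ b.supp r := fun i j _ => b.entry_zero i j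

theorem HilbertBasis.add_mem_supp (hA : A ∈ b.supp r) (hB : B ∈ b.supp r) : A + B ∈ b.supp r :=
  fun i j h => by rw [b.entry_add, hA i j h, hB i j h, add_zero]

theorem HilbertBasis.sub_mem_supp (hA : A ∈ b.supp r) (hB : B ∈ b.supp r) : A - B ∈ b.supp r :=
  fun i j h => by rw [b.entry_sub, hA i j h, hB i j h, sub_zero]

theorem HilbertBasis.smul_mem_supp (c : ℂ) (hA : A ∈ b.supp r) : c • A ∈ b.supp r :=
  fun i j h => by rw [b.entry_smul, hA i j h, mul_zero]

theorem HilbertBasis.one_mem_supp (h : ∀ i, r i i) : (1 : H →L[ℂ] H) ∈ b.supp r :=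
  fun i _ hr => b.entry_one_of_ne fun hij => hr (hij ▸ h i)

theorem HilbertBasis.mul_mem_supp (hA : A ∈ b.supp r) (hB : B ∈ b.supp s)
    (h : ∀ i k j, r i k → s k j → t i j) : A * B ∈ b.supp t := by
  intro i j hij
  refine (b.hasSum_entry_mul A B i j).unique ?_
  convert hasSum_zero using 2 with k
  by_cases hr : r i k
  · rw [hB k j fun hs => hij (h i k j hr hs), mul_zero]
  · rw [hA i k hr, zero_mul]

theorem HilbertBasis.isClosed_supp : IsClosed (b.supp r : Set (H →L[ℂ] H)) := by
  simp only [HilbertBasis.supp, Set.ofPred_forall]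
  exact isClosed_iInter fun i => isClosed_iInter fun j => isClosed_iInter fun _ =>
    isClosed_eq (b.continuous_entry i j) continuous_const

variable (b)

open Classical in
theorem HilbertBasis.exists_basisProj (S : Set ι) :
    ∃ A : H →L[ℂ] H, (∀ i v, inner ℂ (b i) (A v) = inner ℂ (if i ∈ S then b i else 0) v) ∧
      ‖A‖ ≤ 1 := by
  refine b.exists_of_rows _ zero_le_one fun v F => ?_
  refine le_trans (Finset.sum_le_sum fun i _ => ?_) ((b.sum_sq_le v F).trans_eq (by simp))
  split_ifs <;> simp

/-- The projection onto the closed span of the basis vectors indexed by `S`. -/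
def HilbertBasis.basisProj (S : Set ι) : H →L[ℂ] H := (b.exists_basisProj S).choose

open Classical in
theorem HilbertBasis.inner_basisProj (S : Set ι) (i : ι) (v : H) :
    inner ℂ (b i) (b.basisProj S v) = if i ∈ S then inner ℂ (b i) v else 0 := by
  refine ((b.exists_basisProj S).choose_spec.1 i v).trans ?_
  split_ifs <;> simp

theorem HilbertBasis.norm_basisProj_le (S : Set ι) : ‖b.basisProj S‖ ≤ 1 :=
  (b.exists_basisProj S).choose_spec.2

theorem HilbertBasis.inner_basisProj_of_mem {S : Set ι} {i : ι} (h : i ∈ S) (v : H) :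
    inner ℂ (b i) (b.basisProj S v) = inner ℂ (b i) v := by
  rw [b.inner_basisProj, if_pos h]

theorem HilbertBasis.inner_basisProj_of_notMem {S : Set ι} {i : ι} (h : i ∉ S) (v : H) :
    inner ℂ (b i) (b.basisProj S v) = 0 := by
  rw [b.inner_basisProj, if_neg h]

theorem HilbertBasis.basisProj_apply_of_mem {S : Set ι} {j : ι} (h : j ∈ S) :
    b.basisProj S (b j) = b j := by
  refine b.ext_inner fun i => ?_
  by_cases hi : i ∈ S
  · rw [b.inner_basisProj_of_mem hi]
  · rw [b.inner_basisProj_of_notMem hi, b.orthonormal.inner_eq_zero]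
    rintro rfl
    exact hi h

theorem HilbertBasis.basisProj_apply_of_notMem {S : Set ι} {j : ι} (h : j ∉ S) :
    b.basisProj S (b j) = 0 := by
  refine b.ext_inner fun i => ?_
  rw [inner_zero_right]
  by_cases hi : i ∈ S
  · rw [b.inner_basisProj_of_mem hi, b.orthonormal.inner_eq_zero]
    rintro rfl
    exact h hi
  · rw [b.inner_basisProj_of_notMem hi]

open Classical in
@[simp] theorem HilbertBasis.entry_basisProj_mul (S : Set ι) (A : H →L[ℂ] H) (i j : ι) :
    b.entry (b.basisProj S * A) i j = if i ∈ S then b.entry A i j else 0 :=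
  b.inner_basisProj S i _

open Classical in
@[simp] theorem HilbertBasis.entry_mul_basisProj (S : Set ι) (A : H →L[ℂ] H) (i j : ι) :
    b.entry (A * b.basisProj S) i j = if j ∈ S then b.entry A i j else 0 := by
  rw [HilbertBasis.entry, mul_apply_eq_comp]
  split_ifs with h
  · rw [b.basisProj_apply_of_mem h, HilbertBasis.entry]
  · rw [b.basisProj_apply_of_notMem h, map_zero, inner_zero_right]

theorem HilbertBasis.basisProj_mul (S S' : Set ι) :
    b.basisProj S * b.basisProj S' = b.basisProj (S ∩ S') := by
  classical
  refine b.entry_ext fun i j => ?_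
  rw [← mul_one (b.basisProj S'), ← mul_one (b.basisProj (S ∩ S'))]
  simp only [b.entry_basisProj_mul, Set.mem_inter_iff]
  split_ifs <;> tauto

theorem HilbertBasis.basisProj_mul_self (S : Set ι) :
    b.basisProj S * b.basisProj S = b.basisProj S := by
  rw [b.basisProj_mul, Set.inter_self]

theorem HilbertBasis.basisProj_univ : b.basisProj Set.univ = 1 := by
  refine b.entry_ext fun i j => ?_
  rw [← mul_one (b.basisProj _), b.entry_basisProj_mul, if_pos (Set.mem_univ i)]

theorem HilbertBasis.basisProj_empty : b.basisProj ∅ = 0 := by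
  refine b.entry_ext fun i j => ?_
  rw [← mul_one (b.basisProj _), b.entry_basisProj_mul, if_neg (Set.notMem_empty i), b.entry_zero]

theorem HilbertBasis.basisProj_union {S S' : Set ι} (h : Disjoint S S') :
    b.basisProj (S ∪ S') = b.basisProj S + b.basisProj S' := by
  classical
  refine b.entry_ext fun i j => ?_
  rw [b.entry_add, ← mul_one (b.basisProj S'), ← mul_one (b.basisProj (S ∪ S')),
    ← mul_one (b.basisProj S)]
  simp only [b.entry_basisProj_mul, Set.mem_union]
  have : i ∈ S → i ∉ S' := fun hs => Set.disjoint_left.1 h hs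
  by_cases h1 : i ∈ S <;> by_cases h2 : i ∈ S' <;> simp_all

theorem HilbertBasis.basisProj_add_compl (S : Set ι) :
    b.basisProj S + b.basisProj Sᶜ = 1 := by
  rw [← b.basisProj_union disjoint_compl_right, Set.union_compl_self, b.basisProj_univ]

theorem HilbertBasis.basisProj_mem_supp (S : Set ι) (h : ∀ i, r i i) :
    b.basisProj S ∈ b.supp r := by
  intro i j hr
  rw [← mul_one (b.basisProj S), b.entry_basisProj_mul, b.one_mem_supp h i j hr, ite_self]

theorem HilbertBasis.inner_basisProj_comm (S : Set ι) (x y : H) :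
    inner ℂ (b.basisProj S x) y = inner ℂ x (b.basisProj S y) := by
  have : ContinuousLinearMap.adjoint (b.basisProj S) = b.basisProj S := by
    refine b.entry_ext fun i j => ?_
    rw [b.entry_adjoint, ← mul_one (b.basisProj S)]
    simp only [b.entry_basisProj_mul]
    by_cases hij : i = j
    · subst hij
      classical
      rw [b.entry_one]
      split_ifs <;> simp
    · rw [b.entry_one_of_ne hij, b.entry_one_of_ne (Ne.symm hij)]
      simp
  rw [← ContinuousLinearMap.adjoint_inner_right, this]

theorem HilbertBasis.sum_basisProj_fiber {κ : Type*} (f : ι → κ) (K : Finset κ) :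
    ∑ k ∈ K, b.basisProj (f ⁻¹' {k}) = b.basisProj (f ⁻¹' K) := by
  classical
  induction K using Finset.induction_on with
  | empty => simp [b.basisProj_empty]
  | insert k K hk ih =>
    rw [Finset.sum_insert hk, ih, ← b.basisProj_union, ← Set.preimage_union, Finset.coe_insert,
      Set.singleton_union]
    exact Disjoint.preimage f (by simpa using hk)

theorem HilbertBasis.norm_basisProj_sq (S : Set ι) (v : H) :
    ‖b.basisProj S v‖ ^ 2 = (inner ℂ v (b.basisProj S v)).re := by
  rw [← inner_self_eq_norm_sq (𝕜 := ℂ), b.inner_basisProj_comm, ← mul_apply_eq_comp,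
    b.basisProj_mul_self]
  rfl

theorem HilbertBasis.norm_basisProj_apply_le (S : Set ι) (v : H) : ‖b.basisProj S v‖ ≤ ‖v‖ :=
  ((b.basisProj S).le_of_opNorm_le (b.norm_basisProj_le S) v).trans_eq (one_mul _)

theorem HilbertBasis.sum_norm_basisProj_sq_le {κ : Type*} (f : ι → κ) (K : Finset κ) (v : H) :
    ∑ k ∈ K, ‖b.basisProj (f ⁻¹' {k}) v‖ ^ 2 ≤ ‖v‖ ^ 2 := by
  simp only [b.norm_basisProj_sq]
  rw [← Complex.re_sum, ← inner_sum, ← sum_apply, b.sum_basisProj_fiber,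
    ← b.norm_basisProj_sq]
  exact pow_le_pow_left₀ (norm_nonneg _) (b.norm_basisProj_apply_le _ v) 2

theorem HilbertBasis.exists_pinching {κ : Type*} (f : ι → κ) (X : H →L[ℂ] H) :
    ∃ A : H →L[ℂ] H, (∀ i j, f i = f j → b.entry A i j = b.entry X i j) ∧
      ∀ i j, f i ≠ f j → b.entry A i j = 0 := by
  classical
  obtain ⟨A, hA, -⟩ := b.exists_of_rows
    (fun i => b.basisProj (f ⁻¹' {f i}) (ContinuousLinearMap.adjoint X (b i)))
    (norm_nonneg X) (fun v F => by
      have key : ∀ i, inner ℂ (b.basisProj (f ⁻¹' {f i}) (ContinuousLinearMap.adjoint X (b i))) v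
          = inner ℂ (b i) (X (b.basisProj (f ⁻¹' {f i}) v)) := fun i => by
        rw [b.inner_basisProj_comm, ContinuousLinearMap.adjoint_inner_left]
      simp only [key]
      have hsq : ∀ k ∈ F.image f,
          ∑ i ∈ F with f i = k, ‖inner ℂ (b i) (X (b.basisProj (f ⁻¹' {f i}) v))‖ ^ 2 ≤
          ‖X‖ ^ 2 * ‖b.basisProj (f ⁻¹' {k}) v‖ ^ 2 := by
        intro k _
        rw [← mul_pow]
        refine le_trans (le_of_eq ?_) ((b.sum_sq_le _ (F.filter fun i => f i = k)).trans
          (pow_le_pow_left₀ (norm_nonneg _) (X.le_opNorm (b.basisProj (f ⁻¹' {k}) v)) 2))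
        refine Finset.sum_congr rfl fun i hi => ?_
        rw [(Finset.mem_filter.1 hi).2]
      rw [← Finset.sum_fiberwise_of_maps_to (t := F.image f) (g := f)
        (fun i hi => Finset.mem_image_of_mem f hi)]
      refine (Finset.sum_le_sum hsq).trans ?_
      rw [← Finset.mul_sum]
      exact mul_le_mul_of_nonneg_left (b.sum_norm_basisProj_sq_le f _ v) (sq_nonneg _))
  refine ⟨A, fun i j hij => ?_, fun i j hij => ?_⟩
  · rw [HilbertBasis.entry, hA, b.inner_basisProj_comm, b.basisProj_apply_of_mem (by simp [hij]),
      ContinuousLinearMap.adjoint_inner_left, HilbertBasis.entry]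
  · rw [HilbertBasis.entry, hA, b.inner_basisProj_comm,
      b.basisProj_apply_of_notMem (by simpa using Ne.symm hij), inner_zero_right]

end Matrices

section InfinitePaving

variable {ι : Type*} (b : HilbertBasis ι ℂ H)

open Matrix ComplexOrder

theorem HilbertBasis.norm_sq_sum_smul (F : Finset ι) (w : ι → ℂ) :
    ‖∑ i ∈ F, w i • b i‖ ^ 2 = ∑ i ∈ F, ‖w i‖ ^ 2 := by
  rw [← inner_self_eq_norm_sq (𝕜 := ℂ), b.orthonormal.inner_sum]
  simp only [Complex.conj_mul']
  simp [← Complex.ofReal_pow]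

theorem HilbertBasis.inner_sum_smul (F : Finset ι) (R : H →L[ℂ] H) (w : ι → ℂ) :
    inner ℂ (∑ i ∈ F, w i • b i) (R (∑ i ∈ F, w i • b i)) =
      star (fun i : F => w i) ⬝ᵥ (Matrix.of fun i j : F => b.entry R i j) *ᵥ fun i : F => w i := by
  simp only [map_sum, map_smul, sum_inner, inner_sum, inner_smul_left, inner_smul_right,
    dotProduct, mulVec, Pi.star_apply, Matrix.of_apply, Finset.mul_sum, HilbertBasis.entry]
  rw [Finset.sum_comm, ← Finset.sum_coe_sort]
  refine Finset.sum_congr rfl fun i _ => ?_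
  rw [← Finset.sum_coe_sort]
  refine Finset.sum_congr rfl fun j _ => ?_
  simp only [RCLike.star_def]
  ring

theorem Matrix.re_dotProduct_conjTranspose_mulVec {κ : Type*} [Fintype κ] (B : Matrix κ κ ℂ)
    (v : κ → ℂ) : (star v ⬝ᵥ Bᴴ *ᵥ v).re = (star v ⬝ᵥ B *ᵥ v).re := by
  have : star v ⬝ᵥ Bᴴ *ᵥ v = star (star v ⬝ᵥ B *ᵥ v) := by
    rw [Matrix.star_dotProduct, Matrix.star_mulVec, Matrix.conjTranspose_conjTranspose,
      ← Matrix.dotProduct_mulVec]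
  rw [this, RCLike.star_def, Complex.conj_re]

theorem HilbertBasis.exists_paving (R : H →L[ℂ] H) (hR : ∀ i, b.entry R i i = 0) :
    ∃ (r : ℕ) (c : ι → Fin (r + 1)), ∀ k v, 
      (inner ℂ (b.basisProj (c ⁻¹' {k}) v) (R (b.basisProj (c ⁻¹' {k}) v))).re ≤
        1 / 2 * ‖b.basisProj (c ⁻¹' {k}) v‖ ^ 2 := by
  classical
  obtain ⟨r, hr⟩ := _root_.exists_paving (le_max_left 1 ‖R‖)
  have hfin : ∀ F : Finset ι, ∃ c : ι → Fin (r + 1), ∀ k, ∀ w : ι → ℂ, 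
      (∀ i ∈ F, c i ≠ k → w i = 0) →
      (inner ℂ (∑ i ∈ F, w i • b i) (R (∑ i ∈ F, w i • b i))).re ≤
        1 / 2 * ‖∑ i ∈ F, w i • b i‖ ^ 2 := by
    intro F
    set B : Matrix F F ℂ := Matrix.of fun i j : F => b.entry R i j with hB
    have hre : ∀ v, (star v ⬝ᵥ ((1 / 2 : ℂ) • (B + Bᴴ)) *ᵥ v).re = (star v ⬝ᵥ B *ᵥ v).re := by
      intro v
      rw [Matrix.smul_mulVec, dotProduct_smul, Matrix.add_mulVec, dotProduct_add, smul_eq_mul,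
        show (1 / 2 : ℂ) = ((1 / 2 : ℝ) : ℂ) by norm_num, Complex.re_ofReal_mul, Complex.add_re,
        Matrix.re_dotProduct_conjTranspose_mulVec]
      ring
    have hext : ∀ v : F → ℂ, ∃ w : ι → ℂ, v = fun i : F => w i := fun v =>
      ⟨fun i => if h : i ∈ F then v ⟨i, h⟩ else 0, by ext i; simp⟩
    have hherm : ((1 / 2 : ℂ) • (B + Bᴴ)).IsHermitian := by
      rw [Matrix.IsHermitian, Matrix.conjTranspose_smul, Matrix.conjTranspose_add,
        Matrix.conjTranspose_conjTranspose, add_comm]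
      simp
    have hdiag : ∀ i, ((1 / 2 : ℂ) • (B + Bᴴ)) i i = 0 := by simp [hB, hR]
    have hbd : ∀ v : F → ℂ, |(star v ⬝ᵥ ((1 / 2 : ℂ) • (B + Bᴴ)) *ᵥ v).re| ≤
        max 1 ‖R‖ * ∑ i, ‖v i‖ ^ 2 := by
      intro v
      obtain ⟨w, rfl⟩ := hext v
      rw [hre, hB, ← b.inner_sum_smul, Finset.sum_coe_sort F fun i => ‖w i‖ ^ 2,
        ← b.norm_sq_sum_smul]
      set x := ∑ i ∈ F, w i • b i
      calc _ ≤ ‖inner ℂ x (R x)‖ := Complex.abs_re_le_norm _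
        _ ≤ ‖x‖ * ‖R x‖ := norm_inner_le_norm _ _
        _ ≤ ‖x‖ * (‖R‖ * ‖x‖) := by gcongr; exact R.le_opNorm x
        _ = ‖R‖ * ‖x‖ ^ 2 := by ring
        _ ≤ _ := by gcongr; exact le_max_right _ _
    obtain ⟨c, hc⟩ := hr ((1 / 2 : ℂ) • (B + Bᴴ)) hherm hdiag hbd
    refine ⟨fun i => if h : i ∈ F then c ⟨i, h⟩ else 0, fun k w hw => ?_⟩
    rw [b.inner_sum_smul, ← hB, ← hre, b.norm_sq_sum_smul, ← Finset.sum_coe_sort]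
    refine hc k _ fun i hi => hw i i.2 ?_
    simpa using hi
  choose c hc using hfin
  let 𝒰 : Ultrafilter (Finset ι) := Ultrafilter.of Filter.atTop
  have h𝒰 : (𝒰 : Filter (Finset ι)) ≤ Filter.atTop := Ultrafilter.of_le _
  have hlim : ∀ i, ∃ k, ∀ᶠ F in (𝒰 : Filter (Finset ι)), c F i = k := by
    intro i
    obtain ⟨k, hk⟩ := Ultrafilter.eq_pure_of_finite (𝒰.map fun F => c F i)
    refine ⟨k, ?_⟩
    have : {k} ∈ 𝒰.map fun F => c F i := by rw [hk]; exact Set.mem_singleton k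
    exact this
  choose d hd using hlim
  refine ⟨r, d, fun k v => ?_⟩
  set x := b.basisProj (d ⁻¹' {k}) v with hx
  have hsum : HasSum (fun i => inner ℂ (b i) x • b i) x := by
    simpa only [b.repr_apply_apply] using b.hasSum_repr x
  have hcont : Continuous fun y : H => 1 / 2 * ‖y‖ ^ 2 - (inner ℂ y (R y)).re := by
    refine Continuous.sub (by fun_prop) (Complex.continuous_re.comp ?_)
    exact continuous_id.inner R.continuous
  have := ge_of_tendsto (b := (0 : ℝ)) ((hcont.tendsto x).comp hsum)
    (Filter.Eventually.of_forall fun G => ?_)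
  · linarith
  have hG : ∀ᶠ F in (𝒰 : Filter (Finset ι)), G ≤ F ∧ ∀ i ∈ G, c F i = d i :=
    (Filter.Eventually.filter_mono h𝒰 (Filter.eventually_ge_atTop G)).and
      ((Filter.eventually_all_finset G).2 fun i _ => hd i)
  obtain ⟨F, hGF, hF⟩ := hG.exists
  have hFG : ∑ i ∈ G, inner ℂ (b i) x • b i =
      ∑ i ∈ F, (if i ∈ G then inner ℂ (b i) x else 0 : ℂ) • b i := by
    rw [← Finset.sum_subset hGF (fun i _ hi => by simp [hi])]
    exact Finset.sum_congr rfl fun i hi => by rw [if_pos hi]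
  simp only [Function.comp]
  rw [hFG, sub_nonneg]
  refine hc F k _ fun i _ hi => ?_
  split_ifs with h
  · rw [hx, b.inner_basisProj_of_notMem]
    rw [hF i h] at hi
    simpa using hi
  · rfl

theorem HilbertBasis.exists_inverse_mem_supp {r : ι → ι → Prop} (hrefl : ∀ i, r i i)
    (htrans : ∀ i j k, r i j → r j k → r i k) {X : H →L[ℂ] H} (hX : X ∈ b.supp r)
    (h : ‖1 - X‖ < 1) : ∃ Y ∈ b.supp r, Y * X = 1 := by
  have hs := (summable_geometric_of_norm_lt_one h).hasSum
  refine ⟨∑' n, (1 - X) ^ n, ?_, ?_⟩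
  · refine b.isClosed_supp.mem_of_tendsto hs (Filter.Eventually.of_forall fun F => ?_)
    have hpow : ∀ n, (1 - X) ^ n ∈ b.supp r := by
      intro n
      induction n with
      | zero => rw [pow_zero]; exact HilbertBasis.one_mem_supp hrefl
      | succ n ih =>
        rw [pow_succ]
        exact HilbertBasis.mul_mem_supp ih
          (HilbertBasis.sub_mem_supp (HilbertBasis.one_mem_supp hrefl) hX) fun i k j => htrans i k j
    exact Finset.sum_induction _ (· ∈ b.supp r) (fun _ _ => HilbertBasis.add_mem_supp)
      HilbertBasis.zero_mem_supp fun n _ => hpow n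
  · have := geom_series_mul_neg (1 - X) h
    rwa [sub_sub_cancel] at this

theorem norm_one_sub_smul_lt_one {B : H →L[ℂ] H} (h : ∀ v, 1 / 2 * ‖v‖ ^ 2 ≤ (inner ℂ v (B v)).re) :
    ‖1 - ((1 / (2 * (‖B‖ ^ 2 + 1)) : ℝ) : ℂ) • B‖ < 1 := by
  set M := ‖B‖ ^ 2 + 1 with hM
  have hM1 : 1 ≤ M := by have := sq_nonneg ‖B‖; linarith
  set t : ℝ := 1 / (2 * M) with ht
  have ht0 : 0 < t := by positivity
  have htM : t * M = 1 / 2 := by rw [ht]; field_simp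
  have ht1 : t ≤ 1 / 2 := by nlinarith
  have hle : ‖1 - (t : ℂ) • B‖ ≤ Real.sqrt (1 - t / 2) := by
    refine ContinuousLinearMap.opNorm_le_bound _ (Real.sqrt_nonneg _) fun v => ?_
    rw [← Real.sqrt_sq (norm_nonneg v), ← Real.sqrt_mul (by linarith)]
    refine Real.le_sqrt_of_sq_le ?_
    have hsub : (1 - (t : ℂ) • B) v = v - (t : ℂ) • B v := rfl
    rw [hsub, @norm_sub_sq ℂ, inner_smul_right, norm_smul]
    have h1 := h v
    have h2 : ‖B v‖ ^ 2 ≤ M * ‖v‖ ^ 2 := by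
      have := pow_le_pow_left₀ (norm_nonneg _) (B.le_opNorm v) 2
      nlinarith [sq_nonneg ‖v‖]
    have h3 : RCLike.re ((t : ℂ) * inner ℂ v (B v)) = t * (inner ℂ v (B v)).re :=
      Complex.re_ofReal_mul _ _
    have h4 : ‖(t : ℂ)‖ = t := by simp [abs_of_pos ht0]
    rw [h3, h4, mul_pow]
    have h5 : t ^ 2 * ‖B v‖ ^ 2 ≤ t * (1 / 2 * ‖v‖ ^ 2) := by
      rw [← htM]
      nlinarith [mul_le_mul_of_nonneg_left h2 (sq_nonneg t)]
    nlinarith [mul_le_mul_of_nonneg_left h1 ht0.le]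
  refine hle.trans_lt ?_
  rw [Real.sqrt_lt' one_pos]
  linarith

variable {α : Type*} [LinearOrder α] (a : ι → α)

theorem HilbertBasis.one_mem_of_one_sub_strict_mem {R : H →L[ℂ] H}
    (hR : R ∈ b.supp fun i j => a i < a j) {J : Set (H →L[ℂ] H)}
    (hJ : IsIdealOfSet (b.supp fun i j => a i ≤ a j) J) (hRJ : 1 - R ∈ J) : 1 ∈ J := by
  obtain ⟨r, c, hc⟩ := b.exists_paving R fun i => hR i i (lt_irrefl _)
  obtain ⟨hJT, hJ0, hJadd, hJsmul, hJmul⟩ := hJ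
  have hP : ∀ k, b.basisProj (c ⁻¹' {k}) ∈ J := by
    intro k
    set P := b.basisProj (c ⁻¹' {k}) with hPdef
    have hPT : P ∈ b.supp fun i j => a i ≤ a j := b.basisProj_mem_supp _ fun _ => le_rfl
    have hPP : P * P = P := b.basisProj_mul_self _
    have hPX : P * (1 - R) * P ∈ J := (hJmul P hPT _ (hJmul P hPT _ hRJ).1).2
    set B := 1 - P + P * (1 - R) * P with hB
    have hBT : B ∈ b.supp fun i j => a i ≤ a j :=
      HilbertBasis.add_mem_supp (HilbertBasis.sub_mem_supp
        (HilbertBasis.one_mem_supp fun _ => le_rfl) hPT) (hJT hPX)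
    have hBv : ∀ v, 1 / 2 * ‖v‖ ^ 2 ≤ (inner ℂ v (B v)).re := by
      intro v
      have hBe : B = 1 - P * R * P := by
        rw [hB, mul_sub, sub_mul, mul_one, hPP]; abel
      have h1 : inner ℂ v (B v) = inner ℂ v v - inner ℂ (P v) (R (P v)) := by
        rw [hBe, _root_.sub_apply, inner_sub_right, hPdef, b.inner_basisProj_comm]
        rfl
      have h2 : (inner ℂ v v).re = ‖v‖ ^ 2 := inner_self_eq_norm_sq (𝕜 := ℂ) v
      have h3 := hc k v
      have h4 := pow_le_pow_left₀ (norm_nonneg _) (b.norm_basisProj_apply_le (c ⁻¹' {k}) v) 2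
      rw [h1, Complex.sub_re, h2]
      linarith
    obtain ⟨Y, hY, hYB⟩ := b.exists_inverse_mem_supp (r := fun i j => a i ≤ a j) (fun i => le_refl (a i))
      (fun _ _ _ => le_trans) (HilbertBasis.smul_mem_supp _ hBT) (norm_one_sub_smul_lt_one hBv)
    rw [mul_smul_comm, ← smul_mul_assoc] at hYB
    have hBP : B * P = P * (1 - R) * P := by
      rw [hB, add_mul, sub_mul, one_mul, hPP, sub_self, zero_add, mul_assoc, hPP]
    have := (hJmul _ (HilbertBasis.smul_mem_supp
      ((1 / (2 * (‖B‖ ^ 2 + 1)) : ℝ) : ℂ) hY) _ hPX).1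
    rwa [← hBP, ← mul_assoc, hYB, one_mul] at this
  have hsum := b.sum_basisProj_fiber c Finset.univ
  rw [Finset.coe_univ, Set.preimage_univ, b.basisProj_univ] at hsum
  rw [← hsum]
  exact Finset.sum_induction _ (· ∈ J) (fun X Y hX hY => hJadd X hX Y hY) hJ0 fun k _ => hP k

end InfinitePaving

section Coloring

theorem wellFounded_of_finite_initial {α : Type*} {R : α → α → Prop} (hirr : ∀ x, ¬ R x x)
    (htrans : ∀ x y z, R x y → R y z → R x z) (hfin : ∀ x, {y | R y x}.Finite) :
    WellFounded R := by
  refine Subrelation.wf (r := InvImage (· < ·) fun x => {y | R y x}.ncard) ?_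
    (InvImage.wf _ wellFounded_lt)
  intro x y hxy
  exact Set.ncard_lt_ncard ⟨fun z hz => htrans z x y hz hxy, fun h => hirr x (h hxy)⟩ (hfin y)

theorem Fin.exists_ne_ne_three (x y : Fin 3) : ∃ z, z ≠ x ∧ z ≠ y := by
  decide +revert

theorem exists_color_extension {α : Type*} [LinearOrder α] (s : Set α) (hs : s.Finite) (x : α)
    (f : α → Fin 3) : ∃ k, ∀ y ∈ s, f y = k →
      (y < x → ∃ r ∈ s, y < r ∧ r < x ∧ f r ≠ k) ∧ (x < y → ∃ r ∈ s, x < r ∧ r < y ∧ f r ≠ k) := by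
  have hlow : ∃ k₁, ∀ k, k ≠ k₁ → ∀ y ∈ s, f y = k → y < x → ∃ r ∈ s, y < r ∧ r < x ∧ f r ≠ k := by
    by_cases hne : (s ∩ Set.Iio x).Nonempty
    · obtain ⟨m, hm, hmax⟩ := (hs.inter_of_left _).exists_maximal hne
      refine ⟨f m, fun k hk y hy hyk hyx => ⟨m, hm.1, ?_, hm.2, hk.symm⟩⟩
      refine lt_of_le_of_ne (le_of_not_gt fun h => ?_) ?_
      · exact (hmax ⟨hy, hyx⟩ h.le).not_gt h
      · rintro rfl
        exact hk hyk.symm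
    · exact ⟨0, fun k _ y hy _ hyx => absurd ⟨y, hy, hyx⟩ hne⟩
  have hup : ∃ k₂, ∀ k, k ≠ k₂ → ∀ y ∈ s, f y = k → x < y → ∃ r ∈ s, x < r ∧ r < y ∧ f r ≠ k := by
    by_cases hne : (s ∩ Set.Ioi x).Nonempty
    · obtain ⟨m, hm, hmin⟩ := (hs.inter_of_left _).exists_minimal hne
      refine ⟨f m, fun k hk y hy hyk hyx => ⟨m, hm.1, hm.2, ?_, hk.symm⟩⟩
      refine lt_of_le_of_ne (le_of_not_gt fun h => ?_) ?_
      · exact (hmin ⟨hy, hyx⟩ h.le).not_gt h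
      · rintro rfl
        exact hk hyk.symm
    · exact ⟨0, fun k _ y hy _ hyx => absurd ⟨y, hy, hyx⟩ hne⟩
  obtain ⟨k₁, h₁⟩ := hlow
  obtain ⟨k₂, h₂⟩ := hup
  obtain ⟨k, hk₁, hk₂⟩ := Fin.exists_ne_ne_three k₁ k₂
  exact ⟨k, fun y hy hyk => ⟨h₁ k hk₁ y hy hyk, h₂ k hk₂ y hy hyk⟩⟩

open Classical in
/-- Colour points one at a time along `R`, avoiding the colours of the two neighbours of the new
point among its predecessors. -/
theorem exists_separating_coloring {α : Type*} [LinearOrder α] {R : α → α → Prop}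
    (hirr : ∀ x, ¬ R x x) (htrans : ∀ x y z, R x y → R y z → R x z)
    (hfin : ∀ x, {y | R y x}.Finite) :
    ∃ c : α → Fin 3, ∀ x y, R y x → c y = c x →
      (y < x → ∃ r, R r x ∧ y < r ∧ r < x ∧ c r ≠ c x) ∧
      (x < y → ∃ r, R r x ∧ x < r ∧ r < y ∧ c r ≠ c x) := by
  have wf := wellFounded_of_finite_initial hirr htrans hfin
  let F : ∀ x : α, (∀ y, R y x → Fin 3) → Fin 3 := fun x ih =>
    (exists_color_extension {y | R y x} (hfin x) x
      fun y => if h : R y x then ih y h else 0).choose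
  refine ⟨wf.fix F, fun x y hyx hc => ?_⟩
  have hspec := (exists_color_extension {y | R y x} (hfin x) x
    fun y => if _ : R y x then wf.fix F y else 0).choose_spec
  have heq : wf.fix F x = (exists_color_extension {y | R y x} (hfin x) x
    fun y => if _ : R y x then wf.fix F y else 0).choose := by rw [wf.fix_eq]
  rw [← heq] at hspec
  obtain ⟨h₁, h₂⟩ := hspec y hyx (by simp only [dif_pos hyx]; exact hc)
  refine ⟨fun h => ?_, fun h => ?_⟩
  · obtain ⟨r, hr, hyr, hrx, hrk⟩ := h₁ h
    rw [dif_pos (show R r x from hr)] at hrk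
    exact ⟨r, hr, hyr, hrx, hrk⟩
  · obtain ⟨r, hr, hyr, hrx, hrk⟩ := h₂ h
    rw [dif_pos (show R r x from hr)] at hrk
    exact ⟨r, hr, hyr, hrx, hrk⟩

end Coloring

section Hosts

variable {ι α τ : Type*} [LinearOrder α]

/-- If any two points of `A` are separated by a point carrying at least as many hosts as the
smaller of their weights, the total weight of `S`, one maximal weight excepted, is at most the
number of hosts in an interval containing `S`. -/
theorem sum_erase_le_card_hosts (ℋ : Finset ι) (a : ι → α) (d : α → ℕ) (A : Finset α)
    (hsep : ∀ p ∈ A, ∀ q ∈ A, p < q →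
      ∃ r, p < r ∧ r < q ∧ min (d p) (d q) ≤ (ℋ.filter fun i => a i = r).card)
    (S : Finset α) : S ⊆ A → ∀ x y, (∀ p ∈ S, x ≤ p ∧ p ≤ y) → ∀ m ∈ S, (∀ p ∈ S, d p ≤ d m) →
      ∑ p ∈ S.erase m, d p ≤ (ℋ.filter fun i => x < a i ∧ a i < y).card := by
  induction S using Finset.strongInduction with
  | H S ih =>
  intro hSA x y hxy m hm hmax
  by_cases hne : (S.erase m).Nonempty
  swap
  · rw [Finset.not_nonempty_iff_eq_empty.1 hne]
    simp
  obtain ⟨m', hm', hmax'⟩ := Finset.exists_max_image (S.erase m) d hne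
  obtain ⟨hmm', hm'S⟩ := Finset.mem_erase.1 hm'
  have hd : d m' ≤ d m := hmax m' hm'S
  have hr : ∃ r, (m < r ∧ r < m' ∨ m' < r ∧ r < m) ∧
      d m' ≤ (ℋ.filter fun i => a i = r).card := by
    rcases lt_or_gt_of_ne hmm' with h | h
    · obtain ⟨r, h1, h2, h3⟩ := hsep m' (hSA hm'S) m (hSA hm) h
      exact ⟨r, Or.inr ⟨h1, h2⟩, by rwa [min_eq_left hd] at h3⟩
    · obtain ⟨r, h1, h2, h3⟩ := hsep m (hSA hm) m' (hSA hm'S) h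
      exact ⟨r, Or.inl ⟨h1, h2⟩, by rwa [min_eq_right hd] at h3⟩
  obtain ⟨r, hrm, hdr⟩ := hr
  set S₁ := S.filter (· < r) with hS₁
  set S₂ := S.filter fun p => ¬ p < r with hS₂
  have hxr : x < r ∧ r < y := by
    have h1 := hxy m hm
    have h2 := hxy m' hm'S
    rcases hrm with h | h
    · exact ⟨h1.1.trans_lt h.1, h.2.trans_le h2.2⟩
    · exact ⟨h2.1.trans_lt h.1, h.2.trans_le h1.2⟩
  have hhosts : (ℋ.filter fun i => x < a i ∧ a i < r).card + (ℋ.filter fun i => a i = r).card +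
      (ℋ.filter fun i => r < a i ∧ a i < y).card ≤
      (ℋ.filter fun i => x < a i ∧ a i < y).card := by
    classical
    rw [← Finset.card_union_of_disjoint, ← Finset.card_union_of_disjoint]
    · refine Finset.card_le_card fun i hi => ?_
      simp only [Finset.mem_union, Finset.mem_filter] at hi ⊢
      rcases hi with (hi | hi) | hi
      · exact ⟨hi.1, hi.2.1, hi.2.2.trans hxr.2⟩
      · exact ⟨hi.1, hi.2 ▸ hxr.1, hi.2 ▸ hxr.2⟩
      · exact ⟨hi.1, hxr.1.trans hi.2.1, hi.2.2⟩
    · rw [Finset.disjoint_left]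
      intro i hi hi'
      simp only [Finset.mem_union, Finset.mem_filter] at hi hi'
      rcases hi with hi | hi
      · exact lt_asymm hi.2.2 hi'.2.1
      · exact hi'.2.1.ne' hi.2
    · rw [Finset.disjoint_left]
      intro i hi hi'
      simp only [Finset.mem_filter] at hi hi'
      exact hi.2.2.ne hi'.2
  have key : ∀ u ∈ S₁, ∀ v ∈ S₂, (∀ p ∈ S₁, d p ≤ d u) → (∀ p ∈ S₂, d p ≤ d v) →
      ∑ p ∈ S₁.erase u, d p + ∑ p ∈ S₂.erase v, d p + d m' ≤
        (ℋ.filter fun i => x < a i ∧ a i < y).card := by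
    intro u hu v hv hu' hv'
    have hS₁ss : S₁ ⊂ S := (Finset.filter_ssubset).2
      ⟨v, (Finset.mem_filter.1 hv).1, (Finset.mem_filter.1 hv).2⟩
    have hS₂ss : S₂ ⊂ S := (Finset.filter_ssubset).2
      ⟨u, (Finset.mem_filter.1 hu).1, not_not.2 (Finset.mem_filter.1 hu).2⟩
    have h1 := ih S₁ hS₁ss (hS₁ss.1.trans hSA) x r (fun p hp =>
      ⟨(hxy p (hS₁ss.1 hp)).1, (Finset.mem_filter.1 hp).2.le⟩) u hu hu'
    have h2 := ih S₂ hS₂ss (hS₂ss.1.trans hSA) r y (fun p hp =>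
      ⟨not_lt.1 (Finset.mem_filter.1 hp).2, (hxy p (hS₂ss.1 hp)).2⟩) v hv hv'
    omega
  have hsplit : ∑ p ∈ S₁, d p + ∑ p ∈ S₂, d p = ∑ p ∈ S, d p :=
    Finset.sum_filter_add_sum_filter_not S _ _
  have hSm := Finset.add_sum_erase S d hm
  have hmaxm : ∀ p ∈ S, p ≠ m → d p ≤ d m' := fun p hp hpm =>
    hmax' p (Finset.mem_erase.2 ⟨hpm, hp⟩)
  rcases hrm with h | h
  · have hm₁ : m ∈ S₁ := Finset.mem_filter.2 ⟨hm, h.1⟩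
    have hm₂ : m' ∈ S₂ := Finset.mem_filter.2 ⟨hm'S, h.2.not_gt⟩
    have := key m hm₁ m' hm₂ (fun p hp => hmax p (Finset.mem_filter.1 hp).1)
      fun p hp => hmaxm p (Finset.mem_filter.1 hp).1 (by
        rintro rfl
        exact (Finset.mem_filter.1 hp).2 h.1)
    have e1 := Finset.add_sum_erase S₁ d hm₁
    have e2 := Finset.add_sum_erase S₂ d hm₂
    omega
  · have hm₁ : m' ∈ S₁ := Finset.mem_filter.2 ⟨hm'S, h.1⟩
    have hm₂ : m ∈ S₂ := Finset.mem_filter.2 ⟨hm, h.2.not_gt⟩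
    have := key m' hm₁ m hm₂ (fun p hp => hmaxm p (Finset.mem_filter.1 hp).1 (by
        rintro rfl
        exact (h.2.trans (Finset.mem_filter.1 hp).2).false))
      fun p hp => hmax p (Finset.mem_filter.1 hp).1
    have e1 := Finset.add_sum_erase S₁ d hm₁
    have e2 := Finset.add_sum_erase S₂ d hm₂
    omega

variable [Fintype τ] {rel dl : τ → α}

theorem card_jobs_le_two_mul_hosts (ℋ : Finset ι) (a : ι → α) (d : α → ℕ) (A : Finset α)
    (hsep : ∀ p ∈ A, ∀ q ∈ A, p < q →
      ∃ r, p < r ∧ r < q ∧ min (d p) (d q) ≤ (ℋ.filter fun i => a i = r).card)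
    (hrel : ∀ j, rel j ∈ A) (hdl : ∀ j, dl j ∈ A) (hlt : ∀ j, rel j < dl j)
    (hcard : ∀ p, (Finset.univ.filter fun j => rel j = p).card ≤ d p)
    (hcard' : ∀ p q, (Finset.univ.filter fun j => rel j = p ∧ dl j = q).card ≤ d q) (x y : α) :
    (Finset.univ.filter fun j => x ≤ rel j ∧ dl j ≤ y).card ≤
      2 * (ℋ.filter fun i => x < a i ∧ a i < y).card := by
  set S := A.filter fun p => x ≤ p ∧ p ≤ y with hS
  by_cases hne : S.Nonempty
  swap
  · rw [Finset.card_eq_zero.2]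
    · exact Nat.zero_le _
    rw [Finset.filter_eq_empty_iff]
    rintro j - ⟨h1, h2⟩
    exact hne ⟨rel j, Finset.mem_filter.2 ⟨hrel j, h1, (hlt j).le.trans h2⟩⟩
  obtain ⟨m, hm, hmax⟩ := Finset.exists_max_image S d hne
  have hgap := sum_erase_le_card_hosts ℋ a d A hsep S (Finset.filter_subset _ _) x y
    (fun p hp => (Finset.mem_filter.1 hp).2) m hm hmax
  set W := Finset.univ.filter fun j => x ≤ rel j ∧ dl j ≤ y with hW
  have hWrel : ∀ j ∈ W, rel j ∈ S := fun j hj => by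
    obtain ⟨-, h1, h2⟩ := Finset.mem_filter.1 hj
    exact Finset.mem_filter.2 ⟨hrel j, h1, (hlt j).le.trans h2⟩
  have hWdl : ∀ j ∈ W, dl j ∈ S := fun j hj => by
    obtain ⟨-, h1, h2⟩ := Finset.mem_filter.1 hj
    exact Finset.mem_filter.2 ⟨hdl j, h1.trans (hlt j).le, h2⟩
  have h1 : (W.filter fun j => rel j ≠ m).card ≤ ∑ p ∈ S.erase m, d p := by
    rw [Finset.card_eq_sum_card_fiberwise (t := S.erase m) (f := rel)]
    · refine Finset.sum_le_sum fun p _ => (Finset.card_le_card ?_).trans (hcard p)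
      intro j hj
      simpa using (Finset.mem_filter.1 hj).2
    · intro j hj
      obtain ⟨hj, hjm⟩ := Finset.mem_filter.1 hj
      exact Finset.mem_erase.2 ⟨hjm, hWrel j hj⟩
  have h2 : (W.filter fun j => ¬ rel j ≠ m).card ≤ ∑ p ∈ S.erase m, d p := by
    rw [Finset.card_eq_sum_card_fiberwise (t := S.erase m) (f := dl)]
    · refine Finset.sum_le_sum fun p _ => (Finset.card_le_card ?_).trans (hcard' m p)
      intro j hj
      obtain ⟨hj, hjp⟩ := Finset.mem_filter.1 hj
      exact Finset.mem_filter.2 ⟨Finset.mem_univ j, not_not.1 (Finset.mem_filter.1 hj).2, hjp⟩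
    · intro j hj
      obtain ⟨hj, hjm⟩ := Finset.mem_filter.1 hj
      refine Finset.mem_erase.2 ⟨fun h => ?_, hWdl j hj⟩
      have := hlt j
      rw [not_not.1 hjm, h] at this
      exact this.false
  have := Finset.card_filter_add_card_filter_not (s := W) (fun j => rel j ≠ m)
  omega

theorem card_le_two_mul_covered_hosts (ℋ : Finset ι) (a : ι → α)
    (hdemand : ∀ x y, (Finset.univ.filter fun j => x ≤ rel j ∧ dl j ≤ y).card ≤
      2 * (ℋ.filter fun i => x < a i ∧ a i < y).card)
    (hdl : ∀ i ∈ ℋ, ∀ j, a i ≠ dl j) (S : Finset τ) :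
    S.card ≤ 2 * (ℋ.filter fun i => ∃ j ∈ S, rel j < a i ∧ a i < dl j).card := by
  induction S using Finset.strongInduction with
  | H S ih =>
  rcases S.eq_empty_or_nonempty with rfl | hne
  · simp
  obtain ⟨j₀, hj₀, hmin⟩ := Finset.exists_min_image S rel hne
  obtain ⟨j₁, hj₁, hmax⟩ := Finset.exists_max_image S dl hne
  set C := (S.image dl).filter fun B => ∀ j ∈ S, dl j ≤ B ∨ B ≤ rel j with hC
  obtain ⟨B, hB, hBmin⟩ := Finset.exists_min_image C id
    ⟨dl j₁, Finset.mem_filter.2 ⟨Finset.mem_image_of_mem _ hj₁, fun j hj => Or.inl (hmax j hj)⟩⟩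
  obtain ⟨hBim, hBS⟩ := Finset.mem_filter.1 hB
  obtain ⟨j₂, hj₂, hj₂B⟩ := Finset.mem_image.1 hBim
  set S₂ := S.filter fun j => ¬ dl j ≤ B with hS₂
  have hS₂ss : S₂ ⊂ S := Finset.filter_ssubset.2 ⟨j₂, hj₂, not_not.2 hj₂B.le⟩
  have hS₂rel : ∀ j ∈ S₂, B ≤ rel j := fun j hj =>
    (hBS j (hS₂ss.1 hj)).resolve_left (Finset.mem_filter.1 hj).2
  have h1 : (S.filter fun j => dl j ≤ B).card ≤
      2 * (ℋ.filter fun i => rel j₀ < a i ∧ a i < B).card := by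
    refine (Finset.card_le_card fun j hj => ?_).trans (hdemand (rel j₀) B)
    obtain ⟨hj, hjB⟩ := Finset.mem_filter.1 hj
    exact Finset.mem_filter.2 ⟨Finset.mem_univ j, hmin j hj, hjB⟩
  have h2 := ih S₂ hS₂ss
  have h3 : (S.filter fun j => dl j ≤ B).card + S₂.card = S.card :=
    Finset.card_filter_add_card_filter_not _
  have hcov : ∀ i ∈ ℋ, rel j₀ < a i → a i < B → ∃ j ∈ S, rel j < a i ∧ a i < dl j := by
    intro i hi hri hiB
    by_contra hcon
    push Not at hcon
    have hlt₀ : dl j₀ < a i := lt_of_le_of_ne (hcon j₀ hj₀ hri) (hdl i hi j₀).symm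
    obtain ⟨j₃, hj₃, hj₃max⟩ := Finset.exists_max_image (S.filter fun j => dl j < a i) dl
      ⟨j₀, Finset.mem_filter.2 ⟨hj₀, hlt₀⟩⟩
    obtain ⟨hj₃S, hj₃lt⟩ := Finset.mem_filter.1 hj₃
    have hmem : dl j₃ ∈ C := by
      refine Finset.mem_filter.2 ⟨Finset.mem_image_of_mem _ hj₃S, fun j hj => ?_⟩
      rcases lt_or_ge (rel j) (a i) with h | h
      · exact Or.inl (hj₃max j (Finset.mem_filter.2
          ⟨hj, lt_of_le_of_ne (hcon j hj h) (hdl i hi j).symm⟩))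
      · exact Or.inr (hj₃lt.le.trans h)
    exact ((hBmin _ hmem).trans_lt (hj₃lt.trans hiB)).false
  have h4 : (ℋ.filter fun i => rel j₀ < a i ∧ a i < B).card +
      (ℋ.filter fun i => ∃ j ∈ S₂, rel j < a i ∧ a i < dl j).card ≤
      (ℋ.filter fun i => ∃ j ∈ S, rel j < a i ∧ a i < dl j).card := by
    classical
    rw [← Finset.card_union_of_disjoint]
    · refine Finset.card_le_card fun i hi => ?_
      simp only [Finset.mem_union, Finset.mem_filter] at hi ⊢
      rcases hi with ⟨hi, h1, h2⟩ | ⟨hi, j, hj, h⟩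
      · exact ⟨hi, hcov i hi h1 h2⟩
      · exact ⟨hi, j, hS₂ss.1 hj, h⟩
    · rw [Finset.disjoint_left]
      intro i hi hi'
      obtain ⟨-, -, h⟩ := Finset.mem_filter.1 hi
      obtain ⟨-, j, hj, hj', -⟩ := Finset.mem_filter.1 hi'
      exact (h.trans_le (hS₂rel j hj)).not_gt hj'
  omega

/-- Every job can be given its own host, each host being available twice. -/
theorem exists_hosts (ℋ : Finset ι) (a : ι → α) (d : α → ℕ) (A : Finset α)
    (hsep : ∀ p ∈ A, ∀ q ∈ A, p < q →
      ∃ r, p < r ∧ r < q ∧ min (d p) (d q) ≤ (ℋ.filter fun i => a i = r).card)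
    (hℋ : ∀ i ∈ ℋ, a i ∉ A)
    (hrel : ∀ j, rel j ∈ A) (hdl : ∀ j, dl j ∈ A) (hlt : ∀ j, rel j < dl j)
    (hcard : ∀ p, (Finset.univ.filter fun j => rel j = p).card ≤ d p)
    (hcard' : ∀ p q, (Finset.univ.filter fun j => rel j = p ∧ dl j = q).card ≤ d q) :
    ∃ φ : τ → ι × Bool, Function.Injective φ ∧
      ∀ j, (φ j).1 ∈ ℋ ∧ rel j < a (φ j).1 ∧ a (φ j).1 < dl j := by
  classical
  obtain ⟨φ, hφ, hφ'⟩ := (Finset.all_card_le_biUnion_card_iff_exists_injective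
    fun j : τ => (ℋ.filter fun i => rel j < a i ∧ a i < dl j) ×ˢ (Finset.univ : Finset Bool)).1
    (fun S => by
      have h := card_le_two_mul_covered_hosts ℋ a
        (card_jobs_le_two_mul_hosts ℋ a d A hsep hrel hdl hlt hcard hcard')
        (fun i hi j h => hℋ i hi (h ▸ hdl j)) S
      refine h.trans ?_
      rw [mul_comm, show (2 : ℕ) = (Finset.univ : Finset Bool).card from rfl,
        ← Finset.card_product]
      refine Finset.card_le_card fun x hx => ?_
      simp only [Finset.mem_product, Finset.mem_filter, Finset.mem_biUnion] at hx ⊢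
      obtain ⟨⟨hx, j, hj, h⟩, -⟩ := hx
      exact ⟨j, hj, ⟨hx, h⟩, Finset.mem_univ _⟩)
  refine ⟨φ, hφ, fun j => ?_⟩
  have := hφ' j
  simp only [Finset.mem_product, Finset.mem_filter] at this
  exact this.1

end Hosts

section Hosting

theorem exists_triangular_family {n : ℕ} (y : Fin n → H) :
    ∃ g : Fin n → H, (∀ e, g e ≠ 0 → ‖g e‖ = 1) ∧ (∀ e e', e ≠ e' → inner ℂ (g e) (g e') = 0) ∧
      (∀ e e', e < e' → inner ℂ (g e') (y e) = 0) ∧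
      Submodule.span ℂ (Set.range g) = Submodule.span ℂ (Set.range y) ∧
      ∀ e, y e = 0 → g e = 0 := by
  refine ⟨InnerProductSpace.gramSchmidtNormed ℂ y,
    fun e => InnerProductSpace.gramSchmidtNormed_unit_length', fun e e' h => ?_, fun e e' h => ?_,
    ?_, fun e h => ?_⟩
  · rw [InnerProductSpace.gramSchmidtNormed, InnerProductSpace.gramSchmidtNormed, inner_smul_left,
      inner_smul_right, InnerProductSpace.gramSchmidt_orthogonal ℂ y h, mul_zero, mul_zero]
  · rw [InnerProductSpace.gramSchmidtNormed, inner_smul_left,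
      InnerProductSpace.gramSchmidt_inv_triangular ℂ y h, mul_zero]
  · rw [InnerProductSpace.span_gramSchmidtNormed_range, InnerProductSpace.span_gramSchmidt]
  · rw [InnerProductSpace.gramSchmidtNormed, InnerProductSpace.gramSchmidt_def, h]
    simp

variable {ι : Type*} (b : HilbertBasis ι ℂ H)

theorem HilbertBasis.exists_inner_ne_zero {x y : H} (h : inner ℂ x y ≠ 0) :
    ∃ i, inner ℂ (b i) x ≠ 0 ∧ inner ℂ (b i) y ≠ 0 := by
  by_contra hcon
  push Not at hcon
  refine h ((b.hasSum_inner_mul_inner x y).unique ?_)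
  convert hasSum_zero using 2 with i
  by_cases hi : inner ℂ (b i) x = 0
  · rw [← inner_conj_symm, hi, map_zero, zero_mul]
  · rw [hcon i hi, mul_zero]

/-- The vectors whose coordinates vanish outside `S`. -/
def HilbertBasis.coordSubmodule (S : Set ι) : Submodule ℂ H where
  carrier := {x | ∀ i, i ∉ S → inner ℂ (b i) x = 0}
  zero_mem' := fun i _ => inner_zero_right _
  add_mem' := fun hx hy i hi => by rw [inner_add_right, hx i hi, hy i hi, add_zero]
  smul_mem' := fun c x hx i hi => by rw [inner_smul_right, hx i hi, mul_zero]

theorem HilbertBasis.eq_sum_of_mem_coordSubmodule {S : Finset ι} {x : H}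
    (hx : x ∈ b.coordSubmodule S) : x = ∑ i ∈ S, inner ℂ (b i) x • b i := by
  have h : HasSum (fun i => inner ℂ (b i) x • b i) x := by
    simpa only [b.repr_apply_apply] using b.hasSum_repr x
  refine h.unique (hasSum_sum_of_ne_finset_zero fun i hi => ?_)
  rw [hx i hi, zero_smul]

theorem HilbertBasis.card_le_of_orthonormal {κ : Type*} [Fintype κ] {g : κ → H}
    (hg : Orthonormal ℂ g) (S : Finset ι) (h : ∀ k, g k ∈ b.coordSubmodule S) :
    Fintype.card κ ≤ S.card := by
  classical
  have := linearIndependent_le_span' g hg.linearIndependent ((S.image b : Finset H) : Set H) (by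
    rintro _ ⟨k, rfl⟩
    rw [b.eq_sum_of_mem_coordSubmodule (h k)]
    refine Submodule.sum_mem _ fun i hi => Submodule.smul_mem _ _ (Submodule.subset_span ?_)
    exact Finset.mem_coe.2 (Finset.mem_image_of_mem _ hi))
  rw [Cardinal.mk_fintype, Nat.cast_le] at this
  refine this.trans ?_
  simpa using Finset.card_image_le

variable {α : Type*} [LinearOrder α] {a : ι → α} {J : Set (H →L[ℂ] H)}

/-- If the range of `Y` is spanned by orthonormal vectors `u t`, each of which can be moved to its
own basis vector lying in `σᶜ` and between `u t` and the columns of `Y` using `u t`,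
then `Y ∈ J`. -/
theorem HilbertBasis.mem_of_hosted_family (hJ : IsIdealOfSet (b.supp fun i j => a i ≤ a j) J)
    {σ : Set α} (hσ : b.basisProj (a ⁻¹' σᶜ) ∈ J) {Y : H →L[ℂ] H} {τ : Type*} {v : τ → H}
    (hv : Orthonormal ℂ v) {φ : τ → ι × Bool} (hφ : Function.Injective φ)
    (hφσ : ∀ t, a (φ t).1 ∉ σ)
    (hleft : ∀ t i, inner ℂ (b i) (v t) ≠ 0 → a i < a (φ t).1)
    (hright : ∀ t j, inner ℂ (v t) (Y (b j)) ≠ 0 → a (φ t).1 < a j)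
    (hspan : ∀ j, Y (b j) ∈ Submodule.span ℂ (Set.range v)) : Y ∈ J := by
  classical
  obtain ⟨hJT, hJ0, hJadd, hJsmul, hJmul⟩ := hJ
  let w : Bool → ι → H := fun f i => if h : ∃ t, φ t = (i, f) then v h.choose else 0
  have hw : ∀ t, w (φ t).2 (φ t).1 = v t := fun t => by
    have h : ∃ t', φ t' = ((φ t).1, (φ t).2) := ⟨t, rfl⟩
    simp only [w]
    rw [dif_pos h]
    exact congrArg v (hφ h.choose_spec)
  have hw0 : ∀ f i, w f i ≠ 0 → ∃ t, φ t = (i, f) ∧ w f i = v t := by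
    intro f i h
    by_cases hex : ∃ t, φ t = (i, f)
    · obtain ⟨t, ht⟩ := hex
      refine ⟨t, ht, ?_⟩
      rw [← hw t, ht]
    · exact absurd (dif_neg hex) h
  have hbessel : ∀ f x (F : Finset ι), ∑ i ∈ F, ‖inner ℂ (w f i) x‖ ^ 2 ≤ 1 ^ 2 * ‖x‖ ^ 2 := by
    intro f x F
    rw [one_pow, one_mul]
    rcases isEmpty_or_nonempty τ with hτ | hτ
    · have : ∀ i, w f i = 0 := fun i => by
        by_contra h
        exact hτ.elim (hw0 f i h).choose
      simp [this]
    have hsub : ∑ i ∈ F with ∃ t, φ t = (i, f), ‖inner ℂ (w f i) x‖ ^ 2 =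
        ∑ i ∈ F, ‖inner ℂ (w f i) x‖ ^ 2 := by
      refine Finset.sum_filter_of_ne fun i _ h => ?_
      obtain ⟨t, ht, -⟩ := hw0 f i (fun h0 => h (by rw [h0, inner_zero_left]; simp))
      exact ⟨t, ht⟩
    have hT : ∀ i ∈ F.filter fun i => ∃ t, φ t = (i, f), ∃ t, φ t = (i, f) :=
      fun i hi => (Finset.mem_filter.1 hi).2
    choose! T hT using hT
    have hinj : Set.InjOn T (F.filter fun i => ∃ t, φ t = (i, f)) := fun i hi j hj hij => by
      have := hT j hj
      rw [← hij, hT i hi] at this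
      exact (Prod.ext_iff.1 this).1
    rw [← hsub]
    refine le_trans (le_of_eq ?_) (hv.sum_inner_products_le x
      (s := (F.filter fun i => ∃ t, φ t = (i, f)).image T))
    rw [Finset.sum_image hinj]
    refine Finset.sum_congr rfl fun i hi => ?_
    rw [← hw (T i), hT i hi]
  choose W hW _ using fun f => b.exists_of_rows (w f) zero_le_one (hbessel f)
  set V : Bool → H →L[ℂ] H := fun f => ContinuousLinearMap.adjoint (W f) with hVdef
  have hV : ∀ f i, V f (b i) = w f i := fun f i => by
    refine ext_inner_right ℂ fun x => ?_
    rw [ContinuousLinearMap.adjoint_inner_left, hW]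
  have hVT : ∀ f, V f ∈ b.supp fun i j => a i ≤ a j := by
    intro f i j hij
    by_contra hne
    rw [HilbertBasis.entry, hV] at hne
    obtain ⟨t, ht, hwt⟩ := hw0 f j fun h0 => hne (by rw [h0, inner_zero_right])
    rw [hwt] at hne
    have := hleft t i hne
    rw [ht] at this
    exact hij this.le
  have hVJ : ∀ f, V f ∈ J := by
    intro f
    have : V f = V f * b.basisProj (a ⁻¹' σᶜ) := by
      refine b.ext_apply fun j => ?_
      rw [mul_apply_eq_comp]
      by_cases hj : j ∈ a ⁻¹' σᶜ
      · rw [b.basisProj_apply_of_mem hj]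
      · rw [b.basisProj_apply_of_notMem hj, map_zero, hV]
        by_contra hne
        obtain ⟨t, ht, -⟩ := hw0 f j hne
        refine hj ?_
        have := hφσ t
        rwa [ht] at this
    rw [this]
    exact (hJmul _ (hVT f) _ hσ).1
  have hWT : ∀ f, W f * Y ∈ b.supp fun i j => a i ≤ a j := by
    intro f i j hij
    by_contra hne
    rw [HilbertBasis.entry, mul_apply_eq_comp, hW] at hne
    obtain ⟨t, ht, hwt⟩ := hw0 f i fun h0 => hne (by rw [h0, inner_zero_left])
    rw [hwt] at hne
    have := hright t j hne
    rw [ht] at this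
    exact hij this.le
  have hWv : ∀ f t, W f (v t) = if (φ t).2 = f then b (φ t).1 else 0 := by
    intro f t
    refine b.ext_inner fun i => ?_
    rw [hW]
    by_cases hit : φ t = (i, f)
    · have h1 := hw t
      rw [hit] at h1
      rw [h1, hit, if_pos rfl, inner_self_eq_norm_sq_to_K, inner_self_eq_norm_sq_to_K, hv.1,
        b.orthonormal.1]
    · have hzero : inner ℂ (w f i) (v t) = 0 := by
        by_contra hne
        obtain ⟨t', ht', hwt'⟩ := hw0 f i fun h0 => hne (by rw [h0, inner_zero_left])
        rw [hwt'] at hne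
        refine hne (hv.2 ?_)
        rintro rfl
        exact hit ht'
      rw [hzero]
      split_ifs with hf
      · rw [b.orthonormal.2]
        rintro rfl
        exact hit (Prod.ext rfl hf)
      · rw [inner_zero_right]
  have hfix : ∀ x ∈ Submodule.span ℂ (Set.range v), ∑ f, V f (W f x) = x := by
    intro x hx
    induction hx using Submodule.span_induction with
    | mem x hx =>
      obtain ⟨t, rfl⟩ := hx
      rw [Finset.sum_eq_single (φ t).2]
      · rw [hWv, if_pos rfl, hV, hw]
      · intro f _ hf
        rw [hWv, if_neg hf.symm, map_zero]
      · exact fun h => absurd (Finset.mem_univ _) h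
    | zero => simp
    | add x y _ _ hx hy => simp only [map_add, Finset.sum_add_distrib, hx, hy]
    | smul c x _ hx => simp only [map_smul, ← Finset.smul_sum, hx]
  have hY : Y = ∑ f, V f * (W f * Y) := by
    refine b.ext_apply fun j => ?_
    rw [sum_apply]
    exact (hfix _ (hspan j)).symm
  rw [hY]
  exact Finset.sum_induction _ (· ∈ J) (fun X Y hX hY => hJadd X hX Y hY) hJ0
    fun f _ => (hJmul _ (hWT f) _ (hVJ f)).2

end Hosting

section BlockHosting

universe w

variable {ι : Type*} (b : HilbertBasis ι ℂ H)

theorem Finset.exists_monotone_enumeration {α : Type*} [LinearOrder α] (I : Finset ι) (a : ι → α) :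
    ∃ e : Fin I.card → ι, Function.Injective e ∧ (∀ x, e x ∈ I) ∧ (∀ i ∈ I, ∃ x, e x = i) ∧
      Monotone fun x => a (e x) := by
  let f : Fin I.card → ι := fun x => (I.equivFin.symm x : ι)
  refine ⟨f ∘ Tuple.sort (a ∘ f), ?_, fun x => (I.equivFin.symm _).2, fun i hi => ?_,
    Tuple.monotone_sort (a ∘ f)⟩
  · exact (Subtype.val_injective.comp I.equivFin.symm.injective).comp (Equiv.injective _)
  · exact ⟨(Tuple.sort (a ∘ f)).symm (I.equivFin ⟨i, hi⟩), by simp [f]⟩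

theorem HilbertBasis.inner_eq_zero_of_disjoint {S S' : Set ι} (h : Disjoint S S') {x y : H}
    (hx : x ∈ b.coordSubmodule S) (hy : y ∈ b.coordSubmodule S') : inner ℂ x y = 0 := by
  by_contra hne
  obtain ⟨i, hi, hi'⟩ := b.exists_inner_ne_zero hne
  exact Set.disjoint_left.1 h (not_imp_comm.1 (hx i) hi) (not_imp_comm.1 (hy i) hi')

variable {α : Type w} [LinearOrder α] {a : ι → α} {J : Set (H →L[ℂ] H)}

open Classical in
theorem HilbertBasis.exists_block_jobs {σ : Set α} {Y : H →L[ℂ] H} (I ℋ : Finset ι)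
    (hIσ : ∀ i ∈ I, a i ∈ σ) (hHσ : ∀ i ∈ ℋ, a i ∉ σ)
    (hY : ∀ i, ∀ j ∈ I, b.entry Y i j ≠ 0 → a i < a j ∧ i ∈ I)
    (hsep : ∀ p ∈ I.image a, ∀ q ∈ I.image a, p < q → ∃ r, p < r ∧ r < q ∧
      min (I.filter fun i => a i = p).card (I.filter fun i => a i = q).card ≤
        (ℋ.filter fun i => a i = r).card) :
    ∃ (τ : Type w) (v : τ → H) (φ : τ → ι × Bool), Orthonormal ℂ v ∧ Function.Injective φ ∧
      (∀ t, v t ∈ b.coordSubmodule I) ∧ (∀ t, (φ t).1 ∈ ℋ) ∧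
      (∀ t i, inner ℂ (b i) (v t) ≠ 0 → a i < a (φ t).1) ∧
      (∀ t, ∀ j ∈ I, inner ℂ (v t) (Y (b j)) ≠ 0 → a (φ t).1 < a j) ∧
      ∀ j ∈ I, Y (b j) ∈ Submodule.span ℂ (Set.range v) := by
  obtain ⟨e, he, heI, heS, hmono⟩ := I.exists_monotone_enumeration a
  have hYI : ∀ j ∈ I, Y (b j) ∈ b.coordSubmodule I := fun j hj i hi => by
    by_contra hne
    exact hi (hY i j hj hne).2
  choose g hg1 hg2 hg3 hg4 hg5 using fun p : I.image a =>
    exists_triangular_family fun x => b.basisProj (a ⁻¹' {p.1}) (Y (b (e x)))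
  have hgsupp : ∀ p x, g p x ∈ b.coordSubmodule (I.filter fun i => a i = p.1) := by
    intro p x
    have h1 : g p x ∈ Submodule.span ℂ (Set.range (g p)) := Submodule.subset_span ⟨x, rfl⟩
    rw [hg4] at h1
    refine Submodule.span_le.2 ?_ h1
    rintro _ ⟨y, rfl⟩ i hi
    by_cases hip : i ∈ a ⁻¹' {p.1}
    · rw [b.inner_basisProj_of_mem hip]
      exact hYI _ (heI y) i fun h => hi (Finset.mem_coe.2 (Finset.mem_filter.2 ⟨h, hip⟩))
    · exact b.inner_basisProj_of_notMem hip _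
  have hproj : ∀ p x z, inner ℂ (g p x) (b.basisProj (a ⁻¹' {p.1}) z) = inner ℂ (g p x) z := by
    intro p x z
    rw [← b.inner_basisProj_comm]
    congr 1
    refine b.ext_inner fun i => ?_
    by_cases hip : i ∈ a ⁻¹' {p.1}
    · rw [b.inner_basisProj_of_mem hip]
    · rw [b.inner_basisProj_of_notMem hip, hgsupp p x i fun h => hip (by
        have := (Finset.mem_filter.1 (Finset.mem_coe.1 h)).2
        exact this)]
  let τ := {t : I.image a × Fin I.card // g t.1 t.2 ≠ 0}
  let v : τ → H := fun t => g t.1.1 t.1.2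
  have hv : Orthonormal ℂ v := by
    refine ⟨fun t => hg1 _ _ t.2, ?_⟩
    rintro ⟨⟨p, x⟩, h⟩ ⟨⟨q, y⟩, h'⟩ hne
    by_cases hpq : p = q
    · subst hpq
      refine hg2 p x y ?_
      rintro rfl
      exact hne rfl
    · refine b.inner_eq_zero_of_disjoint ?_ (hgsupp p x) (hgsupp q y)
      rw [Finset.disjoint_coe, Finset.disjoint_left]
      intro i hi hi'
      exact hpq (Subtype.ext ((Finset.mem_filter.1 hi).2.symm.trans (Finset.mem_filter.1 hi').2))
  obtain ⟨φ, hφ, hφ'⟩ := exists_hosts (τ := τ) (rel := fun t => t.1.1.1)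
    (dl := fun t => a (e t.1.2)) ℋ a (fun p => (I.filter fun i => a i = p).card) (I.image a) hsep
    (fun i hi h => by
      obtain ⟨j, hj, hji⟩ := Finset.mem_image.1 h
      exact hHσ i hi (hji ▸ hIσ j hj))
    (fun t => t.1.1.2) (fun t => Finset.mem_image_of_mem a (heI _))
    (fun t => by
      by_contra hlt
      refine t.2 (hg5 _ _ (b.ext_inner fun i => ?_))
      rw [inner_zero_right]
      by_cases hip : i ∈ a ⁻¹' {t.1.1.1}
      · rw [b.inner_basisProj_of_mem hip]
        by_contra hne
        refine hlt ?_
        rw [← show a i = t.1.1.1 from hip]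
        exact (hY i _ (heI _) hne).1
      · exact b.inner_basisProj_of_notMem hip _)
    (fun p => by
      rw [← Fintype.card_subtype]
      refine b.card_le_of_orthonormal (g := fun t : {t : τ // t.1.1.1 = p} => v t.1)
        (hv.comp _ Subtype.val_injective) _ fun t => ?_
      have := hgsupp t.1.1.1 t.1.1.2
      rwa [t.2] at this)
    (fun p q => by
      refine Finset.card_le_card_of_injOn (fun t => e t.1.2) (fun t ht => ?_) ?_
      · exact Finset.mem_coe.2 (Finset.mem_filter.2 ⟨heI _, (Finset.mem_filter.1 ht).2.2⟩)
      · intro t ht t' ht' htt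
        refine Subtype.ext (Prod.ext (Subtype.ext ?_) (he htt))
        exact (Finset.mem_filter.1 ht).2.1.trans (Finset.mem_filter.1 ht').2.1.symm)
  refine ⟨τ, v, φ, hv, hφ, fun t i hi => hgsupp _ _ i fun h => hi ?_, fun t => (hφ' t).1,
    fun t i hi => ?_, fun t j hj hne => ?_, fun j hj => ?_⟩
  · exact Finset.mem_coe.2 (Finset.mem_filter.1 (Finset.mem_coe.1 h)).1
  · have := not_imp_comm.1 (hgsupp t.1.1 t.1.2 i) hi
    rw [(Finset.mem_filter.1 (Finset.mem_coe.1 this)).2]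
    exact (hφ' t).2.1
  · obtain ⟨x, rfl⟩ := heS j hj
    refine (hφ' t).2.2.trans_le (hmono (le_of_not_gt fun hlt => hne ?_))
    have := hg3 t.1.1 x t.1.2 hlt
    rwa [hproj] at this
  · have hdecomp : Y (b j) = ∑ p ∈ (I.image a).attach, b.basisProj (a ⁻¹' {p.1}) (Y (b j)) := by
      rw [Finset.sum_attach (I.image a) fun p => b.basisProj (a ⁻¹' {p}) (Y (b j)),
        ← sum_apply, b.sum_basisProj_fiber]
      refine b.ext_inner fun i => ?_
      by_cases hi : i ∈ a ⁻¹' (I.image a : Finset α)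
      · rw [b.inner_basisProj_of_mem hi]
      · rw [b.inner_basisProj_of_notMem hi]
        exact hYI j hj i fun h => hi (Finset.mem_coe.2 (Finset.mem_image_of_mem a h))
    rw [hdecomp]
    refine Submodule.sum_mem _ fun p _ => ?_
    obtain ⟨x, rfl⟩ := heS j hj
    have h1 : b.basisProj (a ⁻¹' {p.1}) (Y (b (e x))) ∈ Submodule.span ℂ (Set.range (g p)) := by
      rw [hg4]
      exact Submodule.subset_span ⟨x, rfl⟩
    refine Submodule.span_le.2 ?_ h1
    rintro _ ⟨y, rfl⟩
    by_cases h0 : g p y = 0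
    · rw [h0]
      exact Submodule.zero_mem _
    · exact Submodule.subset_span ⟨⟨(p, y), h0⟩, rfl⟩

open Classical in
/-- A strictly upper triangular operator with finite diagonal blocks supported over `σ` lies in `J`
if, in each block, any two atoms are separated by enough basis vectors over `σᶜ`. -/
theorem HilbertBasis.mem_of_hosts (hJ : IsIdealOfSet (b.supp fun i j => a i ≤ a j) J)
    {σ : Set α} (hσ : b.basisProj (a ⁻¹' σᶜ) ∈ J) {Y : H →L[ℂ] H} {κ : Type*} (I ℋ : κ → Finset ι)
    (hI : ∀ k l i, i ∈ I k → i ∈ I l → k = l) (hℋ : ∀ k l i, i ∈ ℋ k → i ∈ ℋ l → k = l)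
    (hIσ : ∀ k, ∀ i ∈ I k, a i ∈ σ) (hHσ : ∀ k, ∀ i ∈ ℋ k, a i ∉ σ)
    (hY : ∀ i j, b.entry Y i j ≠ 0 → a i < a j ∧ ∃ k, i ∈ I k ∧ j ∈ I k)
    (hsep : ∀ k, ∀ p ∈ (I k).image a, ∀ q ∈ (I k).image a, p < q → ∃ r, p < r ∧ r < q ∧
      min ((I k).filter fun i => a i = p).card ((I k).filter fun i => a i = q).card ≤
        ((ℋ k).filter fun i => a i = r).card) : Y ∈ J := by
  have hYk : ∀ i j, b.entry Y i j ≠ 0 → ∀ k, (j ∈ I k → i ∈ I k) ∧ (i ∈ I k → j ∈ I k) := by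
    intro i j hij k
    obtain ⟨-, l, hi, hj⟩ := hY i j hij
    exact ⟨fun h => hI _ _ _ hj h ▸ hi, fun h => hI _ _ _ hi h ▸ hj⟩
  choose τ v φ hv hφ hvI hφℋ hleft hright hspan using fun k =>
    b.exists_block_jobs (Y := Y) (I k) (ℋ k) (hIσ k) (hHσ k)
      (fun i j hj hne => ⟨(hY i j hne).1, (hYk i j hne k).1 hj⟩) (hsep k)
  have hdisj : ∀ k l, k ≠ l → Disjoint (I k : Set ι) (I l) := fun k l hkl =>
    Set.disjoint_left.2 fun i hi hi' => hkl (hI k l i hi hi')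
  refine b.mem_of_hosted_family hJ hσ (τ := Σ k, τ k) (v := fun t => v t.1 t.2)
    (φ := fun t => φ t.1 t.2) ?_ ?_ (fun t => hHσ _ _ (hφℋ _ _)) (fun t => hleft t.1 t.2)
    (fun t j hne => ?_) (fun j => ?_)
  · refine ⟨fun t => (hv t.1).1 t.2, ?_⟩
    rintro ⟨k, t⟩ ⟨l, t'⟩ hne
    by_cases hkl : k = l
    · subst hkl
      refine (hv k).2 ?_
      rintro rfl
      exact hne rfl
    · exact b.inner_eq_zero_of_disjoint (hdisj k l hkl) (hvI k t) (hvI l t')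
  · rintro ⟨k, t⟩ ⟨l, t'⟩ h
    obtain rfl : k = l := hℋ k l _ (hφℋ k t) (by
      have := hφℋ l t'
      rwa [← show φ k t = φ l t' from h] at this)
    exact congrArg (Sigma.mk k) (hφ k h)
  · obtain ⟨i, hi, hi'⟩ := b.exists_inner_ne_zero hne
    exact hright t.1 t.2 j ((hYk i j hi' t.1).2 (not_imp_comm.1 (hvI t.1 t.2 i) hi)) hne
  · by_cases hj : ∃ k, j ∈ I k
    · obtain ⟨k, hk⟩ := hj
      refine Submodule.span_mono ?_ (hspan k j hk)
      rintro _ ⟨t, rfl⟩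
      exact ⟨⟨k, t⟩, rfl⟩
    · have : Y (b j) = 0 := b.ext_inner fun i => by
        rw [inner_zero_right]
        by_contra hne
        obtain ⟨-, k, -, hk⟩ := hY i j hne
        exact hj ⟨k, hk⟩
      rw [this]
      exact Submodule.zero_mem _

end BlockHosting

section DiagonalIdeals

theorem IsIdealOfSet.sub_mem {A J : Set (H →L[ℂ] H)} (hJ : IsIdealOfSet A J) {X Y : H →L[ℂ] H}
    (hX : X ∈ J) (hY : Y ∈ J) : X - Y ∈ J := by
  have := hJ.2.2.1 X hX _ (hJ.2.2.2.1 (-1) Y hY)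
  rwa [neg_one_smul, ← sub_eq_add_neg] at this

theorem IsIdealOfSet.sum_mem {A J : Set (H →L[ℂ] H)} (hJ : IsIdealOfSet A J) {κ : Type*}
    {F : Finset κ} {f : κ → H →L[ℂ] H} (hf : ∀ k ∈ F, f k ∈ J) : ∑ k ∈ F, f k ∈ J :=
  Finset.sum_induction _ (· ∈ J) (fun X Y hX hY => hJ.2.2.1 X hX Y hY) hJ.2.1 hf

theorem IsIdealOfSet.eq_of_one_mem {A J : Set (H →L[ℂ] H)} (hJ : IsIdealOfSet A J)
    (h : (1 : H →L[ℂ] H) ∈ J) : J = A :=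
  hJ.1.antisymm fun X hX => by simpa using (hJ.2.2.2.2 X hX 1 h).1

variable {ι : Type*} (b : HilbertBasis ι ℂ H) {α : Type*} {a : ι → α}
  {M : Set (H →L[ℂ] H)}

theorem HilbertBasis.isClosed_of_isMaximalIdealOfSet
    (hM : IsMaximalIdealOfSet (b.supp fun i j => a i = a j) M) : IsClosed M := by
  obtain ⟨hI, hne, hmax⟩ := hM
  obtain ⟨hD, h0, hadd, hsmul, hmul⟩ := hI
  have hcl : IsIdealOfSet (b.supp fun i j => a i = a j) (closure M) := by
    refine ⟨closure_minimal hD b.isClosed_supp, subset_closure h0, fun X hX Y hY => ?_,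
      fun c X hX => ?_, fun T hT X hX => ⟨?_, ?_⟩⟩
    · exact map_mem_closure₂ continuous_add hX hY fun X hX Y hY => hadd X hX Y hY
    · exact map_mem_closure (continuous_const_smul c) hX fun X hX => hsmul c X hX
    · exact map_mem_closure (continuous_const_mul T) hX fun X hX => (hmul T hT X hX).1
    · exact map_mem_closure (f := fun X => X * T) (continuous_mul_const T) hX fun X hX => (hmul T hT X hX).2
  rcases hmax _ hcl subset_closure with h | h
  · rw [← h]
    exact isClosed_closure
  · exfalso
    have h1 : (1 : H →L[ℂ] H) ∈ closure M := by
      rw [h]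
      exact HilbertBasis.one_mem_supp fun _ => rfl
    obtain ⟨X, hX, hlt⟩ := Metric.mem_closure_iff.1 h1 1 one_pos
    rw [dist_eq_norm] at hlt
    obtain ⟨Y, hY, hYX⟩ := b.exists_inverse_mem_supp (r := fun i j => a i = a j) (fun _ => rfl)
      (fun _ _ _ => Eq.trans) (hD hX) hlt
    refine hne (IsIdealOfSet.eq_of_one_mem ⟨hD, h0, hadd, hsmul, hmul⟩ ?_)
    rw [← hYX]
    exact (hmul Y hY X hX).1

theorem HilbertBasis.basisProj_preimage_comm (σ : Set α) {d : H →L[ℂ] H}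
    (hd : d ∈ b.supp fun i j => a i = a j) :
    b.basisProj (a ⁻¹' σ) * d = d * b.basisProj (a ⁻¹' σ) := by
  classical
  refine b.entry_ext fun i j => ?_
  rw [b.entry_basisProj_mul, b.entry_mul_basisProj]
  by_cases h : a i = a j
  · simp only [Set.mem_preimage, h]
  · rw [hd i j h, ite_self, ite_self]

theorem HilbertBasis.one_sub_basisProj (S : Set ι) : 1 - b.basisProj S = b.basisProj Sᶜ :=
  sub_eq_of_eq_add' (b.basisProj_add_compl S).symm

theorem HilbertBasis.basisProj_preimage_mem_or
    (hM : IsMaximalIdealOfSet (b.supp fun i j => a i = a j) M) (σ : Set α) :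
    b.basisProj (a ⁻¹' σ) ∈ M ∨ b.basisProj (a ⁻¹' σᶜ) ∈ M := by
  obtain ⟨hI, hne, hmax⟩ := hM
  obtain ⟨hD, h0, hadd, hsmul, hmul⟩ := hI
  set P := b.basisProj (a ⁻¹' σ) with hP
  have hPD : P ∈ b.supp fun i j => a i = a j := b.basisProj_mem_supp _ fun _ => rfl
  have hPP : P * P = P := b.basisProj_mul_self _
  have hmulD : ∀ {A B}, A ∈ (b.supp fun i j => a i = a j) → B ∈ (b.supp fun i j => a i = a j) →
      A * B ∈ b.supp fun i j => a i = a j := fun hA hB =>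
    HilbertBasis.mul_mem_supp hA hB fun _ _ _ => Eq.trans
  have hid : IsIdealOfSet (b.supp fun i j => a i = a j)
      {X | ∃ m ∈ M, ∃ d ∈ (b.supp fun i j => a i = a j), X = m + P * d} := by
    refine ⟨?_, ⟨0, h0, 0, HilbertBasis.zero_mem_supp, by simp⟩, ?_, ?_, ?_⟩
    · rintro _ ⟨m, hm, d, hd, rfl⟩
      exact HilbertBasis.add_mem_supp (hD hm) (hmulD hPD hd)
    · rintro _ ⟨m, hm, d, hd, rfl⟩ _ ⟨m', hm', d', hd', rfl⟩
      exact ⟨m + m', hadd m hm m' hm', d + d', HilbertBasis.add_mem_supp hd hd', by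
        rw [mul_add]; abel⟩
    · rintro c _ ⟨m, hm, d, hd, rfl⟩
      exact ⟨c • m, hsmul c m hm, c • d, HilbertBasis.smul_mem_supp c hd, by
        rw [smul_add, mul_smul_comm]⟩
    · rintro T hT _ ⟨m, hm, d, hd, rfl⟩
      refine ⟨⟨T * m, (hmul T hT m hm).1, T * d, hmulD hT hd, ?_⟩,
        ⟨m * T, (hmul T hT m hm).2, d * T, hmulD hd hT, ?_⟩⟩
      · rw [mul_add, ← mul_assoc, ← mul_assoc, hP, b.basisProj_preimage_comm σ hT]
      · rw [add_mul, mul_assoc]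
  rcases hmax _ hid fun m hm => ⟨m, hm, 0, HilbertBasis.zero_mem_supp, by simp⟩ with h | h
  · left
    rw [← h]
    exact ⟨0, h0, P, hPD, by rw [hPP, zero_add]⟩
  · right
    have h1 : (1 : H →L[ℂ] H) ∈ {X | ∃ m ∈ M, ∃ d ∈ (b.supp fun i j => a i = a j),
        X = m + P * d} := by
      rw [h]
      exact HilbertBasis.one_mem_supp fun _ => rfl
    obtain ⟨m, hm, d, hd, h1⟩ := h1
    have h2 : b.basisProj (a ⁻¹' σᶜ) = (1 - P) * m := by
      have h3 : (1 - P) * (m + P * d) = (1 - P) * m := by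
        rw [mul_add, ← mul_assoc, sub_mul 1 P P, hPP, one_mul, sub_self, zero_mul, add_zero]
      rw [← h3, ← h1, mul_one, hP, b.one_sub_basisProj, Set.preimage_compl]
    rw [h2]
    exact (hmul _ (HilbertBasis.sub_mem_supp (HilbertBasis.one_mem_supp fun _ => rfl) hPD) m hm).1

end DiagonalIdeals

section BlockReduction

variable {ι : Type*} (b : HilbertBasis ι ℂ H)

theorem HilbertBasis.exists_norm_basisProj_tail_le (ρ : ι → ℕ) (x : H) {ε : ℝ} (hε : 0 < ε) :
    ∃ N, ∀ n, N ≤ n → ‖b.basisProj {i | n ≤ ρ i} x‖ ≤ ε := by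
  have hsum : HasSum (fun i => inner ℂ (b i) x • b i) x := by
    simpa only [b.repr_apply_apply] using b.hasSum_repr x
  obtain ⟨G, hG⟩ := (hsum.eventually (Metric.ball_mem_nhds x hε)).exists
  rw [dist_comm, dist_eq_norm] at hG
  refine ⟨G.sup ρ + 1, fun n hn => ?_⟩
  have h0 : b.basisProj {i | n ≤ ρ i} (∑ i ∈ G, inner ℂ (b i) x • b i) = 0 := by
    rw [map_sum]
    refine Finset.sum_eq_zero fun i hi => ?_
    rw [map_smul, b.basisProj_apply_of_notMem, smul_zero]
    have := Finset.le_sup (f := ρ) hi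
    simp only [Set.mem_ofPred_eq]
    omega
  have h1 : b.basisProj {i | n ≤ ρ i} x =
      b.basisProj {i | n ≤ ρ i} (x - ∑ i ∈ G, inner ℂ (b i) x • b i) := by
    rw [map_sub, h0, sub_zero]
  rw [h1]
  exact (b.norm_basisProj_apply_le _ _).trans hG.le

theorem HilbertBasis.norm_mul_basisProj_le (A : Finset ι) (X : H →L[ℂ] H) {ε : ℝ} (hε : 0 ≤ ε)
    (h : ∀ i ∈ A, ‖X (b i)‖ ≤ ε) : ‖X * b.basisProj A‖ ≤ A.card * ε := by
  refine ContinuousLinearMap.opNorm_le_bound _ (by positivity) fun v => ?_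
  have hP : b.basisProj A v = ∑ i ∈ A, inner ℂ (b i) v • b i := by
    refine b.ext_inner fun j => ?_
    classical
    simp only [b.inner_basisProj, inner_sum, inner_smul_right, orthonormal_iff_ite.1 b.orthonormal]
    simp
  rw [mul_apply_eq_comp, hP, map_sum]
  refine (norm_sum_le _ _).trans ?_
  rw [mul_assoc, ← nsmul_eq_mul]
  refine Finset.sum_le_card_nsmul _ _ _ fun i hi => ?_
  rw [map_smul, norm_smul, mul_comm]
  refine mul_le_mul (h i hi) ?_ (norm_nonneg _) hε
  simpa [b.orthonormal.1] using norm_inner_le_norm (𝕜 := ℂ) (b i) v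

theorem HilbertBasis.adjoint_basisProj (S : Set ι) :
    ContinuousLinearMap.adjoint (b.basisProj S) = b.basisProj S := by
  refine (ContinuousLinearMap.eq_adjoint_iff _ _).2 (fun x y => b.inner_basisProj_comm S x y) |>.symm

theorem HilbertBasis.exists_norm_tail_mul_le (ρ : ι → ℕ) (A : Finset ι) (X : H →L[ℂ] H) {ε : ℝ}
    (hε : 0 < ε) : ∃ N, ∀ n, N ≤ n → ‖b.basisProj {i | n ≤ ρ i} * X * b.basisProj A‖ ≤ ε := by
  choose N hN using fun i => b.exists_norm_basisProj_tail_le ρ (X (b i))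
    (show 0 < ε / (A.card + 1) by positivity)
  refine ⟨A.sup N, fun n hn => ?_⟩
  refine (b.norm_mul_basisProj_le A _ (ε := ε / (A.card + 1)) (by positivity) fun i hi => ?_).trans ?_
  · exact hN i n ((Finset.le_sup hi).trans hn)
  · rw [mul_div_assoc', div_le_iff₀ (by positivity)]
    nlinarith

theorem HilbertBasis.exists_norm_mul_tail_le (ρ : ι → ℕ) (A : Finset ι) (X : H →L[ℂ] H) {ε : ℝ}
    (hε : 0 < ε) : ∃ N, ∀ n, N ≤ n → ‖b.basisProj A * X * b.basisProj {i | n ≤ ρ i}‖ ≤ ε := by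
  obtain ⟨N, hN⟩ := b.exists_norm_tail_mul_le ρ A (ContinuousLinearMap.adjoint X) hε
  refine ⟨N, fun n hn => ?_⟩
  have hstar : ∀ S, star (b.basisProj S) = b.basisProj S := fun S => b.adjoint_basisProj S
  rw [← norm_star, star_mul, star_mul, hstar, hstar, ← mul_assoc]
  exact hN n hn

end BlockReduction

section BlockHosts

variable {ι : Type*} (b : HilbertBasis ι ℂ H)

theorem HilbertBasis.exists_block_scale (ρ : ι → ℕ) (S : Set ι)
    (hfin : ∀ m, {i | i ∈ S ∧ ρ i < m}.Finite) (X : H →L[ℂ] H) :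
    ∃ n : ℕ → ℕ, n 0 = 0 ∧ StrictMono n ∧ ∀ m,
      ‖b.basisProj {i | i ∈ S ∧ ρ i < n m} * X * b.basisProj {i | n (m + 1) ≤ ρ i}‖ ≤ (1 / 4) ^ m ∧
      ‖b.basisProj {i | n (m + 1) ≤ ρ i} * X * b.basisProj {i | i ∈ S ∧ ρ i < n m}‖ ≤
        (1 / 4) ^ m := by
  have hstep : ∀ m N, ∃ N', N < N' ∧
      ‖b.basisProj {i | i ∈ S ∧ ρ i < N} * X * b.basisProj {i | N' ≤ ρ i}‖ ≤ (1 / 4) ^ m ∧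
      ‖b.basisProj {i | N' ≤ ρ i} * X * b.basisProj {i | i ∈ S ∧ ρ i < N}‖ ≤ (1 / 4) ^ m := by
    intro m N
    obtain ⟨N₁, h₁⟩ := b.exists_norm_mul_tail_le ρ (hfin N).toFinset X
      (show (0 : ℝ) < (1 / 4) ^ m by positivity)
    obtain ⟨N₂, h₂⟩ := b.exists_norm_tail_mul_le ρ (hfin N).toFinset X
      (show (0 : ℝ) < (1 / 4) ^ m by positivity)
    rw [Set.Finite.coe_toFinset] at h₁ h₂
    exact ⟨N + 1 + N₁ + N₂, by omega, h₁ _ (by omega), h₂ _ (by omega)⟩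
  choose f hf using hstep
  obtain ⟨n, h0, hn⟩ : ∃ n : ℕ → ℕ, n 0 = 0 ∧ ∀ m, n (m + 1) = f m (n m) :=
    ⟨fun k => Nat.rec 0 f k, rfl, fun _ => rfl⟩
  refine ⟨n, h0, strictMono_nat_of_lt_succ fun m => ?_, fun m => ?_⟩
  · rw [hn]
    exact (hf m _).1
  · rw [hn]
    exact (hf m _).2

/-- The part of a level at which the scale `n` is reached. -/
def blockIndex (n : ℕ → ℕ) (t : ℕ) : ℕ := Nat.findGreatest (fun k => n k ≤ t) t

theorem le_blockIndex_iff {n : ℕ → ℕ} (h0 : n 0 = 0) (hn : StrictMono n) {k t : ℕ} :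
    k ≤ blockIndex n t ↔ n k ≤ t := by
  constructor
  · intro h
    refine (hn.monotone h).trans ?_
    exact Nat.findGreatest_spec (P := fun k => n k ≤ t) (Nat.zero_le t) (h0.trans_le t.zero_le)
  · intro h
    exact Nat.le_findGreatest ((hn.le_apply).trans h) h

theorem summable_of_norm_le_pow {Z : ℕ → H →L[ℂ] H} {r : ℝ} (h0 : 0 ≤ r) (h1 : r < 1)
    (h : ∀ k, ‖Z k‖ ≤ r ^ k) : Summable Z :=
  Summable.of_norm_bounded (summable_geometric_of_lt_one h0 h1) h

theorem HilbertBasis.hasSum_entry {Z : ℕ → H →L[ℂ] H} {K : H →L[ℂ] H} (h : HasSum Z K) (i j : ι) :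
    HasSum (fun k => b.entry (Z k) i j) (b.entry K i j) :=
  h.map (AddMonoidHom.mk' (fun A => b.entry A i j) fun A B => b.entry_add A B i j)
    (b.continuous_entry i j)

variable {b} {α : Type*} [LinearOrder α] {a : ι → α} {J : Set (H →L[ℂ] H)}

theorem HilbertBasis.summable_smul_mem (hJ : IsIdealOfSet (b.supp fun i j => a i ≤ a j) J)
    (hcl : IsClosed (J ∩ b.supp fun i j => a i = a j)) {C : ℕ → H →L[ℂ] H}
    (hC : ∀ k, C k ∈ J ∩ b.supp fun i j => a i = a j) (hC1 : ∀ k, ‖C k‖ ≤ 1) :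
    ∃ L ∈ J, HasSum (fun k => (1 / 2 : ℂ) ^ k • C k) L := by
  have hs : Summable fun k => (1 / 2 : ℂ) ^ k • C k := by
    refine summable_of_norm_le_pow (r := 1 / 2) (by norm_num) (by norm_num) fun k => ?_
    rw [norm_smul, norm_pow]
    have : ‖(1 / 2 : ℂ)‖ = 1 / 2 := by norm_num
    rw [this]
    exact mul_le_of_le_one_right (by positivity) (hC1 k)
  obtain ⟨L, hL⟩ := hs
  refine ⟨L, (hcl.mem_of_tendsto hL (Filter.Eventually.of_forall fun F => ?_)).1, hL⟩
  refine Finset.sum_induction _ (· ∈ J ∩ b.supp fun i j => a i = a j)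
    (fun X Y hX hY => ⟨hJ.2.2.1 X hX.1 Y hY.1, HilbertBasis.add_mem_supp hX.2 hY.2⟩)
    ⟨hJ.2.1, HilbertBasis.zero_mem_supp⟩ fun k _ => ?_
  exact ⟨hJ.2.2.2.1 _ _ (hC k).1, HilbertBasis.smul_mem_supp _ (hC k).2⟩

theorem HilbertBasis.hasSum_two_pow_smul_mem {Z : ℕ → H →L[ℂ] H}
    (hZ : ∀ k, Z k ∈ b.supp fun i j => a i ≤ a j) (hZn : ∀ k, ‖Z k‖ ≤ (1 / 4) ^ k) :
    ∃ W ∈ (b.supp fun i j => a i ≤ a j), HasSum (fun k => (2 : ℂ) ^ k • Z k) W := by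
  have hs : Summable fun k => (2 : ℂ) ^ k • Z k := by
    refine summable_of_norm_le_pow (r := 1 / 2) (by norm_num) (by norm_num) fun k => ?_
    rw [norm_smul, norm_pow, show ‖(2 : ℂ)‖ = 2 by norm_num]
    calc (2 : ℝ) ^ k * ‖Z k‖ ≤ 2 ^ k * (1 / 4) ^ k := by gcongr; exact hZn k
      _ = (1 / 2) ^ k := by rw [← mul_pow]; norm_num
  obtain ⟨W, hW⟩ := hs
  refine ⟨W, b.isClosed_supp.mem_of_tendsto hW (Filter.Eventually.of_forall fun F => ?_), hW⟩
  exact Finset.sum_induction _ (· ∈ b.supp fun i j => a i ≤ a j)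
    (fun X Y hX hY => HilbertBasis.add_mem_supp hX hY) HilbertBasis.zero_mem_supp
    fun k _ => HilbertBasis.smul_mem_supp _ (hZ k)

theorem HilbertBasis.exists_hasSum_mem_left (hJ : IsIdealOfSet (b.supp fun i j => a i ≤ a j) J)
    (hcl : IsClosed (J ∩ b.supp fun i j => a i = a j)) {C Z : ℕ → H →L[ℂ] H}
    (hC : ∀ k, C k ∈ J ∩ b.supp fun i j => a i = a j) (hC1 : ∀ k, ‖C k‖ ≤ 1)
    (hZ : ∀ k, Z k ∈ b.supp fun i j => a i ≤ a j) (hZn : ∀ k, ‖Z k‖ ≤ (1 / 4) ^ k)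
    (hCZ : ∀ k, C k * Z k = Z k) (hCZ0 : ∀ l k, l ≠ k → C l * Z k = 0) :
    ∃ K ∈ J, HasSum Z K := by
  obtain ⟨L, hLJ, hL⟩ := HilbertBasis.summable_smul_mem hJ hcl hC hC1
  obtain ⟨W, hWT, hW⟩ := HilbertBasis.hasSum_two_pow_smul_mem hZ hZn
  refine ⟨L * W, (hJ.2.2.2.2 W hWT L hLJ).2, ?_⟩
  have hLZ : ∀ k, L * Z k = (1 / 2 : ℂ) ^ k • Z k := fun k => by
    refine (hL.mul_right (Z k)).unique ?_
    have := hasSum_single (f := fun l => ((1 / 2 : ℂ) ^ l • C l) * Z k) k fun l hl => by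
      rw [smul_mul_assoc, hCZ0 l k hl, smul_zero]
    rwa [smul_mul_assoc, hCZ k] at this
  have heq : (fun k => L * ((2 : ℂ) ^ k • Z k)) = Z := funext fun k => by
    rw [mul_smul_comm, hLZ, smul_smul, ← mul_pow]
    norm_num
  exact heq ▸ hW.mul_left L

theorem HilbertBasis.exists_hasSum_mem_right (hJ : IsIdealOfSet (b.supp fun i j => a i ≤ a j) J)
    (hcl : IsClosed (J ∩ b.supp fun i j => a i = a j)) {C Z : ℕ → H →L[ℂ] H}
    (hC : ∀ k, C k ∈ J ∩ b.supp fun i j => a i = a j) (hC1 : ∀ k, ‖C k‖ ≤ 1)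
    (hZ : ∀ k, Z k ∈ b.supp fun i j => a i ≤ a j) (hZn : ∀ k, ‖Z k‖ ≤ (1 / 4) ^ k)
    (hCZ : ∀ k, Z k * C k = Z k) (hCZ0 : ∀ l k, l ≠ k → Z k * C l = 0) :
    ∃ K ∈ J, HasSum Z K := by
  obtain ⟨L, hLJ, hL⟩ := HilbertBasis.summable_smul_mem hJ hcl hC hC1
  obtain ⟨W, hWT, hW⟩ := HilbertBasis.hasSum_two_pow_smul_mem hZ hZn
  refine ⟨W * L, (hJ.2.2.2.2 W hWT L hLJ).1, ?_⟩
  have hLZ : ∀ k, Z k * L = (1 / 2 : ℂ) ^ k • Z k := fun k => by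
    refine (hL.mul_left (Z k)).unique ?_
    have := hasSum_single (f := fun l => Z k * ((1 / 2 : ℂ) ^ l • C l)) k fun l hl => by
      rw [mul_smul_comm, hCZ0 l k hl, smul_zero]
    rwa [mul_smul_comm, hCZ k] at this
  have heq : (fun k => ((2 : ℂ) ^ k • Z k) * L) = Z := funext fun k => by
    rw [smul_mul_assoc, hLZ, smul_smul, ← mul_pow]
    norm_num
  exact heq ▸ hW.mul_right L

theorem HilbertBasis.mem_of_block_host (hJ : IsIdealOfSet (b.supp fun i j => a i ≤ a j) J)
    (hcl : IsClosed (J ∩ b.supp fun i j => a i = a j))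
    (hfin : ∀ F : Set ι, F.Finite → b.basisProj F ∈ J) {X : H →L[ℂ] H} {S : Set ι}
    (hX : ∀ i j, b.entry X i j ≠ 0 → a i < a j ∧ i ∈ S ∧ j ∈ S) (ρ : ι → ℕ)
    (hρ : ∀ m, {i | i ∈ S ∧ ρ i < m}.Finite)
    (host : ∀ (g : ℕ → ℕ) (Y : H →L[ℂ] H), (∀ k, {i | i ∈ S ∧ g (ρ i) = k}.Finite) →
      (∀ i j, b.entry Y i j ≠ 0 → a i < a j ∧ i ∈ S ∧ j ∈ S ∧ g (ρ i) = g (ρ j)) → Y ∈ J) :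
    X ∈ J := by
  classical
  obtain ⟨n, hn0, hn, hnX⟩ := b.exists_block_scale ρ S hρ X
  have hβ : ∀ {k t}, k ≤ blockIndex n t ↔ n k ≤ t := le_blockIndex_iff hn0 hn
  set β := blockIndex n with hβdef
  set C : ℕ → H →L[ℂ] H := fun k => b.basisProj {i | i ∈ S ∧ β (ρ i) = k} with hCdef
  set Q : ℕ → H →L[ℂ] H := fun k => b.basisProj {i | n (k + 2) ≤ ρ i} with hQdef
  have hXT : X ∈ b.supp fun i j => a i ≤ a j := fun i j hij => by
    by_contra h
    exact hij (hX i j h).1.le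
  have hsub : ∀ k, {i | i ∈ S ∧ β (ρ i) = k} ⊆ {i | i ∈ S ∧ ρ i < n (k + 1)} := by
    rintro k i ⟨hi, rfl⟩
    refine ⟨hi, ?_⟩
    by_contra! h
    have := hβ.2 h
    omega
  have hCJ : ∀ k, C k ∈ J ∩ b.supp fun i j => a i = a j := fun k =>
    ⟨hfin _ ((hρ _).subset (hsub k)), b.basisProj_mem_supp _ fun _ => rfl⟩
  have hC1 : ∀ k, ‖C k‖ ≤ 1 := fun k => b.norm_basisProj_le _
  have hCC : ∀ k, C k * C k = C k := fun k => b.basisProj_mul_self _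
  have hCC0 : ∀ l k, l ≠ k → C l * C k = 0 := fun l k hlk => by
    rw [hCdef, b.basisProj_mul]
    convert b.basisProj_empty using 2
    ext i
    simp only [Set.mem_inter_iff, Set.mem_ofPred_eq, Set.mem_empty_iff_false, iff_false]
    rintro ⟨⟨-, rfl⟩, -, h⟩
    exact hlk h
  have hCP : ∀ k, b.basisProj {i | i ∈ S ∧ ρ i < n (k + 1)} * C k = C k := fun k => by
    rw [hCdef, b.basisProj_mul, Set.inter_eq_right.2 (hsub k)]
  have hPC : ∀ k, C k * b.basisProj {i | i ∈ S ∧ ρ i < n (k + 1)} = C k := fun k => by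
    rw [hCdef, b.basisProj_mul, Set.inter_eq_left.2 (hsub k)]
  have hCT : ∀ k, C k ∈ b.supp fun i j => a i ≤ a j := fun k =>
    b.basisProj_mem_supp _ fun _ => le_rfl
  have hQT : ∀ k, Q k ∈ b.supp fun i j => a i ≤ a j := fun k =>
    b.basisProj_mem_supp _ fun _ => le_rfl
  have hmulT : ∀ {A B : H →L[ℂ] H}, A ∈ (b.supp fun i j => a i ≤ a j) →
      B ∈ (b.supp fun i j => a i ≤ a j) → A * B ∈ b.supp fun i j => a i ≤ a j :=
    fun hA hB => HilbertBasis.mul_mem_supp hA hB fun _ _ _ => le_trans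
  have hpow : ∀ k, ((1 : ℝ) / 4) ^ (k + 1) ≤ (1 / 4) ^ k := fun k =>
    pow_le_pow_of_le_one (by norm_num) (by norm_num) k.le_succ
  obtain ⟨K₁, hK₁J, hK₁⟩ := HilbertBasis.exists_hasSum_mem_left hJ hcl (C := C)
    (Z := fun k => C k * X * Q k) hCJ hC1 (fun k => hmulT (hmulT (hCT k) hXT) (hQT k))
    (fun k => by
      have h : C k * X * Q k = C k * (b.basisProj {i | i ∈ S ∧ ρ i < n (k + 1)} * X * Q k) := by
        rw [← mul_assoc, ← mul_assoc, hPC]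
      rw [h]
      refine (norm_mul_le _ _).trans ((mul_le_of_le_one_left (norm_nonneg _) (hC1 k)).trans ?_)
      exact (hnX (k + 1)).1.trans (hpow k))
    (fun k => by rw [← mul_assoc, ← mul_assoc, hCC])
    fun l k hlk => by rw [← mul_assoc, ← mul_assoc, hCC0 l k hlk, zero_mul, zero_mul]
  obtain ⟨K₂, hK₂J, hK₂⟩ := HilbertBasis.exists_hasSum_mem_right hJ hcl (C := C)
    (Z := fun k => Q k * X * C k) hCJ hC1 (fun k => hmulT (hmulT (hQT k) hXT) (hCT k))
    (fun k => by
      have h : Q k * X * C k = (Q k * X * b.basisProj {i | i ∈ S ∧ ρ i < n (k + 1)}) * C k := by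
        rw [mul_assoc (Q k * X), hCP]
      rw [h]
      refine (norm_mul_le _ _).trans ((mul_le_of_le_one_right (norm_nonneg _) (hC1 k)).trans ?_)
      exact (hnX (k + 1)).2.trans (hpow k))
    (fun k => by rw [mul_assoc, hCC])
    fun l k hlk => by rw [mul_assoc, hCC0 k l hlk.symm, mul_zero]
  have he₁ : ∀ i j, b.entry K₁ i j =
      if β (ρ i) + 2 ≤ β (ρ j) then b.entry X i j else 0 := fun i j => by
    have hent : ∀ k, b.entry (C k * X * Q k) i j =
        if k = β (ρ i) ∧ β (ρ i) + 2 ≤ β (ρ j) then b.entry X i j else 0 := fun k => by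
      by_cases h0 : b.entry X i j = 0
      · simp [hCdef, hQdef, mul_assoc, h0]
      obtain ⟨-, hi, -⟩ := hX i j h0
      rw [hCdef, hQdef, b.entry_mul_basisProj, b.entry_basisProj_mul]
      simp only [Set.mem_ofPred_eq, hi, true_and, ← hβ]
      split_ifs <;> first | rfl | (exfalso; omega)
    have hs := hasSum_single (f := fun k => b.entry (C k * X * Q k) i j) (β (ρ i)) fun k hk => by
      rw [hent, if_neg fun h => hk h.1]
    rw [(b.hasSum_entry hK₁ i j).unique hs, hent]
    simp
  have he₂ : ∀ i j, b.entry K₂ i j =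
      if β (ρ j) + 2 ≤ β (ρ i) then b.entry X i j else 0 := fun i j => by
    have hent : ∀ k, b.entry (Q k * X * C k) i j =
        if k = β (ρ j) ∧ β (ρ j) + 2 ≤ β (ρ i) then b.entry X i j else 0 := fun k => by
      by_cases h0 : b.entry X i j = 0
      · simp [hCdef, hQdef, mul_assoc, h0]
      obtain ⟨-, -, hj⟩ := hX i j h0
      rw [hCdef, hQdef, b.entry_mul_basisProj, b.entry_basisProj_mul]
      simp only [Set.mem_ofPred_eq, hj, true_and, ← hβ]
      split_ifs <;> first | rfl | (exfalso; omega)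
    have hs := hasSum_single (f := fun k => b.entry (Q k * X * C k) i j) (β (ρ j)) fun k hk => by
      rw [hent, if_neg fun h => hk h.1]
    rw [(b.hasSum_entry hK₂ i j).unique hs, hent]
    simp
  have hX₁ : ∀ i j, b.entry (X - K₁ - K₂) i j ≠ 0 → b.entry X i j ≠ 0 ∧
      β (ρ j) < β (ρ i) + 2 ∧ β (ρ i) < β (ρ j) + 2 := fun i j h => by
    rw [b.entry_sub, b.entry_sub, he₁, he₂] at h
    split_ifs at h with h₁ h₂ h₂
    · omega
    · simp at h
    · simp at h
    · exact ⟨by simpa using h, by omega, by omega⟩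
  obtain ⟨X₀, hsame, hdiff⟩ := b.exists_pinching (fun i => β (ρ i) / 2) (X - K₁ - K₂)
  have hblock : ∀ k, {i | i ∈ S ∧ β (ρ i) ≤ k}.Finite := fun k =>
    (hρ (n (k + 1))).subset fun i hi => ⟨hi.1, by
      by_contra! h
      have := (hβ.2 h).trans hi.2
      omega⟩
  have hX₀ : X₀ ∈ J := by
    refine host (fun t => β t / 2) X₀ (fun k => (hblock (2 * k + 1)).subset ?_) fun i j h => ?_
    · rintro i ⟨hi, h⟩
      exact ⟨hi, by omega⟩
    · have hij : β (ρ i) / 2 = β (ρ j) / 2 := by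
        by_contra hne
        exact h (hdiff i j hne)
      rw [hsame i j hij] at h
      obtain ⟨h₁, h₂, h₃⟩ := hX i j (hX₁ i j h).1
      exact ⟨h₁, h₂, h₃, hij⟩
  have hX₂ : X - K₁ - K₂ - X₀ ∈ J := by
    refine host (fun t => (β t + 1) / 2) _ (fun k => (hblock (2 * k + 1)).subset ?_) fun i j h => ?_
    · rintro i ⟨hi, h⟩
      exact ⟨hi, by omega⟩
    · have hij : β (ρ i) / 2 ≠ β (ρ j) / 2 := by
        intro heq
        rw [b.entry_sub, hsame i j heq, sub_self] at h
        exact h rfl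
      rw [b.entry_sub, hdiff i j hij, sub_zero] at h
      obtain ⟨h₀, h₄, h₅⟩ := hX₁ i j h
      obtain ⟨h₁, h₂, h₃⟩ := hX i j h₀
      exact ⟨h₁, h₂, h₃, by omega⟩
  have : X = X - K₁ - K₂ - X₀ + X₀ + K₂ + K₁ := by abel
  rw [this]
  exact hJ.2.2.1 _ (hJ.2.2.1 _ (hJ.2.2.1 _ hX₂ _ hX₀) _ hK₂J) _ hK₁J

end BlockHosts

section StrictPart

variable {ι : Type*} {b : HilbertBasis ι ℂ H} {α : Type*} [LinearOrder α] {a : ι → α}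
  {J : Set (H →L[ℂ] H)}

theorem HilbertBasis.basisProj_mem_triangular (S : Set ι) :
    b.basisProj S ∈ b.supp fun i j => a i ≤ a j :=
  b.basisProj_mem_supp _ fun _ => le_rfl

theorem HilbertBasis.mem_of_compression_mem (hJ : IsIdealOfSet (b.supp fun i j => a i ≤ a j) J)
    {S : Set ι} (hS : b.basisProj Sᶜ ∈ J) {X : H →L[ℂ] H}
    (hX : X ∈ b.supp fun i j => a i ≤ a j) (h : b.basisProj S * X * b.basisProj S ∈ J) :
    X ∈ J := by
  have hsum : X = b.basisProj S * X * b.basisProj S +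
      (b.basisProj S * X * b.basisProj Sᶜ + b.basisProj Sᶜ * X) := by
    rw [← b.one_sub_basisProj]
    noncomm_ring
  have hPX : b.basisProj S * X ∈ b.supp fun i j => a i ≤ a j :=
    HilbertBasis.mul_mem_supp (HilbertBasis.basisProj_mem_triangular S) hX fun _ _ _ => le_trans
  rw [hsum]
  exact hJ.2.2.1 _ h _ (hJ.2.2.1 _ (hJ.2.2.2.2 _ hPX _ hS).1 _ (hJ.2.2.2.2 _ hX _ hS).2)

theorem HilbertBasis.one_notMem_of_isMaximalIdealOfSet
    (hM : IsMaximalIdealOfSet (b.supp fun i j => a i = a j) (J ∩ b.supp fun i j => a i = a j)) :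
    (1 : H →L[ℂ] H) ∉ J := fun h =>
  hM.2.1 (hM.1.eq_of_one_mem ⟨h, HilbertBasis.one_mem_supp fun _ => rfl⟩)

theorem HilbertBasis.exists_color_basisProj_mem
    (hJ : IsIdealOfSet (b.supp fun i j => a i ≤ a j) J)
    (hM : IsMaximalIdealOfSet (b.supp fun i j => a i = a j) (J ∩ b.supp fun i j => a i = a j))
    {n : ℕ} (c : α → Fin n) : ∃ k, b.basisProj (a ⁻¹' (c ⁻¹' {k})ᶜ) ∈ J := by
  by_contra! h
  refine HilbertBasis.one_notMem_of_isMaximalIdealOfSet hM ?_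
  have hmem : ∀ k ∈ Finset.univ, b.basisProj ((c ∘ a) ⁻¹' {k}) ∈ J := fun k _ =>
    ((b.basisProj_preimage_mem_or hM (c ⁻¹' {k})).resolve_right fun h' => h k h'.1).1
  have := hJ.sum_mem hmem
  rwa [b.sum_basisProj_fiber, Finset.coe_univ, Set.preimage_univ, b.basisProj_univ] at this

theorem HilbertBasis.basisProj_mem_of_finite (hJ : IsIdealOfSet (b.supp fun i j => a i ≤ a j) J)
    (hp : ∀ p, b.basisProj (a ⁻¹' {p}) ∈ J) {F : Set ι} (hF : F.Finite) : b.basisProj F ∈ J := by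
  classical
  have h := hJ.sum_mem (F := (hF.toFinset.image a)) fun p _ => hp p
  rw [b.sum_basisProj_fiber] at h
  have hmul := (hJ.2.2.2.2 _ (HilbertBasis.basisProj_mem_triangular F) _ h).1
  rwa [b.basisProj_mul, Set.inter_eq_left.2] at hmul
  intro i hi
  simpa using ⟨i, hi, rfl⟩

theorem HilbertBasis.entry_compression_ne_zero {S : Set ι} {X : H →L[ℂ] H} {i j : ι}
    (h : b.entry (b.basisProj S * X * b.basisProj S) i j ≠ 0) :
    i ∈ S ∧ j ∈ S ∧ b.entry X i j ≠ 0 := by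
  rw [b.entry_mul_basisProj, b.entry_basisProj_mul] at h
  split_ifs at h with h₁ h₂
  · exact ⟨h₂, h₁, h⟩
  · exact absurd rfl h
  · exact absurd rfl h

open Classical in
theorem HilbertBasis.mem_of_finite_fibers (hJ : IsIdealOfSet (b.supp fun i j => a i ≤ a j) J)
    (hM : IsMaximalIdealOfSet (b.supp fun i j => a i = a j) (J ∩ b.supp fun i j => a i = a j))
    (hsurj : Function.Surjective a) {e : α → ℕ} (he : Function.Injective e)
    (hp : ∀ p, b.basisProj (a ⁻¹' {p}) ∈ J) {F : Set α} (hF : ∀ p ∈ F, (a ⁻¹' {p}).Finite)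
    {X : H →L[ℂ] H} (hX : ∀ i j, b.entry X i j ≠ 0 → a i < a j ∧ a i ∈ F ∧ a j ∈ F) : X ∈ J := by
  refine HilbertBasis.mem_of_block_host hJ (b.isClosed_of_isMaximalIdealOfSet hM)
    (fun _ => HilbertBasis.basisProj_mem_of_finite hJ hp) (S := a ⁻¹' F) hX (fun i => e (a i))
    (fun m => ?_) fun g Y hfin hY => ?_
  · have hfe : {p | p ∈ F ∧ e p < m}.Finite :=
      ((Set.finite_Iio m).preimage he.injOn).subset fun p hp => hp.2
    refine (hfe.biUnion fun p hp => hF p hp.1).subset fun i hi => ?_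
    exact Set.mem_biUnion (x := a i) hi rfl
  let d : α → ℕ := fun p => (a ⁻¹' {p}).ncard
  let R : α → α → Prop := fun y x => y ∈ F ∧ g (e y) = g (e x) ∧
    (d x < d y ∨ d x = d y ∧ e y < e x)
  obtain ⟨c, hc⟩ := exists_separating_coloring (R := R)
    (fun x h => by rcases h.2.2 with h | h <;> omega)
    (fun x y z hxy hyz => ⟨hxy.1, hxy.2.1.trans hyz.2.1, by
      rcases hxy.2.2 with h | h <;> rcases hyz.2.2 with h' | h' <;> omega⟩)
    (fun x => ((hfin (g (e x))).image a).subset fun y hy => by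
      obtain ⟨i, rfl⟩ := hsurj y
      exact ⟨i, ⟨hy.1, hy.2.1⟩, rfl⟩)
  obtain ⟨k₀, hk₀⟩ := HilbertBasis.exists_color_basisProj_mem hJ hM c
  set σ := c ⁻¹' {k₀} with hσ
  refine HilbertBasis.mem_of_compression_mem hJ (S := a ⁻¹' σ) hk₀ (fun i j hij => ?_) ?_
  · by_contra h
    exact hij (hY i j h).1.le
  have hmemI : ∀ {k i}, i ∈ (hfin k).toFinset.filter (fun i => a i ∈ σ) ↔
      (a i ∈ F ∧ g (e (a i)) = k) ∧ a i ∈ σ := by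
    intro k i
    simp
  have hmemH : ∀ {k i}, i ∈ (hfin k).toFinset.filter (fun i => a i ∉ σ) ↔
      (a i ∈ F ∧ g (e (a i)) = k) ∧ a i ∉ σ := by
    intro k i
    simp
  refine b.mem_of_hosts hJ hk₀ (fun k => (hfin k).toFinset.filter fun i => a i ∈ σ)
    (fun k => (hfin k).toFinset.filter fun i => a i ∉ σ)
    (fun k l i hk hl => (hmemI.1 hk).1.2.symm.trans (hmemI.1 hl).1.2)
    (fun k l i hk hl => (hmemH.1 hk).1.2.symm.trans (hmemH.1 hl).1.2)
    (fun k i hi => (hmemI.1 hi).2) (fun k i hi => (hmemH.1 hi).2) (fun i j h => ?_)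
    fun k p hpk q hqk hpq => ?_
  · obtain ⟨hi, hj, hne⟩ := HilbertBasis.entry_compression_ne_zero h
    obtain ⟨hlt, hiF, hjF, hg⟩ := hY i j hne
    exact ⟨hlt, g (e (a i)), hmemI.2 ⟨⟨hiF, rfl⟩, hi⟩, hmemI.2 ⟨⟨hjF, hg.symm⟩, hj⟩⟩
  · have hp' : (p ∈ F ∧ g (e p) = k) ∧ c p = k₀ := by
      obtain ⟨i, hi, rfl⟩ := Finset.mem_image.1 hpk
      exact hmemI.1 hi
    have hq' : (q ∈ F ∧ g (e q) = k) ∧ c q = k₀ := by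
      obtain ⟨i, hi, rfl⟩ := Finset.mem_image.1 hqk
      exact hmemI.1 hi
    have hcardle : ∀ p ∈ F, (((hfin k).toFinset.filter fun i => a i ∈ σ).filter
        fun i => a i = p).card ≤ d p := fun p hpF => by
      rw [← Set.ncard_coe_finset]
      refine Set.ncard_le_ncard (fun i hi => ?_) (hF p hpF)
      exact (Finset.mem_filter.1 hi).2
    have hle : ∀ {x r}, R r x → c r ≠ k₀ → g (e x) = k → d x ≤
        (((hfin k).toFinset.filter fun i => a i ∉ σ).filter fun i => a i = r).card := by
      intro x r hr hcr hx
      have heq : ((((hfin k).toFinset.filter fun i => a i ∉ σ).filter fun i => a i = r : Finset ι) :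
          Set ι) = a ⁻¹' {r} := by
        ext i
        simp only [Finset.coe_filter, hmemH, Set.mem_ofPred_eq, Set.mem_preimage,
          Set.mem_singleton_iff, and_iff_right_iff_imp]
        rintro rfl
        exact ⟨⟨hr.1, hr.2.1.trans hx⟩, hcr⟩
      rw [← Set.ncard_coe_finset, heq]
      rcases hr.2.2 with h | h
      · exact h.le
      · exact h.1.le
    have hene : e p ≠ e q := fun h => hpq.ne (he h)
    have htot : R p q ∨ R q p := by
      have h₁ : g (e p) = g (e q) := hp'.1.2.trans hq'.1.2.symm
      have h₂ : (d q < d p ∨ d q = d p ∧ e p < e q) ∨ (d p < d q ∨ d p = d q ∧ e q < e p) := by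
        omega
      exact h₂.imp (fun h => ⟨hp'.1.1, h₁, h⟩) fun h => ⟨hq'.1.1, h₁.symm, h⟩
    rcases htot with h | h
    · obtain ⟨r, hr, h₁, h₂, h₃⟩ := (hc q p h (hp'.2.trans hq'.2.symm)).1 hpq
      exact ⟨r, h₁, h₂, (min_le_right _ _).trans ((hcardle q hq'.1.1).trans
        (hle hr (fun h => h₃ (h.trans hq'.2.symm)) hq'.1.2))⟩
    · obtain ⟨r, hr, h₁, h₂, h₃⟩ := (hc p q h (hq'.2.trans hp'.2.symm)).2 hpq
      exact ⟨r, h₁, h₂, (min_le_left _ _).trans ((hcardle p hp'.1.1).trans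
        (hle hr (fun h => h₃ (h.trans hp'.2.symm)) hp'.1.2))⟩

end StrictPart

section StrictPart

variable {ι : Type*} {b : HilbertBasis ι ℂ H} {α : Type*} [LinearOrder α] {a : ι → α}
  {J : Set (H →L[ℂ] H)}

open Classical in
theorem HilbertBasis.mem_of_infinite_fibers (hJ : IsIdealOfSet (b.supp fun i j => a i ≤ a j) J)
    (hM : IsMaximalIdealOfSet (b.supp fun i j => a i = a j) (J ∩ b.supp fun i j => a i = a j))
    {e : α → ℕ} (he : Function.Injective e) {ρ : ι → ℕ} (hρ : Function.Injective ρ)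
    (hp : ∀ p, b.basisProj (a ⁻¹' {p}) ∈ J) {F : Set α} (hF : ∀ p ∈ F, (a ⁻¹' {p}).Infinite)
    {X : H →L[ℂ] H} (hX : ∀ i j, b.entry X i j ≠ 0 → a i < a j ∧ a i ∈ F ∧ a j ∈ F) : X ∈ J := by
  rcases isEmpty_or_nonempty ι with _ | _
  · rw [show X = 0 from b.entry_ext fun i => isEmptyElim i]
    exact hJ.2.1
  refine HilbertBasis.mem_of_block_host hJ (b.isClosed_of_isMaximalIdealOfSet hM)
    (fun _ => HilbertBasis.basisProj_mem_of_finite hJ hp) (S := a ⁻¹' F) hX ρ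
    (fun m => ((Set.finite_Iio m).preimage hρ.injOn).subset fun i hi => hi.2)
    fun g Y hfin hY => ?_
  let R : α → α → Prop := fun y x => (y ∈ F ∧ x ∈ F) ∧ e y < e x
  obtain ⟨c, hc⟩ := exists_separating_coloring (R := R) (fun x h => h.2.ne rfl)
    (fun x y z hxy hyz => ⟨⟨hxy.1.1, hyz.1.2⟩, hxy.2.trans hyz.2⟩)
    (fun x => ((Set.finite_Iio (e x)).preimage he.injOn).subset fun y hy => hy.2)
  obtain ⟨k₀, hk₀⟩ := HilbertBasis.exists_color_basisProj_mem hJ hM c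
  have hsep : ∀ p q, p ∈ F → q ∈ F → c p = k₀ → c q = k₀ → p < q →
      ∃ r, p < r ∧ r < q ∧ r ∈ F ∧ c r ≠ k₀ := by
    intro p q hpF hqF hcp hcq hpq
    rcases lt_or_gt_of_ne fun h : e p = e q => hpq.ne (he h) with h | h
    · obtain ⟨r, hr, h₁, h₂, h₃⟩ := (hc q p ⟨⟨hpF, hqF⟩, h⟩ (hcp.trans hcq.symm)).1 hpq
      exact ⟨r, h₁, h₂, hr.1.1, fun h => h₃ (h.trans hcq.symm)⟩
    · obtain ⟨r, hr, h₁, h₂, h₃⟩ := (hc p q ⟨⟨hqF, hpF⟩, h⟩ (hcq.trans hcp.symm)).2 hpq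
      exact ⟨r, h₁, h₂, hr.1.1, fun h => h₃ (h.trans hcp.symm)⟩
  choose! r hr using hsep
  have hG : ∀ p ∈ F, ∃ G : ℕ → ι, Function.Injective G ∧ ∀ n, a (G n) = p := fun p hpF =>
    ⟨fun n => (hF p hpF).natEmbedding _ n,
      fun m n h => (hF p hpF).natEmbedding _ |>.injective (Subtype.ext h),
      fun n => ((hF p hpF).natEmbedding _ n).2⟩
  choose! G hGinj hGa using hG
  set σ := c ⁻¹' {k₀} with hσ
  refine HilbertBasis.mem_of_compression_mem hJ (S := a ⁻¹' σ) hk₀ (fun i j hij => ?_) ?_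
  · by_contra h
    exact hij (hY i j h).1.le
  let I : ℕ → Finset ι := fun k => (hfin k).toFinset.filter fun i => a i ∈ σ
  have hmemI : ∀ {k i}, i ∈ I k ↔ (a i ∈ F ∧ g (ρ i) = k) ∧ c (a i) = k₀ := by
    intro k i
    simp [I, σ]
  let A : ℕ → Finset (α × α) := fun k =>
    ((I k).image a ×ˢ (I k).image a).filter fun pq => pq.1 < pq.2
  have hA : ∀ {k pq}, pq ∈ A k → r pq.1 pq.2 ∈ F ∧ c (r pq.1 pq.2) ≠ k₀ := by
    rintro k ⟨p, q⟩ h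
    simp only [A, Finset.mem_filter, Finset.mem_product, Finset.mem_image] at h
    obtain ⟨⟨⟨i, hi, rfl⟩, j, hj, rfl⟩, hlt⟩ := h
    rw [hmemI] at hi hj
    exact (hr _ _ hi.1.1 hj.1.1 hi.2 hj.2 hlt).2.2
  let 𝓗 : ℕ → Finset ι := fun k => (A k).biUnion fun pq =>
    (Finset.range (I k).card).image fun m => G (r pq.1 pq.2) (Nat.pair k m)
  have hmemH : ∀ {k i}, i ∈ 𝓗 k → (a i ∈ F ∧ c (a i) ≠ k₀) ∧
      ∃ m, i = G (a i) (Nat.pair k m) := by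
    intro k i hi
    simp only [𝓗, Finset.mem_biUnion, Finset.mem_image] at hi
    obtain ⟨pq, hpq, m, -, rfl⟩ := hi
    obtain ⟨h₁, h₂⟩ := hA hpq
    rw [hGa _ h₁]
    exact ⟨⟨h₁, h₂⟩, m, rfl⟩
  refine b.mem_of_hosts hJ hk₀ I 𝓗
    (fun k l i hk hl => (hmemI.1 hk).1.2.symm.trans (hmemI.1 hl).1.2)
    (fun k l i hk hl => ?_)
    (fun k i hi => (hmemI.1 hi).2) (fun k i hi => (hmemH hi).1.2) (fun i j h => ?_)
    fun k p hpk q hqk hpq => ?_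
  · obtain ⟨⟨hiF, -⟩, m, hm⟩ := hmemH hk
    obtain ⟨-, m', hm'⟩ := hmemH hl
    exact (Nat.pair_eq_pair.1 (hGinj _ hiF (hm.symm.trans hm'))).1
  · obtain ⟨hi, hj, hne⟩ := HilbertBasis.entry_compression_ne_zero h
    obtain ⟨hlt, hiF, hjF, hg⟩ := hY i j hne
    exact ⟨hlt, g (ρ i), hmemI.2 ⟨⟨hiF, rfl⟩, hi⟩, hmemI.2 ⟨⟨hjF, hg.symm⟩, hj⟩⟩
  · have hpqA : (p, q) ∈ A k := by
      simp only [A, Finset.mem_filter, Finset.mem_product]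
      exact ⟨⟨hpk, hqk⟩, hpq⟩
    have hlt : p < r p q ∧ r p q < q := by
      obtain ⟨i, hi, rfl⟩ := Finset.mem_image.1 hpk
      obtain ⟨j, hj, rfl⟩ := Finset.mem_image.1 hqk
      rw [hmemI] at hi hj
      have := hr _ _ hi.1.1 hj.1.1 hi.2 hj.2 hpq
      exact ⟨this.1, this.2.1⟩
    refine ⟨r p q, hlt.1, hlt.2, (min_le_left _ _).trans ((Finset.card_filter_le _ _).trans ?_)⟩
    have hrF := (hA hpqA).1
    have hcard : ((Finset.range (I k).card).image fun m => G (r p q) (Nat.pair k m)).card =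
        (I k).card := by
      rw [Finset.card_image_of_injective, Finset.card_range]
      intro m m' h
      exact (Nat.pair_eq_pair.1 (hGinj _ hrF h)).2
    rw [← hcard]
    refine Finset.card_le_card fun i hi => Finset.mem_filter.2
      ⟨Finset.mem_biUnion.2 ⟨(p, q), hpqA, hi⟩, ?_⟩
    obtain ⟨m, -, rfl⟩ := Finset.mem_image.1 hi
    exact hGa _ hrF _

theorem HilbertBasis.strict_mem [Countable ι] [Countable α] (hsurj : Function.Surjective a)
    (hJ : IsIdealOfSet (b.supp fun i j => a i ≤ a j) J)
    (hM : IsMaximalIdealOfSet (b.supp fun i j => a i = a j) (J ∩ b.supp fun i j => a i = a j))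
    {R : H →L[ℂ] H} (hR : R ∈ b.supp fun i j => a i < a j) : R ∈ J := by
  have hRT : R ∈ b.supp fun i j => a i ≤ a j := HilbertBasis.supp_mono (fun _ _ => le_of_lt) hR
  have hRlt : ∀ {i j}, b.entry R i j ≠ 0 → a i < a j := fun {i j} h => by
    by_contra h'
    exact h (hR i j h')
  by_cases hp : ∀ p, b.basisProj (a ⁻¹' {p}) ∈ J
  · obtain ⟨e, he⟩ := exists_injective_nat α
    obtain ⟨ρ, hρ⟩ := exists_injective_nat ι
    rcases b.basisProj_preimage_mem_or hM {p | (a ⁻¹' {p}).Finite} with h | h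
    · refine HilbertBasis.mem_of_compression_mem hJ (S := a ⁻¹' {p | (a ⁻¹' {p}).Finite}ᶜ) ?_ hRT ?_
      · rw [← Set.preimage_compl, compl_compl]
        exact h.1
      · refine HilbertBasis.mem_of_infinite_fibers hJ hM he hρ hp
          (F := {p | (a ⁻¹' {p}).Finite}ᶜ) (fun p hp => hp) fun i j hij => ?_
        obtain ⟨hi, hj, hne⟩ := HilbertBasis.entry_compression_ne_zero hij
        exact ⟨hRlt hne, hi, hj⟩
    · refine HilbertBasis.mem_of_compression_mem hJ (S := a ⁻¹' {p | (a ⁻¹' {p}).Finite}) ?_ hRT ?_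
      · exact h.1
      · refine HilbertBasis.mem_of_finite_fibers hJ hM hsurj he hp
          (F := {p | (a ⁻¹' {p}).Finite}) (fun p hp => hp) fun i j hij => ?_
        obtain ⟨hi, hj, hne⟩ := HilbertBasis.entry_compression_ne_zero hij
        exact ⟨hRlt hne, hi, hj⟩
  · push Not at hp
    obtain ⟨p, hp⟩ := hp
    have hpc := ((b.basisProj_preimage_mem_or hM {p}).resolve_left fun h => hp h.1).1
    refine HilbertBasis.mem_of_compression_mem hJ (S := a ⁻¹' {p}) hpc hRT ?_
    have h0 : b.basisProj (a ⁻¹' {p}) * R * b.basisProj (a ⁻¹' {p}) = 0 := by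
      refine b.entry_ext fun i j => ?_
      rw [b.entry_zero]
      by_contra h
      obtain ⟨hi, hj, hne⟩ := HilbertBasis.entry_compression_ne_zero h
      exact (hRlt hne).ne (Eq.trans (show a i = p from hi) (show a j = p from hj).symm)
    rw [h0]
    exact hJ.2.1

end StrictPart

section TriangularIdeals

variable {ι : Type*} {b : HilbertBasis ι ℂ H} {α : Type*} [LinearOrder α] {a : ι → α}
  {J : Set (H →L[ℂ] H)}

theorem HilbertBasis.exists_diagonal_add_strict {X : H →L[ℂ] H}
    (hX : X ∈ b.supp fun i j => a i ≤ a j) :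
    ∃ d ∈ b.supp fun i j => a i = a j, X - d ∈ b.supp fun i j => a i < a j := by
  obtain ⟨d, hsame, hdiff⟩ := b.exists_pinching a X
  refine ⟨d, hdiff, fun i j hij => ?_⟩
  rw [b.entry_sub]
  by_cases h : a i = a j
  · rw [hsame i j h, sub_self]
  · rw [hdiff i j h, hX i j fun h' => hij (lt_of_le_of_ne h' h), sub_zero]

theorem HilbertBasis.diagonal_subset_triangular :
    (b.supp fun i j => a i = a j) ⊆ b.supp fun i j => a i ≤ a j :=
  HilbertBasis.supp_mono fun _ _ => le_of_eq

theorem HilbertBasis.strict_subset_triangular :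
    (b.supp fun i j => a i < a j) ⊆ b.supp fun i j => a i ≤ a j :=
  HilbertBasis.supp_mono fun _ _ => le_of_lt

theorem HilbertBasis.eq_zero_of_diagonal_of_strict {X : H →L[ℂ] H}
    (hd : X ∈ b.supp fun i j => a i = a j) (hs : X ∈ b.supp fun i j => a i < a j) : X = 0 :=
  b.entry_ext fun i j => by
    rw [b.entry_zero]
    by_cases h : a i = a j
    · exact hs i j h.not_lt
    · exact hd i j h

theorem HilbertBasis.isIdealOfSet_add_strict {M : Set (H →L[ℂ] H)}
    (hMT : M ⊆ b.supp fun i j => a i ≤ a j) (h0 : (0 : H →L[ℂ] H) ∈ M)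
    (hadd : ∀ X ∈ M, ∀ Y ∈ M, X + Y ∈ M) (hsmul : ∀ c : ℂ, ∀ X ∈ M, c • X ∈ M)
    (hmul : ∀ T ∈ b.supp fun i j => a i ≤ a j, ∀ m ∈ M,
      (∃ m' ∈ M, T * m - m' ∈ b.supp fun i j => a i < a j) ∧
      ∃ m' ∈ M, m * T - m' ∈ b.supp fun i j => a i < a j) :
    IsIdealOfSet (b.supp fun i j => a i ≤ a j)
      {X | ∃ m ∈ M, X - m ∈ b.supp fun i j => a i < a j} := by
  refine ⟨?_, ⟨0, h0, ?_⟩, ?_, ?_, ?_⟩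
  · rintro X ⟨m, hm, h⟩
    rw [← sub_add_cancel X m]
    exact HilbertBasis.add_mem_supp (HilbertBasis.strict_subset_triangular h) (hMT hm)
  · rw [sub_zero]
    exact HilbertBasis.zero_mem_supp
  · rintro X ⟨m, hm, h⟩ Y ⟨m', hm', h'⟩
    refine ⟨m + m', hadd m hm m' hm', ?_⟩
    rw [add_sub_add_comm]
    exact HilbertBasis.add_mem_supp h h'
  · rintro c X ⟨m, hm, h⟩
    refine ⟨c • m, hsmul c m hm, ?_⟩
    rw [← smul_sub]
    exact HilbertBasis.smul_mem_supp c h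
  · rintro T hT X ⟨m, hm, h⟩
    obtain ⟨⟨m₁, hm₁, h₁⟩, m₂, hm₂, h₂⟩ := hmul T hT m hm
    refine ⟨⟨m₁, hm₁, ?_⟩, m₂, hm₂, ?_⟩
    · rw [show T * X - m₁ = T * (X - m) + (T * m - m₁) by rw [mul_sub]; abel]
      exact HilbertBasis.add_mem_supp
        (HilbertBasis.mul_mem_supp hT h fun _ _ _ => lt_of_le_of_lt) h₁
    · rw [show X * T - m₂ = (X - m) * T + (m * T - m₂) by rw [sub_mul]; abel]
      exact HilbertBasis.add_mem_supp
        (HilbertBasis.mul_mem_supp h hT fun _ _ _ => lt_of_lt_of_le) h₂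

theorem HilbertBasis.isIdealOfSet_inter_diagonal
    (hJ : IsIdealOfSet (b.supp fun i j => a i ≤ a j) J) :
    IsIdealOfSet (b.supp fun i j => a i = a j) (J ∩ b.supp fun i j => a i = a j) := by
  obtain ⟨-, h0, hadd, hsmul, hmul⟩ := hJ
  refine ⟨Set.inter_subset_right, ⟨h0, HilbertBasis.zero_mem_supp⟩,
    fun X hX Y hY => ⟨hadd X hX.1 Y hY.1, HilbertBasis.add_mem_supp hX.2 hY.2⟩,
    fun c X hX => ⟨hsmul c X hX.1, HilbertBasis.smul_mem_supp c hX.2⟩, fun T hT X hX => ?_⟩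
  have h := hmul T (HilbertBasis.diagonal_subset_triangular hT) X hX.1
  exact ⟨⟨h.1, HilbertBasis.mul_mem_supp hT hX.2 fun _ _ _ => Eq.trans⟩,
    ⟨h.2, HilbertBasis.mul_mem_supp hX.2 hT fun _ _ _ => Eq.trans⟩⟩

theorem HilbertBasis.strict_subset_of_isMaximalIdealOfSet
    (hJ : IsMaximalIdealOfSet (b.supp fun i j => a i ≤ a j) J) :
    (b.supp fun i j => a i < a j) ⊆ J := by
  obtain ⟨hI, hne, hmax⟩ := hJ
  have hid := HilbertBasis.isIdealOfSet_add_strict hI.1 hI.2.1 hI.2.2.1 hI.2.2.2.1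
    fun T hT m hm => ⟨⟨T * m, (hI.2.2.2.2 T hT m hm).1, by
      rw [sub_self]; exact HilbertBasis.zero_mem_supp⟩, m * T, (hI.2.2.2.2 T hT m hm).2, by
      rw [sub_self]; exact HilbertBasis.zero_mem_supp⟩
  rcases hmax _ hid fun X hX => ⟨X, hX, by
    rw [sub_self]; exact HilbertBasis.zero_mem_supp⟩ with h | h
  · intro X hX
    rw [← h]
    exact ⟨0, hI.2.1, by rwa [sub_zero]⟩
  · have h1 : (1 : H →L[ℂ] H) ∈ {X | ∃ m ∈ J, X - m ∈ b.supp fun i j => a i < a j} := by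
      rw [h]
      exact HilbertBasis.one_mem_supp fun _ => le_rfl
    obtain ⟨m, hm, hs⟩ := h1
    exact absurd (hI.eq_of_one_mem (b.one_mem_of_one_sub_strict_mem a hs hI
      (by rwa [sub_sub_cancel]))) hne

theorem HilbertBasis.isMaximalIdealOfSet_iff [Countable ι] [Countable α]
    (hsurj : Function.Surjective a) (hJ : IsIdealOfSet (b.supp fun i j => a i ≤ a j) J) :
    IsMaximalIdealOfSet (b.supp fun i j => a i ≤ a j) J ↔
      IsMaximalIdealOfSet (b.supp fun i j => a i = a j) (J ∩ b.supp fun i j => a i = a j) := by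
  constructor
  · intro hM
    have hR := HilbertBasis.strict_subset_of_isMaximalIdealOfSet hM
    refine ⟨HilbertBasis.isIdealOfSet_inter_diagonal hJ, fun h => hM.2.1 ?_, fun J' hJ' hsub => ?_⟩
    · refine hJ.eq_of_one_mem (h.ge ?_).1
      exact HilbertBasis.one_mem_supp fun _ => rfl
    have hid := HilbertBasis.isIdealOfSet_add_strict
      (hJ'.1.trans HilbertBasis.diagonal_subset_triangular) hJ'.2.1 hJ'.2.2.1 hJ'.2.2.2.1
      fun T hT m hm => by
        obtain ⟨d, hd, hs⟩ := HilbertBasis.exists_diagonal_add_strict hT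
        have hmT := HilbertBasis.diagonal_subset_triangular (hJ'.1 hm)
        refine ⟨⟨d * m, (hJ'.2.2.2.2 d hd m hm).1, ?_⟩, m * d, (hJ'.2.2.2.2 d hd m hm).2, ?_⟩
        · rw [← sub_mul]
          exact HilbertBasis.mul_mem_supp hs hmT fun _ _ _ => lt_of_lt_of_le
        · rw [← mul_sub]
          exact HilbertBasis.mul_mem_supp hmT hs fun _ _ _ => lt_of_le_of_lt
    rcases hM.2.2 _ hid fun X hX => by
      obtain ⟨d, hd, hs⟩ := HilbertBasis.exists_diagonal_add_strict (hJ.1 hX)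
      refine ⟨d, hsub ⟨?_, hd⟩, hs⟩
      rw [← sub_sub_cancel X d]
      exact hJ.sub_mem hX (hR hs) with h | h
    · left
      refine Set.Subset.antisymm (fun X hX => ⟨?_, hJ'.1 hX⟩) hsub
      rw [← h]
      exact ⟨X, hX, by rw [sub_self]; exact HilbertBasis.zero_mem_supp⟩
    · right
      have h1 : (1 : H →L[ℂ] H) ∈ {X | ∃ m ∈ J', X - m ∈ b.supp fun i j => a i < a j} := by
        rw [h]
        exact HilbertBasis.one_mem_supp fun _ => le_rfl
      obtain ⟨m, hm, hs⟩ := h1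
      have h0 := HilbertBasis.eq_zero_of_diagonal_of_strict
        (HilbertBasis.sub_mem_supp (HilbertBasis.one_mem_supp fun _ => rfl) (hJ'.1 hm)) hs
      rw [sub_eq_zero] at h0
      exact hJ'.eq_of_one_mem (h0 ▸ hm)
  · intro hM
    refine ⟨hJ, fun h => ?_, fun J' hJ' hsub => ?_⟩
    · refine HilbertBasis.one_notMem_of_isMaximalIdealOfSet hM ?_
      rw [h]
      exact HilbertBasis.one_mem_supp fun _ => le_rfl
    rcases hM.2.2 _ (HilbertBasis.isIdealOfSet_inter_diagonal hJ')
      (Set.inter_subset_inter_left _ hsub) with h | h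
    · left
      refine Set.Subset.antisymm (fun X hX => ?_) hsub
      obtain ⟨d, hd, hs⟩ := HilbertBasis.exists_diagonal_add_strict (hJ'.1 hX)
      have hsJ := HilbertBasis.strict_mem hsurj hJ hM hs
      have hdJ : d ∈ J' ∩ b.supp fun i j => a i = a j := by
        refine ⟨?_, hd⟩
        rw [← sub_sub_cancel X d]
        exact hJ'.sub_mem hX (hsub hsJ)
      rw [h] at hdJ
      rw [← sub_add_cancel X d]
      exact hJ.2.2.1 _ hsJ _ hdJ.1
    · right
      refine hJ'.eq_of_one_mem (h.ge ?_).1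
      exact HilbertBasis.one_mem_supp fun _ => rfl

end TriangularIdeals

section AtomicNests

theorem Orthonormal.countable_index {ι : Type*} {v : ι → H} (hv : Orthonormal ℂ v) :
    Countable ι := by
  refine Pairwise.countable_of_isOpen_disjoint (s := fun i => Metric.ball (v i) (1 / 2))
    (fun i j hij => Metric.ball_disjoint_ball ?_) (fun i => Metric.isOpen_ball)
    fun i => ⟨v i, Metric.mem_ball_self (by norm_num)⟩
  have h : ‖v i - v j‖ ^ 2 = 2 := by
    rw [@norm_sub_sq ℂ, hv.2 hij, hv.1, hv.1]
    norm_num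
  rw [dist_eq_norm]
  nlinarith [norm_nonneg (v i - v j)]

theorem exists_adapted_hilbertBasis {E : ℕ → H →L[ℂ] H} (hsa : ∀ n, IsSelfAdjoint (E n))
    (hidem : ∀ n, E n * E n = E n) (horth : ∀ m n, m ≠ n → E m * E n = 0)
    (hsum : ∀ x, HasSum (fun n => E n x) x) :
    ∃ (ι : Type u) (b : HilbertBasis ι ℂ H) (a : ι → {n // E n ≠ 0}),
      Function.Surjective a ∧ ∀ i, E (a i) (b i) = b i := by
  let K : {n // E n ≠ 0} → Submodule ℂ H := fun n => (1 - E n).ker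
  have hK : ∀ n x, x ∈ K n ↔ E n x = x := fun n x => by
    simp only [K, LinearMap.mem_ker, ContinuousLinearMap.coe_coe, _root_.sub_apply]
    exact sub_eq_zero.trans eq_comm
  have hsymm : ∀ n x y, inner ℂ (E n x) y = inner ℂ x (E n y) := fun n x y =>
    (ContinuousLinearMap.isSelfAdjoint_iff_isSymmetric.1 (hsa n)) x y
  have hfam : OrthogonalFamily ℂ (fun n => K n) fun n => (K n).subtypeₗᵢ := by
    rintro n m hnm ⟨x, hx⟩ ⟨y, hy⟩
    rw [hK] at hx hy
    change inner ℂ x y = 0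
    rw [← hx, ← hy, hsymm, ← mul_apply_eq_comp, horth _ _ fun h => hnm (Subtype.ext h)]
    simp
  have hEK : ∀ (n : {n // E n ≠ 0}) x, E n x ∈ K n := fun n x => by
    rw [hK, ← mul_apply_eq_comp, hidem]
  choose w B hB using fun n => exists_hilbertBasis ℂ (K n)
  have hzero : ∀ (n : {n // E n ≠ 0}) x, (∀ i : w n, inner ℂ ((B n i : K n) : H) (E n x) = 0) →
      E n x = 0 := fun n x h => by
    have : (⟨E n x, hEK n x⟩ : K n) = 0 := by
      refine (B n).repr.injective (lp.ext (funext fun i => ?_))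
      rw [(B n).repr_apply_apply, map_zero]
      exact h i
    exact congrArg Subtype.val this
  have hv : Orthonormal ℂ fun s : Σ n, w n => ((B s.1 s.2 : K s.1) : H) :=
    hfam.orthonormal_sigma_orthonormal fun n => (B n).orthonormal
  refine ⟨Σ n, w n, HilbertBasis.mkOfOrthogonalEqBot hv ?_, Sigma.fst, fun n => ?_, fun s => ?_⟩
  · rw [Submodule.eq_bot_iff]
    intro x hx
    rw [Submodule.mem_orthogonal] at hx
    have h0 : ∀ n, E n x = 0 := fun n => by
      by_cases hn : E n = 0
      · rw [hn]
        rfl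
      refine hzero ⟨n, hn⟩ x fun i => ?_
      have hi := (hK ⟨n, hn⟩ _).1 (B ⟨n, hn⟩ i).2
      dsimp only at hi ⊢
      rw [← hsymm, hi]
      exact hx _ (Submodule.subset_span ⟨⟨⟨n, hn⟩, i⟩, rfl⟩)
    have := hsum x
    simp only [h0] at this
    exact this.unique hasSum_zero
  · by_contra h
    refine n.2 (ContinuousLinearMap.ext fun x => hzero n x fun i => ?_)
    exact absurd ⟨⟨n, i⟩, rfl⟩ h
  · rw [HilbertBasis.coe_mkOfOrthogonalEqBot]
    exact (hK _ _).1 (B s.1 s.2).2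

theorem Nest.mul_eq_left {𝒩 : Nest H} {P Q : H →L[ℂ] H} (hP : P ∈ 𝒩.carrier) (hQ : Q ∈ 𝒩.carrier)
    (h : Q * P = P) : P * Q = P := by
  have := congrArg star h
  rwa [star_mul, (𝒩.isProj P hP).1.star_eq, (𝒩.isProj Q hQ).1.star_eq] at this

theorem IsAtomOf.ne_zero {𝒩 : Nest H} {E : H →L[ℂ] H} (hE : IsAtomOf 𝒩 E) : E ≠ 0 := by
  obtain ⟨M, hM, N, hN, hlt, rfl, -⟩ := hE
  exact sub_ne_zero.2 hlt.2.symm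

theorem IsAtomOf.isSelfAdjoint {𝒩 : Nest H} {E : H →L[ℂ] H} (hE : IsAtomOf 𝒩 E) :
    IsSelfAdjoint E := by
  obtain ⟨M, hM, N, hN, -, rfl, -⟩ := hE
  exact (𝒩.isProj N hN).1.sub (𝒩.isProj M hM).1

theorem IsAtomOf.mul_self {𝒩 : Nest H} {E : H →L[ℂ] H} (hE : IsAtomOf 𝒩 E) : E * E = E := by
  obtain ⟨M, hM, N, hN, hlt, rfl, -⟩ := hE
  have h₁ : N * M = M := hlt.1
  have h₂ := 𝒩.mul_eq_left hM hN h₁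
  rw [sub_mul, mul_sub, mul_sub, h₁, h₂, (𝒩.isProj N hN).2, (𝒩.isProj M hM).2]
  abel

theorem IsAtomOf.mul_eq_self_or_eq_zero {𝒩 : Nest H} {E : H →L[ℂ] H} (hE : IsAtomOf 𝒩 E)
    {P : H →L[ℂ] H} (hP : P ∈ 𝒩.carrier) : P * E = E ∨ P * E = 0 := by
  obtain ⟨M, hM, N, hN, hlt, rfl, hmin⟩ := hE
  have h₁ : N * M = M := hlt.1
  rw [mul_sub]
  rcases 𝒩.chain P hP M hM with hPM | hMP
  · right
    have h₂ := 𝒩.mul_eq_left hP hM hPM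
    have h₃ : P * N = P := by
      refine 𝒩.mul_eq_left hP hN ?_
      rw [← hPM, ← mul_assoc, h₁]
    rw [h₂, h₃, sub_self]
  · rcases 𝒩.chain P hP N hN with hPN | hNP
    · rcases hmin P hP hMP hPN with rfl | rfl
      · right
        rw [𝒩.mul_eq_left hM hN h₁, (𝒩.isProj _ hM).2, sub_self]
      · left
        rw [(𝒩.isProj _ hN).2, h₁]
    · left
      rw [hNP, hMP]

theorem IsAtomOf.false_of_mul_eq_self_iff {𝒩 : Nest H} {E F : H →L[ℂ] H} (hE : IsAtomOf 𝒩 E)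
    (hF : F ≠ 0) (hEF : E * F = 0)
    (h : ∀ P ∈ 𝒩.carrier, P * E = E ↔ P * F = F) (hor : ∀ P ∈ 𝒩.carrier, P * F = F ∨ P * F = 0) :
    False := by
  obtain ⟨M, hM, N, hN, hlt, rfl, hmin⟩ := hE
  have h₁ : N * M = M := hlt.1
  have hNF : N * F = F := (h N hN).1 (by rw [mul_sub, (𝒩.isProj N hN).2, h₁])
  have hMF : M * F = 0 := (hor M hM).resolve_left fun h' => IsAtomOf.ne_zero ⟨M, hM, N, hN, hlt, rfl, hmin⟩ <| by
    rw [← (h M hM).2 h', mul_sub, 𝒩.mul_eq_left hM hN h₁, (𝒩.isProj M hM).2, sub_self]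
  rw [sub_mul, hNF, hMF, sub_zero] at hEF
  exact hF hEF

theorem Nest.eq_basisProj {ι : Type*} {𝒩 : Nest H} {P : H →L[ℂ] H} (hP : P ∈ 𝒩.carrier)
    (b : HilbertBasis ι ℂ H) {F : ι → H →L[ℂ] H} (hFb : ∀ i, F i (b i) = b i)
    (hor : ∀ i, P * F i = F i ∨ P * F i = 0) : P = b.basisProj {i | P * F i = F i} := by
  refine ContinuousLinearMap.ext fun x => b.ext_inner fun i => ?_
  have hsymm : inner ℂ (b i) (P x) = inner ℂ (P (b i)) x :=
    ((ContinuousLinearMap.isSelfAdjoint_iff_isSymmetric.1 (𝒩.isProj P hP).1) (b i) x).symm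
  rw [hsymm, ← hFb i, ← mul_apply_eq_comp, hFb, b.inner_basisProj]
  split_ifs with h
  · rw [show P * F i = F i from h, hFb]
  · rw [(hor i).resolve_left h]
    simp

theorem Nest.isMaximalIdealOfSet_iff {𝒩 : Nest H} {ι α : Type*} [Countable α]
    (b : HilbertBasis ι ℂ H) {a : ι → α} (hsurj : Function.Surjective a) {E : α → H →L[ℂ] H}
    (hE : ∀ n, IsAtomOf 𝒩 (E n)) (horth : ∀ m n, m ≠ n → E m * E n = 0)
    (hab : ∀ i, E (a i) (b i) = b i) {J : Set (H →L[ℂ] H)}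
    (hJ : IsIdealOfSet (nestAlgebra 𝒩 : Set (H →L[ℂ] H)) J) :
    IsMaximalIdealOfSet (nestAlgebra 𝒩 : Set (H →L[ℂ] H)) J ↔
      IsMaximalIdealOfSet (diagAlgebra 𝒩) (J ∩ diagAlgebra 𝒩) := by
  classical
  have hor : ∀ n, ∀ P ∈ 𝒩.carrier, P * E n = E n ∨ P * E n = 0 :=
    fun n P hP => (hE n).mul_eq_self_or_eq_zero hP
  let : LinearOrder α :=
    { le := fun n m => ∀ P ∈ 𝒩.carrier, P * E m = E m → P * E n = E n
      le_refl := fun n P hP h => h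
      le_trans := fun n m k hnm hmk P hP h => hnm P hP (hmk P hP h)
      le_antisymm := fun n m hnm hmn => by
        by_contra hne
        exact (hE n).false_of_mul_eq_self_iff (hE m).ne_zero (horth _ _ hne)
          (fun P hP => ⟨hmn P hP, hnm P hP⟩) (hor m)
      le_total := fun n m => by
        by_contra! h
        obtain ⟨⟨P, hP, hPm, hPn⟩, Q, hQ, hQn, hQm⟩ := h
        rcases 𝒩.chain P hP Q hQ with h | h
        · exact hQm (by rw [← hPm, ← mul_assoc, h])
        · exact hPn (by rw [← hQn, ← mul_assoc, h])
      toDecidableLE := Classical.decRel _ }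
  have hle : ∀ {n m}, n ≤ m ↔ ∀ P ∈ 𝒩.carrier, P * E m = E m → P * E n = E n := Iff.rfl
  have hproj : ∀ P ∈ 𝒩.carrier, P = b.basisProj {i | P * E (a i) = E (a i)} := fun P hP =>
    𝒩.eq_basisProj hP b hab fun i => hor _ P hP
  have hleft : ∀ P ∈ 𝒩.carrier, ∀ X i j, b.entry (P * X) i j =
      if P * E (a i) = E (a i) then b.entry X i j else 0 := fun P hP X i j => by
    conv_lhs => rw [hproj P hP]
    exact b.entry_basisProj_mul _ X i j
  have hright : ∀ P ∈ 𝒩.carrier, ∀ X i j, b.entry (X * P) i j =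
      if P * E (a j) = E (a j) then b.entry X i j else 0 := fun P hP X i j => by
    conv_lhs => rw [hproj P hP]
    exact b.entry_mul_basisProj _ X i j
  have hT : (nestAlgebra 𝒩 : Set (H →L[ℂ] H)) = b.supp fun i j => a i ≤ a j := by
    ext X
    have hentry : ∀ P ∈ 𝒩.carrier, ∀ i j, b.entry ((1 - P) * X * P) i j =
        if P * E (a j) = E (a j) then (if P * E (a i) = E (a i) then 0 else b.entry X i j)
        else 0 := fun P hP i j => by
      rw [hright P hP, sub_mul, one_mul, b.entry_sub, hleft P hP]
      split_ifs <;> simp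
    constructor
    · intro hX i j hij
      by_contra h0
      refine hij (hle.2 fun P hP hj => ?_)
      by_contra hi
      have := hentry P hP i j
      rw [if_pos hj, if_neg hi, hX P hP, b.entry_zero] at this
      exact h0 this.symm
    · intro hX P hP
      refine b.entry_ext fun i j => ?_
      rw [hentry P hP, b.entry_zero]
      split_ifs with hj hi
      · rfl
      · exact hX i j fun h => hi (hle.1 h P hP hj)
      · rfl
  have hD : diagAlgebra 𝒩 = b.supp fun i j => a i = a j := by
    ext X
    constructor
    · intro hX i j hij
      by_contra h0
      have hiff : ∀ P ∈ 𝒩.carrier, P * E (a i) = E (a i) ↔ P * E (a j) = E (a j) :=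
        fun P hP => by
          have key : b.entry (P * X) i j = b.entry (X * P) i j := by rw [hX P hP]
          rw [hleft P hP, hright P hP] at key
          split_ifs at key with hi hj hj
          · exact iff_of_true hi hj
          · exact absurd key h0
          · exact absurd key.symm h0
          · exact iff_of_false hi hj
      exact hij (le_antisymm (hle.2 fun P hP => (hiff P hP).2) (hle.2 fun P hP => (hiff P hP).1))
    · intro hX P hP
      refine b.entry_ext fun i j => ?_
      rw [hleft P hP, hright P hP]
      by_cases h : a i = a j
      · rw [h]
      · rw [hX i j h, ite_self, ite_self]
  have := b.orthonormal.countable_index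
  rw [hT] at hJ ⊢
  rw [hD]
  exact HilbertBasis.isMaximalIdealOfSet_iff hsurj hJ

end AtomicNests

/-- for an atomic nest `𝒩` and a two-sided ideal `J` of `T(𝒩)`, `J` is a
maximal two-sided ideal of `T(𝒩)` iff `J ∩ D(𝒩)` is a maximal two-sided ideal of the
diagonal algebra `D(𝒩)`. -/
theorem statement16 (𝒩 : Nest H) (hatomic : IsAtomicNest 𝒩) (J : Set (H →L[ℂ] H))
    (hJ : IsIdealOfSet (nestAlgebra 𝒩 : Set (H →L[ℂ] H)) J) :
    IsMaximalIdealOfSet (nestAlgebra 𝒩 : Set (H →L[ℂ] H)) J ↔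
      IsMaximalIdealOfSet (diagAlgebra 𝒩) (J ∩ diagAlgebra 𝒩) := by
  obtain ⟨E, hE, horth, hsum⟩ := hatomic
  obtain ⟨ι, b, a, hsurj, hab⟩ := exists_adapted_hilbertBasis
    (fun n => (hE n).elim IsAtomOf.isSelfAdjoint fun h => by rw [h]; exact .zero _)
    (fun n => (hE n).elim IsAtomOf.mul_self fun h => by rw [h, mul_zero]) horth hsum
  exact Nest.isMaximalIdealOfSet_iff b hsurj (E := fun n => E n)
    (fun n => (hE n).resolve_right n.2)
    (fun m n hmn => horth _ _ fun h => hmn (Subtype.ext h)) hab hJ
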